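/- For a prime p, the set of primes p for which the group Γ₀(p)* (generated by Γ₀(p) and the Fricke involution W_p) has genus zero is exactly {2,3,5,7,11,13,17,19,23,29,31,41,47,59,71}. -/

import Mathlib

/-- The open upper half plane, as a subset of `ℂ`. -/
def UpperH : Set ℂ := {z : ℂ | 0 < z.im}

/-- Möbius action of a real matrix of determinant one on the upper half plane. -/
noncomputable def moebius (X : Matrix.SpecialLinearGroup (Fin 2) ℝ) (z : ℂ) : ℂ :=
  ((X.1 0 0 : ℂ) * z + (X.1 0 1 : ℂ)) / ((X.1 1 0 : ℂ) * z + (X.1 1 1 : ℂ))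

/-- The image of `Γ₀(p)` in `SL₂(ℝ)`. -/
def Gamma0InSLR (p : ℕ) : Set (Matrix.SpecialLinearGroup (Fin 2) ℝ) :=
  {X | ∃ a b c d : ℤ, (p : ℤ) ∣ c ∧
    X.1 0 0 = (a : ℝ) ∧ X.1 0 1 = (b : ℝ) ∧ X.1 1 0 = (c : ℝ) ∧ X.1 1 1 = (d : ℝ)}

/-- The Fricke involution `W_p = (1/√p)(0,−1;p,0)` in `SL₂(ℝ)`. -/
def FrickeSet (p : ℕ) : Set (Matrix.SpecialLinearGroup (Fin 2) ℝ) :=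
  {X | X.1 0 0 = 0 ∧ X.1 0 1 = -(Real.sqrt p)⁻¹ ∧
    X.1 1 0 = (p : ℝ) / Real.sqrt p ∧ X.1 1 1 = 0}

/-- `Γ₀(p)*`: the subgroup of `SL₂(ℝ)` generated by `Γ₀(p)` and the Fricke
involution `W_p`. -/
def Gamma0Star (p : ℕ) : Subgroup (Matrix.SpecialLinearGroup (Fin 2) ℝ) :=
  Subgroup.closure (Gamma0InSLR p ∪ FrickeSet p)

/-- `Γ₀(p)*` has genus zero: since `Γ₀(p)*` has a single cusp, this is equivalent
to the existence of a Hauptmodul, i.e. a holomorphic function on the upper half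
plane, invariant under `Γ₀(p)*`, which identifies the quotient `Γ₀(p)*\𝔥` with `ℂ`
(it separates exactly the orbits and attains every complex value). -/
def IsGenusZeroStar (p : ℕ) : Prop :=
  ∃ f : ℂ → ℂ, DifferentiableOn ℂ f UpperH ∧
    (∀ z ∈ UpperH, ∀ w ∈ UpperH, (f z = f w ↔ ∃ X ∈ Gamma0Star p, moebius X z = w)) ∧
    Set.SurjOn f UpperH Set.univ

section

open UpperHalfPlane Matrix Filter Topology
open scoped MatrixGroups

/-- Matrices of `Γ₀(p)` type. -/
def IsHeckeType (p : ℕ) (X : SL(2, ℝ)) : Prop :=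
  ∃ a b c d : ℤ, X.1 0 0 = a ∧ X.1 0 1 = b ∧ X.1 1 0 = p * c ∧ X.1 1 1 = d

/-- Matrices in the Atkin–Lehner coset of `Γ₀(p)`. -/
def IsFrickeType (p : ℕ) (X : SL(2, ℝ)) : Prop :=
  ∃ a b c d : ℤ, X.1 0 0 = a * √p ∧ X.1 0 1 = b / √p ∧ X.1 1 0 = c * √p ∧ X.1 1 1 = d * √p

theorem Gamma0Star.isHeckeType_or_isFrickeType {p : ℕ} (hp : p.Prime) {X : SL(2, ℝ)}
    (hX : X ∈ Gamma0Star p) : IsHeckeType p X ∨ IsFrickeType p X := by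
  have hp0 : (0 : ℝ) < p := by exact_mod_cast hp.pos
  have hs : √(p : ℝ) ≠ 0 := (Real.sqrt_pos.2 hp0).ne'
  have hss : √(p : ℝ) ^ 2 = p := Real.sq_sqrt hp0.le
  induction hX using Subgroup.closure_induction with
  | mem X h =>
    rcases h with ⟨a, b, c, d, ⟨c', rfl⟩, h1, h2, h3, h4⟩ | ⟨h1, h2, h3, h4⟩
    · exact Or.inl ⟨a, b, c', d, h1, h2, by simpa using h3, h4⟩
    · refine Or.inr ⟨0, -1, 1, 0, by simpa using h1, ?_, ?_, by simpa using h4⟩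
      · rw [h2]; push_cast; ring
      · rw [h3]; push_cast; field_simp; rw [hss]
  | one => exact Or.inl ⟨1, 0, 0, 1, by simp, by simp, by simp, by simp⟩
  | mul X Y _ _ hX hY =>
    rcases hX with ⟨a, b, c, d, h1, h2, h3, h4⟩ | ⟨a, b, c, d, h1, h2, h3, h4⟩ <;>
    rcases hY with ⟨a', b', c', d', h1', h2', h3', h4'⟩ | ⟨a', b', c', d', h1', h2', h3', h4'⟩
    · refine Or.inl ⟨a * a' + p * b * c', a * b' + b * d', c * a' + d * c', p * c * b' + d * d',
        ?_, ?_, ?_, ?_⟩ <;>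
      simp [Matrix.mul_apply, Fin.sum_univ_two, *] <;> ring
    · refine Or.inr ⟨a * a' + b * c', a * b' + p * b * d', p * c * a' + d * c', c * b' + d * d',
        ?_, ?_, ?_, ?_⟩ <;>
      simp [Matrix.mul_apply, Fin.sum_univ_two, *] <;> field_simp <;> simp only [hss] <;> ring
    · refine Or.inr ⟨a * a' + b * c', p * a * b' + b * d', c * a' + p * d * c', c * b' + d * d',
        ?_, ?_, ?_, ?_⟩ <;>
      simp [Matrix.mul_apply, Fin.sum_univ_two, *] <;> field_simp <;> simp only [hss] <;> ring
    · refine Or.inl ⟨p * a * a' + b * c', a * b' + b * d', c * a' + d * c', c * b' + p * d * d',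
        ?_, ?_, ?_, ?_⟩ <;>
      simp [Matrix.mul_apply, Fin.sum_univ_two, *] <;> field_simp <;> simp only [hss] <;> ring
  | inv X _ hX =>
    rcases hX with ⟨a, b, c, d, h1, h2, h3, h4⟩ | ⟨a, b, c, d, h1, h2, h3, h4⟩
    · refine Or.inl ⟨d, -b, -c, a, ?_, ?_, ?_, ?_⟩ <;>
      simp [Matrix.adjugate_fin_two, *]
    · refine Or.inr ⟨d, -b, -c, a, ?_, ?_, ?_, ?_⟩ <;>
      simp [Matrix.adjugate_fin_two, *, neg_div]

theorem moebius_eq (X : SL(2, ℝ)) (z : ℍ) : moebius X z = ((X • z : ℍ) : ℂ) := by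
  rw [UpperHalfPlane.coe_specialLinearGroup_apply]
  simp [moebius]

/-- The element of `Γ₀(p)*` given by an integral matrix. -/
theorem Gamma0Star.of_int {p : ℕ} (g : SL(2, ℤ)) (h : (p : ℤ) ∣ g 1 0) :
    (SpecialLinearGroup.map (Int.castRingHom ℝ) g) ∈ Gamma0Star p :=
  Subgroup.subset_closure (Or.inl ⟨g 0 0, g 0 1, g 1 0, g 1 1, h, by simp, by simp, by simp,
      by simp⟩)

theorem map_smul_eq (g : SL(2, ℤ)) (z : ℍ) :
    (SpecialLinearGroup.map (Int.castRingHom ℝ) g) • z = g • z := by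
  ext
  rw [UpperHalfPlane.coe_specialLinearGroup_apply, UpperHalfPlane.coe_specialLinearGroup_apply]
  simp

/-- The Fricke involution as a matrix. -/
noncomputable def fricke (p : ℕ) [NeZero p] : SL(2, ℝ) :=
  ⟨!![0, -(√p)⁻¹; √p, 0], by
    have : (0 : ℝ) < p := by exact_mod_cast Nat.pos_of_ne_zero (NeZero.ne p)
    simp [Matrix.det_fin_two, (Real.sqrt_pos.2 this).ne']⟩

theorem fricke_mem (p : ℕ) [NeZero p] : fricke p ∈ Gamma0Star p := by
  refine Subgroup.subset_closure (Or.inr ⟨?_, ?_, ?_, ?_⟩) <;> simp [fricke]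

theorem coe_fricke_smul (p : ℕ) [NeZero p] (z : ℍ) :
    ((fricke p • z : ℍ) : ℂ) = -1 / (p * z) := by
  have h0 : (0 : ℝ) < p := by exact_mod_cast Nat.pos_of_ne_zero (NeZero.ne p)
  have h1 : ((√p : ℝ) : ℂ) ≠ 0 := by exact_mod_cast (Real.sqrt_pos.2 h0).ne'
  have h2 : ((√p : ℝ) : ℂ) ^ 2 = p := by exact_mod_cast Real.sq_sqrt h0.le
  have h3 : (p : ℂ) ≠ 0 := by exact_mod_cast h0.ne'
  have := UpperHalfPlane.ne_zero z
  rw [UpperHalfPlane.coe_specialLinearGroup_apply]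
  simp [fricke]
  rw [← h2]; field_simp

end

section

open UpperHalfPlane Matrix Filter Topology
open scoped MatrixGroups

theorem SL2_mul_apply {R : Type*} [CommRing R] (A B : SL(2, R)) (i j : Fin 2) :
    (A * B) i j = A i 0 * B 0 j + A i 1 * B 1 j := by
  simp [Matrix.mul_apply, Fin.sum_univ_two]

/-- Every element of `Γ₀(p)*` is an element of `Γ₀(p)`, or such an element times `W_p`. -/
theorem Gamma0Star.exists_int {p : ℕ} [NeZero p] (hp : p.Prime) {X : SL(2, ℝ)}
    (hX : X ∈ Gamma0Star p) : ∃ g : SL(2, ℤ), (p : ℤ) ∣ g 1 0 ∧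
      (X = SpecialLinearGroup.map (Int.castRingHom ℝ) g ∨
        X = SpecialLinearGroup.map (Int.castRingHom ℝ) g * fricke p) := by
  have hp0 : (0 : ℝ) < p := by exact_mod_cast hp.pos
  have hs : √(p : ℝ) ≠ 0 := (Real.sqrt_pos.2 hp0).ne'
  have hss : √(p : ℝ) ^ 2 = p := Real.sq_sqrt hp0.le
  have hdet := X.2
  rw [Matrix.det_fin_two] at hdet
  rcases Gamma0Star.isHeckeType_or_isFrickeType hp hX with
    ⟨a, b, c, d, h1, h2, h3, h4⟩ | ⟨a, b, c, d, h1, h2, h3, h4⟩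
  · have hd : (!![a, b; p * c, d] : Matrix (Fin 2) (Fin 2) ℤ).det = 1 := by
      rw [Matrix.det_fin_two]
      rw [h1, h2, h3, h4] at hdet
      simp; exact_mod_cast hdet
    obtain ⟨g, hg⟩ : ∃ g : SL(2, ℤ), g.1 = !![a, b; p * c, d] := ⟨⟨_, hd⟩, rfl⟩
    refine ⟨g, by simp [hg], Or.inl ?_⟩
    ext i j
    rw [SpecialLinearGroup.map_apply_coe, hg]
    fin_cases i <;> fin_cases j <;> simp [*]
  · have hd : (!![-b, a; -(p * d), c] : Matrix (Fin 2) (Fin 2) ℤ).det = 1 := by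
      rw [Matrix.det_fin_two]
      rw [h1, h2, h3, h4] at hdet
      have : (p : ℝ) * a * d - b * c = 1 := by
        rw [← hdet]; field_simp; rw [hss]; ring
      have : (p : ℤ) * a * d - b * c = 1 := by exact_mod_cast this
      simp; linarith
    obtain ⟨g, hg⟩ : ∃ g : SL(2, ℤ), g.1 = !![-b, a; -(p * d), c] := ⟨⟨_, hd⟩, rfl⟩
    refine ⟨g, by simp [hg], Or.inr ?_⟩
    ext i j
    rw [SL2_mul_apply, SpecialLinearGroup.map_apply_coe, hg]
    fin_cases i <;> fin_cases j <;>
      simp [*, fricke] <;> field_simp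
    rw [hss]

theorem continuous_smul_SLR (g : SL(2, ℝ)) : Continuous fun z : ℍ ↦ g • z :=
  continuous_const_smul g

theorem finite_SL2Z_smul_inter {K L : Set ℍ} (hK : IsCompact K) (hL : IsCompact L) :
    {γ : SL(2, ℝ) | γ ∈ (SpecialLinearGroup.map (n := Fin 2) (Int.castRingHom ℝ)).range ∧
      ∃ z ∈ K, γ • z ∈ L}.Finite := by
  let S : Subgroup SL(2, ℝ) := (SpecialLinearGroup.map (Int.castRingHom ℝ)).range
  have : ProperlyDiscontinuousSMul S ℍ := inferInstance
  refine ((S.properlyDiscontinuousSMul_iff.1 this) hK hL).subset ?_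
  rintro γ ⟨hγ, z, hz, hzL⟩
  exact ⟨hγ, γ • z, ⟨z, hz, rfl⟩, hzL⟩

/-- Proper discontinuity of the action of `Γ₀(p)*`, in local form. -/
theorem Gamma0Star.exists_finite {p : ℕ} (hp : p.Prime) (z₀ w₀ : ℍ) :
    ∃ S : Set SL(2, ℝ), S.Finite ∧ (∀ γ ∈ S, γ ∈ Gamma0Star p ∧ γ • z₀ = w₀) ∧
      ∀ᶠ q : ℍ × ℍ in 𝓝 (z₀, w₀), (∃ γ ∈ Gamma0Star p, γ • q.1 = q.2) → ∃ γ ∈ S, γ • q.1 = q.2 := by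
  have : NeZero p := ⟨hp.ne_zero⟩
  obtain ⟨K, hK, hKz⟩ := exists_compact_mem_nhds z₀
  obtain ⟨L, hL, hLw⟩ := exists_compact_mem_nhds w₀
  have hA := finite_SL2Z_smul_inter hK hL
  have hB := finite_SL2Z_smul_inter (hK.image (continuous_smul_SLR (fricke p))) hL
  have hS₀ := hA.union (hB.image (fun g ↦ g * fricke p))
  set S₀ : Set SL(2, ℝ) := _ ∪ _
  refine ⟨{γ ∈ S₀ | γ ∈ Gamma0Star p ∧ γ • z₀ = w₀}, hS₀.subset (Set.sep_subset _ _),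
    fun γ h ↦ h.2, ?_⟩
  have hev : ∀ᶠ q : ℍ × ℍ in 𝓝 (z₀, w₀), ∀ γ ∈ S₀, γ • z₀ ≠ w₀ → γ • q.1 ≠ q.2 := by
    rw [Filter.eventually_all_finite hS₀]
    intro γ _
    by_cases h : γ • z₀ = w₀
    · simp [h]
    · have : ∀ᶠ q : ℍ × ℍ in 𝓝 (z₀, w₀), γ • q.1 ≠ q.2 := by
        have hc : ContinuousAt (fun q : ℍ × ℍ ↦ γ • q.1) (z₀, w₀) :=
          ((continuous_smul_SLR γ).comp continuous_fst).continuousAt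
        exact (hc.ne_iff_eventually_ne continuous_snd.continuousAt).1 h
      filter_upwards [this] with q hq _ using hq
  filter_upwards [hev, prod_mem_nhds hKz hLw] with q hq hqKL
  rintro ⟨γ, hγ, hγq⟩
  have hmem : γ ∈ S₀ := by
    obtain ⟨g, -, rfl | rfl⟩ := Gamma0Star.exists_int hp hγ
    · exact Or.inl ⟨⟨g, rfl⟩, q.1, hqKL.1, hγq ▸ hqKL.2⟩
    · refine Or.inr ⟨_, ⟨⟨g, rfl⟩, fricke p • q.1, ⟨q.1, hqKL.1, rfl⟩, ?_⟩, rfl⟩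
      rw [← mul_smul, hγq]; exact hqKL.2
  exact ⟨γ, ⟨hmem, hγ, by by_contra h; exact hq γ hmem h hγq⟩, hγq⟩

theorem Gamma0Star.T_mem (p : ℕ) :
    (SpecialLinearGroup.map (Int.castRingHom ℝ) ModularGroup.T) ∈ Gamma0Star p :=
  Gamma0Star.of_int _ (by simp [ModularGroup.T])

theorem Gamma0Star.exists_vadd_eq (p : ℕ) (n : ℤ) :
    ∃ γ ∈ Gamma0Star p, ∀ z : ℍ, γ • z = (n : ℝ) +ᵥ z := by
  refine ⟨_, zpow_mem (Gamma0Star.T_mem p) n, fun z ↦ ?_⟩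
  rw [← map_zpow, map_smul_eq, UpperHalfPlane.modular_T_zpow_smul]

/-- Every orbit of `Γ₀(p)*` meets a half plane bounded away from the real line. -/
theorem Gamma0Star.exists_le_im {p : ℕ} (hp : p.Prime) (z : ℍ) :
    ∃ γ ∈ Gamma0Star p, 1 / (2 * p) ≤ (γ • z).im ∧ |(γ • z).re| ≤ 1 := by
  have : NeZero p := ⟨hp.ne_zero⟩
  have hp0 : (0 : ℝ) < p := by exact_mod_cast hp.pos
  have hp1 : (1 : ℝ) ≤ p := by exact_mod_cast hp.one_le
  suffices h : ∃ γ ∈ Gamma0Star p, 1 / (2 * p) ≤ (γ • z).im by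
    obtain ⟨γ, hγ, h⟩ := h
    obtain ⟨δ, hδ, hδz⟩ := Gamma0Star.exists_vadd_eq p (-⌊(γ • z).re⌋)
    refine ⟨δ * γ, mul_mem hδ hγ, ?_, ?_⟩
    · rw [mul_smul, hδz]; simpa using h
    · rw [mul_smul, hδz]
      have h1 := Int.floor_le (γ • z).re
      have h2 := Int.lt_floor_add_one (γ • z).re
      simp only [UpperHalfPlane.vadd_re]; push_cast
      rw [abs_le]; constructor <;> linarith
  obtain ⟨g, hg⟩ := ModularGroup.exists_smul_mem_fd z
  have him := ModularGroup.three_le_four_mul_im_sq_of_mem_fd hg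
  have him' : 1 / 2 ≤ (g • z).im := by nlinarith [(g • z).im_pos]
  by_cases hc : (p : ℤ) ∣ g 1 0
  · refine ⟨_, Gamma0Star.of_int g hc, ?_⟩
    rw [map_smul_eq]
    refine le_trans ?_ him'
    rw [div_le_div_iff₀ (by positivity) (by norm_num)]; linarith
  · have hcop : IsCoprime (p : ℤ) (g 1 0) :=
      (Nat.prime_iff_prime_int.1 hp).irreducible.coprime_iff_not_dvd.2 hc
    obtain ⟨u, v, huv⟩ := hcop
    set j : ℤ := -(g 0 0) * v with hj
    have hmem : (p : ℤ) ∣ (ModularGroup.S * ModularGroup.T ^ j * g) 1 0 := by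
      refine ⟨g 0 0 * u, ?_⟩
      rw [SL2_mul_apply, SL2_mul_apply, SL2_mul_apply, ModularGroup.coe_T_zpow]
      simp [ModularGroup.S, hj]
      linear_combination (-(g 0 0)) * huv
    refine ⟨_, mul_mem (fricke_mem p) (Gamma0Star.of_int _ hmem), ?_⟩
    rw [mul_smul, map_smul_eq, ← UpperHalfPlane.coe_im, coe_fricke_smul, mul_smul, mul_smul,
      UpperHalfPlane.modular_T_zpow_smul, UpperHalfPlane.modular_S_smul]
    have hne := UpperHalfPlane.ne_zero ((j : ℝ) +ᵥ g • z)
    have : (-1 / ((p : ℂ) * ((UpperHalfPlane.mk (-(((j : ℝ) +ᵥ g • z : ℍ) : ℂ))⁻¹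
        ((j : ℝ) +ᵥ g • z).im_inv_neg_coe_pos : ℍ) : ℂ))) =
        ((p : ℝ)⁻¹ : ℝ) * (((j : ℝ) +ᵥ g • z : ℍ) : ℂ) := by
      push_cast
      field_simp
    rw [this, Complex.im_ofReal_mul, UpperHalfPlane.coe_im, UpperHalfPlane.vadd_im]
    field_simp; linarith

theorem SL2R_sq_mul_im_mul_im_le (X : SL(2, ℝ)) (z : ℍ) :
    (X 1 0) ^ 2 * z.im * (X • z).im ≤ 1 := by
  have h1 := UpperHalfPlane.im_smul_eq_div_normSq (X : GL (Fin 2) ℝ) z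
  have h2 := UpperHalfPlane.c_mul_im_sq_le_normSq_denom (X : GL (Fin 2) ℝ) z
  have h3 := UpperHalfPlane.normSq_denom_pos (X : GL (Fin 2) ℝ) z.im_ne_zero
  have h4 : (X • z).im = ((X : GL (Fin 2) ℝ) • z).im := rfl
  rw [h4, h1]
  simp at h2 ⊢
  rw [← mul_div_assoc, div_le_one h3]
  linarith

/-- Above height one, `Γ₀(p)*` only identifies translates. -/
theorem Gamma0Star.eq_vadd_of_one_lt_im {p : ℕ} (hp : p.Prime) {γ : SL(2, ℝ)}
    (hγ : γ ∈ Gamma0Star p) {z : ℍ} (hz : 1 < z.im) (hw : 1 < (γ • z).im) :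
    ∃ n : ℤ, γ • z = (n : ℝ) +ᵥ z := by
  have hp0 : (1 : ℝ) < p := by exact_mod_cast hp.one_lt
  have hs : √(p : ℝ) ≠ 0 := (Real.sqrt_pos.2 (by linarith)).ne'
  have hss : √(p : ℝ) ^ 2 = p := Real.sq_sqrt (by linarith)
  have hdet := γ.2
  rw [Matrix.det_fin_two] at hdet
  have hlt : (γ.1 1 0) ^ 2 < 1 := by
    have := SL2R_sq_mul_im_mul_im_le γ z
    by_contra! h
    have h1 : 1 < z.im * (γ • z).im := one_lt_mul_of_lt_of_le hz hw.le
    have h2 : z.im * (γ • z).im ≤ γ.1 1 0 ^ 2 * (z.im * (γ • z).im) :=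
      le_mul_of_one_le_left (by linarith) h
    linarith
  rcases Gamma0Star.isHeckeType_or_isFrickeType hp hγ with
    ⟨a, b, c, d, h1, h2, h3, h4⟩ | ⟨a, b, c, d, h1, h2, h3, h4⟩
  · rw [h3, mul_pow] at hlt
    have hc : c = 0 := by
      by_contra hc
      have : (1 : ℝ) ≤ (c : ℝ) ^ 2 := by
        exact_mod_cast (Int.one_le_abs (pow_ne_zero 2 hc)).trans_eq (abs_of_nonneg (sq_nonneg c))
      nlinarith
    rw [h1, h2, h3, h4, hc] at hdet
    have had : a * d = 1 := by
      have : (a : ℝ) * d = 1 := by simpa using hdet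
      exact_mod_cast this
    refine ⟨b * a, ?_⟩
    ext
    rw [← moebius_eq, moebius, h1, h2, h3, h4, hc]
    rcases Int.mul_eq_one_iff_eq_one_or_neg_one.1 had with ⟨rfl, rfl⟩ | ⟨rfl, rfl⟩ <;>
      simp <;> ring
  · rw [h3, mul_pow, hss] at hlt
    have hc : c = 0 := by
      by_contra hc
      have : (1 : ℝ) ≤ (c : ℝ) ^ 2 := by
        exact_mod_cast (Int.one_le_abs (pow_ne_zero 2 hc)).trans_eq (abs_of_nonneg (sq_nonneg c))
      nlinarith
    rw [h1, h2, h3, h4, hc] at hdet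
    have : (p : ℝ) * a * d = 1 := by
      rw [← hdet]; simp; linear_combination (-(a : ℝ) * d) * hss
    have : (p : ℤ) * (a * d) = 1 := by rw [← mul_assoc]; exact_mod_cast this
    have := Int.isUnit_iff.1 (IsUnit.of_mul_eq_one _ this)
    have := hp.one_lt
    omega

end

section

open UpperHalfPlane Matrix Filter Topology Function
open scoped MatrixGroups Manifold
local notation "𝕢" => Function.Periodic.qParam

theorem periodic_comp_ofComplex_of_vadd {f : ℍ → ℂ} (h : ∀ z : ℍ, f ((1 : ℝ) +ᵥ z) = f z) :
    Periodic (f ∘ ofComplex) ((1 : ℝ) : ℂ) := by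
  intro w
  by_cases hw : 0 < w.im
  · have hw' : 0 < (w + ((1 : ℝ) : ℂ)).im := by simpa using hw
    simp only [Function.comp_apply, ofComplex_apply_of_im_pos hw, ofComplex_apply_of_im_pos hw']
    rw [← h ⟨w, hw⟩]
    congr 1
    ext
    simp [add_comm]
  · have hw' : (w + ((1 : ℝ) : ℂ)).im ≤ 0 := by simpa using hw
    rw [Function.comp_apply, Function.comp_apply, ofComplex_apply_of_im_nonpos (not_lt.1 hw),
      ofComplex_apply_of_im_nonpos hw']

/-- Invariance under `Γ₀(p)*`. -/
def IsStarInvariant (p : ℕ) (f : ℍ → ℂ) : Prop :=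
  ∀ γ ∈ Gamma0Star p, ∀ z : ℍ, f (γ • z) = f z

theorem IsStarInvariant.vadd_int {p : ℕ} {f : ℍ → ℂ} (h : IsStarInvariant p f) (n : ℤ) (z : ℍ) :
    f ((n : ℝ) +ᵥ z) = f z := by
  obtain ⟨γ, hγ, hz⟩ := Gamma0Star.exists_vadd_eq p n
  rw [← hz, h γ hγ]

theorem IsStarInvariant.periodic {p : ℕ} {f : ℍ → ℂ} (h : IsStarInvariant p f) :
    Periodic (f ∘ ofComplex) ((1 : ℝ) : ℂ) :=
  periodic_comp_ofComplex_of_vadd fun z ↦ by simpa using h.vadd_int 1 z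

theorem norm_qParam_lt_one (z : ℍ) : ‖𝕢 1 z‖ < 1 :=
  Function.Periodic.norm_qParam_lt_one one_pos z.im_pos

theorem exists_qParam_eq {q : ℂ} (h0 : q ≠ 0) (h1 : ‖q‖ < 1) : ∃ z : ℍ, 𝕢 1 z = q :=
  ⟨⟨_, Function.Periodic.im_invQParam_pos_of_norm_lt_one one_pos h1 h0⟩,
    Function.Periodic.qParam_right_inv one_ne_zero h0⟩

/-- A bounded invariant holomorphic function is constant. -/
theorem IsStarInvariant.eq_const {p : ℕ} (hp : p.Prime) {f : ℍ → ℂ} (h : IsStarInvariant p f)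
    (hf : MDiff f) (hb : IsBoundedAtImInfty f) : ∃ c, ∀ z, f z = c := by
  have hp0 : (0 : ℝ) < p := by exact_mod_cast hp.pos
  set G := UpperHalfPlane.cuspFunction 1 f with hG
  have hGz : ∀ z : ℍ, G (𝕢 1 z) = f z := fun z ↦ eq_cuspFunction z one_ne_zero h.periodic
  have hd : DifferentiableOn ℂ G (Metric.ball 0 1) :=
    differentiableOn_cuspFunction_ball one_pos h.periodic hf hb
  set r : ℝ := Real.exp (-2 * Real.pi * (1 / (2 * p))) with hr
  have hr1 : r < 1 := by
    rw [hr, Real.exp_lt_one_iff]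
    have := Real.pi_pos
    have : 0 < 2 * Real.pi * (1 / (2 * p)) := by positivity
    linarith
  have hsub : Metric.closedBall (0 : ℂ) r ⊆ Metric.ball 0 1 := Metric.closedBall_subset_ball hr1
  obtain ⟨q₀, hq₀, hmax⟩ := (isCompact_closedBall (0 : ℂ) r).exists_isMaxOn
    ⟨0, by simpa using (Real.exp_pos _).le⟩ ((hd.continuousOn.mono hsub).norm)
  have hmax' : IsMaxOn (norm ∘ G) (Metric.ball 0 1) q₀ := by
    intro q hq
    rw [mem_ball_zero_iff] at hq
    by_cases h0 : q = 0
    · exact hmax (by simpa [h0] using (Real.exp_pos _).le)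
    · obtain ⟨z, rfl⟩ := exists_qParam_eq h0 hq
      obtain ⟨γ, hγ, him, -⟩ := Gamma0Star.exists_le_im hp z
      have : G (𝕢 1 z) = G (𝕢 1 (γ • z : ℍ)) := by rw [hGz, hGz, h γ hγ]
      change ‖G (𝕢 1 z)‖ ≤ ‖G q₀‖
      rw [this]
      refine hmax ?_
      rw [mem_closedBall_zero_iff, Function.Periodic.norm_qParam, hr, Real.exp_le_exp]
      have := mul_le_mul_of_nonneg_left him Real.pi_pos.le
      simp only [coe_im, div_one]
      linarith
  have := Complex.eqOn_of_isPreconnected_of_isMaxOn_norm (convex_ball (0 : ℂ) 1).isPreconnected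
    Metric.isOpen_ball hd (hsub hq₀) hmax'
  refine ⟨G q₀, fun z ↦ ?_⟩
  rw [← hGz]
  exact this (by simpa using norm_qParam_lt_one z)

/-- A holomorphic function that vanishes at the cusp is bounded after division by `q`. -/
theorem isBoundedAtImInfty_div_qParam {f : ℍ → ℂ} (h : Periodic (f ∘ ofComplex) ((1 : ℝ) : ℂ))
    (hf : MDiff f) (h0 : IsZeroAtImInfty f) : IsBoundedAtImInfty fun z ↦ f z / 𝕢 1 z := by
  have hev : ∀ᶠ z in comap Complex.im atTop, DifferentiableAt ℂ (f ∘ ofComplex) z :=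
    eventually_of_mem (preimage_mem_comap (Ioi_mem_atTop 0))
        (fun z hz ↦ UpperHalfPlane.mdifferentiableAt_iff.mp (hf ⟨z, hz⟩))
  have := h.exp_decay_of_zero_at_inf one_pos hev
    (Tendsto.comp h0 tendsto_comap_im_ofComplex)
  obtain ⟨C, hC⟩ := (this.comp_tendsto tendsto_coe_atImInfty).bound
  refine Asymptotics.IsBigO.of_bound C ?_
  filter_upwards [hC] with z hz
  have h1 : ‖𝕢 1 z‖ = Real.exp (-2 * Real.pi * (z : ℂ).im / 1) :=
    Function.Periodic.norm_qParam 1 z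
  have h2 : 0 < ‖𝕢 1 z‖ := norm_pos_iff.2 (Function.Periodic.qParam_ne_zero _)
  rw [norm_div, div_le_iff₀ h2]
  rw [h1]
  simpa using hz

theorem tendsto_qParam : Tendsto (fun z : ℍ ↦ 𝕢 1 z) atImInfty (𝓝 0) :=
  qParam_tendsto_atImInfty one_pos

theorem mdifferentiable_qParam : MDiff (fun z : ℍ ↦ 𝕢 1 z) := by
  rw [UpperHalfPlane.mdifferentiable_iff]
  refine (Function.Periodic.differentiable_qParam (h := 1)).differentiableOn.congr
    (fun z hz ↦ ?_)
  simp [ofComplex_apply_of_im_pos hz]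

theorem periodic_qParam (z : ℍ) : 𝕢 1 (((1 : ℝ) +ᵥ z : ℍ) : ℂ) = 𝕢 1 z := by
  rw [coe_vadd, add_comm]
  simp [Function.Periodic.qParam, mul_add, Complex.exp_add]

/-- An invariant function with a pole of order at most `n` at the cusp is a polynomial in a
function with a simple pole. -/
theorem IsStarInvariant.exists_polynomial {p : ℕ} (hp : p.Prime) {f : ℍ → ℂ}
    (hfi : IsStarInvariant p f) (hf : MDiff f) {u : ℂ} (hu : u ≠ 0)
    (hfu : Tendsto (fun z : ℍ ↦ 𝕢 1 z * f z) atImInfty (𝓝 u)) (n : ℕ) :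
    ∀ g : ℍ → ℂ, IsStarInvariant p g → MDiff g →
      IsBoundedAtImInfty (fun z ↦ 𝕢 1 z ^ n * g z) →
      ∃ P : Polynomial ℂ, ∀ z, g z = P.eval (f z) := by
  induction n with
  | zero =>
    intro g hgi hg hb
    obtain ⟨c, hc⟩ := hgi.eq_const hp hg (by simpa using hb)
    exact ⟨Polynomial.C c, by simpa using hc⟩
  | succ n ih =>
    intro g hgi hg hb
    have hper : Periodic ((fun z : ℍ ↦ 𝕢 1 z ^ (n + 1) * g z) ∘ ofComplex) ((1 : ℝ) : ℂ) :=
      periodic_comp_ofComplex_of_vadd fun z ↦ by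
        rw [periodic_qParam, ← show (((1 : ℤ) : ℝ) +ᵥ z) = (1 : ℝ) +ᵥ z by simp, hgi.vadd_int]
    have hm : MDiff (fun z : ℍ ↦ 𝕢 1 z ^ (n + 1) * g z) := (mdifferentiable_qParam.pow _).mul hg
    obtain ⟨L, hL⟩ : ∃ L, Tendsto (fun z : ℍ ↦ 𝕢 1 z ^ (n + 1) * g z) atImInfty (𝓝 L) := by
      refine ⟨UpperHalfPlane.cuspFunction 1 (fun z : ℍ ↦ 𝕢 1 z ^ (n + 1) * g z) 0, ?_⟩
      refine ((analyticAt_cuspFunction_zero one_pos hper hm hb).continuousAt.tendsto.comp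
        tendsto_qParam).congr fun z ↦ ?_
      exact eq_cuspFunction z one_ne_zero hper
    set g₁ : ℍ → ℂ := fun z ↦ g z - L / u ^ (n + 1) * f z ^ (n + 1) with hg₁
    have hg₁i : IsStarInvariant p g₁ := fun γ hγ z ↦ by simp only [hg₁, hgi γ hγ, hfi γ hγ]
    have hg₁m : MDiff g₁ := hg.sub (mdifferentiable_const.mul (hf.pow _))
    have h0 : IsZeroAtImInfty (fun z ↦ 𝕢 1 z ^ (n + 1) * g₁ z) := by
      have := hL.sub ((hfu.pow (n + 1)).const_mul (L / u ^ (n + 1)))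
      rw [div_mul_cancel₀ _ (pow_ne_zero _ hu), sub_self] at this
      refine this.congr fun z ↦ ?_
      simp only [hg₁]; ring
    have hper₁ : Periodic ((fun z : ℍ ↦ 𝕢 1 z ^ (n + 1) * g₁ z) ∘ ofComplex) ((1 : ℝ) : ℂ) :=
      periodic_comp_ofComplex_of_vadd fun z ↦ by
        rw [periodic_qParam, ← show (((1 : ℤ) : ℝ) +ᵥ z) = (1 : ℝ) +ᵥ z by simp, hg₁i.vadd_int]
    have hb₁ := isBoundedAtImInfty_div_qParam hper₁ ((mdifferentiable_qParam.pow _).mul hg₁m) h0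
    obtain ⟨P, hP⟩ := ih g₁ hg₁i hg₁m (by
      convert hb₁ using 2 with z
      have := Function.Periodic.qParam_ne_zero (h := 1) (z : ℂ)
      field_simp
      ring)
    refine ⟨P + Polynomial.C (L / u ^ (n + 1)) * Polynomial.X ^ (n + 1), fun z ↦ ?_⟩
    have := hP z
    simp only [hg₁] at this
    simp [← this]

/-- The degree of the polynomial is at least the order of the pole. -/
theorem le_natDegree_of_tendsto {f g : ℍ → ℂ} {u v : ℂ}
    (hfu : Tendsto (fun z : ℍ ↦ 𝕢 1 z * f z) atImInfty (𝓝 u)) (n : ℕ) (hv : v ≠ 0)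
    (hgv : Tendsto (fun z : ℍ ↦ 𝕢 1 z ^ n * g z) atImInfty (𝓝 v)) (P : Polynomial ℂ)
    (hP : ∀ z, g z = P.eval (f z)) : n ≤ P.natDegree := by
  by_contra! hlt
  refine hv (tendsto_nhds_unique hgv ?_)
  have : ∀ z : ℍ, 𝕢 1 z ^ n * g z = ∑ i ∈ Finset.range (P.natDegree + 1),
      P.coeff i * ((𝕢 1 z * f z) ^ i * 𝕢 1 z ^ (n - i)) := by
    intro z
    rw [hP, Polynomial.eval_eq_sum_range, Finset.mul_sum]
    refine Finset.sum_congr rfl fun i hi ↦ ?_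
    have : n = i + (n - i) := by have := Finset.mem_range.1 hi; omega
    conv_lhs => rw [this, pow_add]
    ring
  simp_rw [this]
  rw [show (0 : ℂ) = ∑ i ∈ Finset.range (P.natDegree + 1), P.coeff i * (u ^ i * 0 ^ (n - i)) by
    refine (Finset.sum_eq_zero fun i hi ↦ ?_).symm
    rw [zero_pow (by have := Finset.mem_range.1 hi; omega)]; simp]
  exact tendsto_finsetSum _ fun i _ ↦ ((hfu.pow i).mul (tendsto_qParam.pow _)).const_mul _

end

section

open UpperHalfPlane Matrix Filter Topology Function
open scoped MatrixGroups Manifold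
local notation "𝕢" => Function.Periodic.qParam

/-- Local normal form of a non-constant analytic function. -/
theorem AnalyticAt.exists_eventually_eq_add_pow {f : ℂ → ℂ} {z₀ : ℂ} (hf : AnalyticAt ℂ f z₀)
    (hnc : ¬ ∀ᶠ z in 𝓝 z₀, f z = f z₀) :
    ∃ k : ℕ, k ≠ 0 ∧ analyticOrderAt (fun z ↦ f z - f z₀) z₀ = k ∧ ∃ s : ℂ → ℂ,
      AnalyticAt ℂ s z₀ ∧ s z₀ = 0 ∧ deriv s z₀ ≠ 0 ∧ ∀ᶠ z in 𝓝 z₀, f z = f z₀ + s z ^ k := by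
  have hF : AnalyticAt ℂ (fun z ↦ f z - f z₀) z₀ := hf.sub analyticAt_const
  have htop : analyticOrderAt (fun z ↦ f z - f z₀) z₀ ≠ ⊤ := by
    rw [Ne, analyticOrderAt_eq_top]
    simpa [sub_eq_zero] using hnc
  obtain ⟨k, hk⟩ := ENat.ne_top_iff_exists.1 htop
  have hk0 : k ≠ 0 := by
    rintro rfl
    rw [eq_comm, Nat.cast_zero, hF.analyticOrderAt_eq_zero] at hk
    simp at hk
  obtain ⟨g, hg, hg0, hfg⟩ := hF.analyticOrderAt_eq_natCast.1 hk.symm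
  obtain ⟨c, hc⟩ := IsAlgClosed.exists_pow_nat_eq (g z₀) (Nat.pos_of_ne_zero hk0)
  have hc0 : c ≠ 0 := by
    rintro rfl
    rw [zero_pow hk0] at hc
    exact hg0 hc.symm
  have hr : AnalyticAt ℂ (fun z ↦ (g z / g z₀) ^ ((k : ℂ)⁻¹)) z₀ :=
    (hg.div analyticAt_const hg0).cpow analyticAt_const (by simp [hg0])
  have hr' : AnalyticAt ℂ (fun z ↦ c * (g z / g z₀) ^ ((k : ℂ)⁻¹)) z₀ := analyticAt_const.mul hr
  have hid : AnalyticAt ℂ (fun z : ℂ ↦ z - z₀) z₀ := by fun_prop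
  refine ⟨k, hk0, hk.symm, fun z ↦ (z - z₀) * (c * (g z / g z₀) ^ ((k : ℂ)⁻¹)),
    hid.mul hr', by simp, ?_, ?_⟩
  · have h1 : HasDerivAt (fun z : ℂ ↦ z - z₀) 1 z₀ := (hasDerivAt_id z₀).sub_const z₀
    rw [(h1.fun_mul hr'.differentiableAt.hasDerivAt).deriv]
    simp [hg0, hc0]
  · filter_upwards [hfg] with z hz
    rw [mul_pow, mul_pow, Complex.cpow_nat_inv_pow _ hk0, hc, mul_div_cancel₀ _ hg0]
    rw [smul_eq_mul] at hz
    rw [← hz]; ring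

/-- Near a simple zero of `s`, the equation `s b = ζ * s a` is the graph of an analytic map. -/
theorem AnalyticAt.exists_twist {s : ℂ → ℂ} {z₀ : ℂ} (hs : AnalyticAt ℂ s z₀) (hs0 : s z₀ = 0)
    (hs' : deriv s z₀ ≠ 0) (ζ : ℂ) :
    ∃ w : ℂ → ℂ, AnalyticAt ℂ w z₀ ∧ w z₀ = z₀ ∧ HasDerivAt w ζ z₀ ∧
      ∀ᶠ q : ℂ × ℂ in 𝓝 (z₀, z₀), s q.2 = ζ * s q.1 ↔ q.2 = w q.1 := by
  have hd := hs.hasStrictDerivAt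
  obtain ⟨t, ht⟩ : ∃ t, t = hd.localInverse s _ z₀ hs' := ⟨_, rfl⟩
  have hta : AnalyticAt ℂ t 0 := by
    rw [ht, ← hs0]; exact hs.analyticAt_localInverse hs'
  have hl : ∀ᶠ x in 𝓝 z₀, t (s x) = x := by
    rw [ht]; exact hd.eventually_left_inverse hs'
  have hr : ∀ᶠ y in 𝓝 (0 : ℂ), s (t y) = y := by
    rw [ht]; have := hd.eventually_right_inverse hs'; rwa [hs0] at this
  have ht0 : t 0 = z₀ := by have := hl.self_of_nhds; rwa [hs0] at this
  have htd : HasDerivAt t (deriv s z₀)⁻¹ 0 := by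
    have := (hd.to_localInverse hs').hasDerivAt
    rwa [hs0, ← ht] at this
  have hm : AnalyticAt ℂ (fun z ↦ ζ * s z) z₀ := analyticAt_const.mul hs
  have hm0 : ζ * s z₀ = 0 := by simp [hs0]
  have hmt : Tendsto (fun z ↦ ζ * s z) (𝓝 z₀) (𝓝 0) := by
    have := hm.continuousAt.tendsto
    rwa [hm0] at this
  refine ⟨fun z ↦ t (ζ * s z), ?_, by simp [hs0, ht0], ?_, ?_⟩
  · refine AnalyticAt.fun_comp (g := t) (f := fun z ↦ ζ * s z) ?_ hm
    simpa [hs0] using hta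
  · have h1 : HasDerivAt (fun z ↦ ζ * s z) (ζ * deriv s z₀) z₀ :=
      hs.differentiableAt.hasDerivAt.const_mul ζ
    have h2 : HasDerivAt t (deriv s z₀)⁻¹ (ζ * s z₀) := by rwa [hm0]
    have := h2.comp z₀ h1
    rwa [show (deriv s z₀)⁻¹ * (ζ * deriv s z₀) = ζ by field_simp] at this
  · rw [nhds_prod_eq]
    have h1 := (tendsto_snd (f := 𝓝 z₀) (g := 𝓝 z₀)).eventually hl
    have h2 := (hmt.comp (tendsto_fst (f := 𝓝 z₀) (g := 𝓝 z₀))).eventually hr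
    filter_upwards [h1, h2] with q hq1 hq2
    constructor
    · intro h
      rw [← h, hq1]
    · intro h
      rw [h]; exact hq2

end

section

open UpperHalfPlane Matrix Filter Topology Function
open scoped MatrixGroups Manifold
local notation "𝕢" => Function.Periodic.qParam

theorem tendsto_ofComplex_nhds (z : ℍ) : Tendsto ofComplex (𝓝 (z : ℂ)) (𝓝 z) := by
  have := (contMDiffAt_ofComplex (n := ⊤) z.im_pos).continuousAt.tendsto
  rwa [ofComplex_apply] at this

theorem analyticOnNhd_comp_ofComplex {f : ℍ → ℂ} (hf : MDiff f) :
    AnalyticOnNhd ℂ (f ∘ ofComplex) {z : ℂ | 0 < z.im} :=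
  (UpperHalfPlane.mdifferentiable_iff.1 hf).analyticOnNhd isOpen_upperHalfPlaneSet

theorem analyticAt_comp_ofComplex {f : ℍ → ℂ} (hf : MDiff f) (z : ℍ) :
    AnalyticAt ℂ (f ∘ ofComplex) z :=
  analyticOnNhd_comp_ofComplex hf _ z.im_pos

theorem isPreconnected_upperHalfPlaneSet : IsPreconnected {z : ℂ | 0 < z.im} :=
  (convex_halfSpace_im_gt 0).isPreconnected

theorem not_eventually_comp_ofComplex_eq {f : ℍ → ℂ} (hf : MDiff f) (hc : ∃ a b, f a ≠ f b)
    (z : ℍ) : ¬ ∀ᶠ x in 𝓝 (z : ℂ), (f ∘ ofComplex) x = (f ∘ ofComplex) z := by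
  intro h
  have := (analyticOnNhd_comp_ofComplex hf).eqOn_of_preconnected_of_eventuallyEq
    (g := fun _ ↦ (f ∘ ofComplex) z) analyticOnNhd_const isPreconnected_upperHalfPlaneSet z.im_pos h
  obtain ⟨a, b, hab⟩ := hc
  have ha := this a.im_pos
  have hb := this b.im_pos
  simp only [Function.comp_apply, ofComplex_apply] at ha hb
  exact hab (ha.trans hb.symm)

/-- Open mapping theorem on the upper half plane. -/
theorem nhds_le_map_nhds_of_mdifferentiable {f : ℍ → ℂ} (hf : MDiff f) (hc : ∃ a b, f a ≠ f b)
    (z : ℍ) : 𝓝 (f z) ≤ map f (𝓝 z) := by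
  have h := (analyticAt_comp_ofComplex hf z).eventually_constant_or_nhds_le_map_nhds.resolve_left
    (not_eventually_comp_ofComplex_eq hf hc z)
  rw [Function.comp_apply, ofComplex_apply, ← Filter.map_map] at h
  exact h.trans (map_mono (tendsto_ofComplex_nhds z))

theorem isCompact_im_re_le {c Y B : ℝ} (hc : 0 < c) :
    IsCompact {z : ℍ | c ≤ z.im ∧ z.im ≤ Y ∧ |z.re| ≤ B} := by
  rw [UpperHalfPlane.isEmbedding_coe.isCompact_iff]
  have : ((↑) : ℍ → ℂ) '' {z : ℍ | c ≤ z.im ∧ z.im ≤ Y ∧ |z.re| ≤ B} =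
      Set.Icc (-B) B ×ℂ Set.Icc c Y := by
    ext x
    simp only [Set.mem_image, Set.mem_ofPred_eq, Complex.mem_reProdIm, Set.mem_Icc, ← abs_le]
    constructor
    · rintro ⟨z, ⟨h1, h2, h3⟩, rfl⟩
      exact ⟨h3, h1, h2⟩
    · rintro ⟨h1, h2, h3⟩
      exact ⟨⟨x, hc.trans_le h2⟩, ⟨h2, h3, h1⟩, rfl⟩
  rw [this]
  exact isCompact_Icc.reProdIm isCompact_Icc

theorem tendsto_norm_atTop_of_pole {f : ℍ → ℂ} {u : ℂ} (hu : u ≠ 0)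
    (hfu : Tendsto (fun z : ℍ ↦ 𝕢 1 z * f z) atImInfty (𝓝 u)) :
    Tendsto (fun z ↦ ‖f z‖) atImInfty atTop := by
  have h1 : Tendsto (fun z : ℍ ↦ ‖𝕢 1 z‖) atImInfty (𝓝[>] 0) := by
    refine tendsto_nhdsWithin_iff.2 ⟨by simpa using tendsto_qParam.norm, .of_forall fun z ↦ ?_⟩
    exact norm_pos_iff.2 (Function.Periodic.qParam_ne_zero _)
  have h2 := h1.inv_tendsto_nhdsGT_zero.atTop_mul_pos (norm_pos_iff.2 hu) hfu.norm
  refine h2.congr fun z ↦ ?_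
  have := norm_ne_zero_iff.2 (Function.Periodic.qParam_ne_zero (h := 1) (z : ℂ))
  rw [norm_mul, Pi.inv_apply]
  field_simp

theorem eventually_atImInfty_iff {P : ℍ → Prop} :
    (∀ᶠ z in atImInfty, P z) ↔ ∃ Y : ℝ, ∀ z : ℍ, Y < z.im → P z := by
  rw [Filter.Eventually, atImInfty_mem]
  constructor
  · rintro ⟨A, h⟩
    exact ⟨A, fun z hz ↦ h z hz.le⟩
  · rintro ⟨A, h⟩
    exact ⟨A + 1, fun z hz ↦ h z (by linarith)⟩

/-- Functions with a simple pole at the cusp are injective near the cusp. -/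
theorem exists_injective_near_cusp {f : ℍ → ℂ} (hf : MDiff f)
    (hper : Periodic (f ∘ ofComplex) ((1 : ℝ) : ℂ)) {u : ℂ} (hu : u ≠ 0)
    (hfu : Tendsto (fun z : ℍ ↦ 𝕢 1 z * f z) atImInfty (𝓝 u)) :
    ∃ Y : ℝ, ∀ z w : ℍ, Y < z.im → Y < w.im → f z = f w → ∃ n : ℤ, w = (n : ℝ) +ᵥ z := by
  have hgd : MDiff fun z : ℍ ↦ 𝕢 1 z * f z := mdifferentiable_qParam.mul hf
  have hgp : Periodic ((fun z : ℍ ↦ 𝕢 1 z * f z) ∘ ofComplex) ((1 : ℝ) : ℂ) := by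
    refine periodic_comp_ofComplex_of_vadd fun z ↦ ?_
    have h1 := hper (z : ℂ)
    have h2 : (z : ℂ) + ((1 : ℝ) : ℂ) = (((1 : ℝ) +ᵥ z : ℍ) : ℂ) := by
      rw [coe_vadd, add_comm]
    rw [h2, Function.comp_apply, Function.comp_apply, ofComplex_apply, ofComplex_apply] at h1
    rw [periodic_qParam, h1]
  have hgb : IsBoundedAtImInfty fun z : ℍ ↦ 𝕢 1 z * f z :=
    hfu.isBigO_one ℝ
  set U := UpperHalfPlane.cuspFunction 1 (fun z : ℍ ↦ 𝕢 1 z * f z) with hU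
  have hUz : ∀ z : ℍ, U (𝕢 1 z) = 𝕢 1 z * f z := fun z ↦ eq_cuspFunction z one_ne_zero hgp
  have hUa : AnalyticAt ℂ U 0 := analyticAt_cuspFunction_zero one_pos hgp hgd hgb
  have hqt : Tendsto (fun z : ℍ ↦ 𝕢 1 z) atImInfty (𝓝 0) := tendsto_qParam
  have hU0 : U 0 = u := by
    refine tendsto_nhds_unique ?_ hfu
    simpa only [Function.comp_def, hUz] using hUa.continuousAt.tendsto.comp hqt
  have hU0' : U 0 ≠ 0 := hU0 ▸ hu
  have hs : AnalyticAt ℂ (fun q ↦ q / U q) 0 := analyticAt_id.div hUa hU0'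
  have hsd : HasDerivAt (fun q ↦ q / U q) (U 0)⁻¹ 0 := by
    have := (hasDerivAt_id (0 : ℂ)).div hUa.differentiableAt.hasDerivAt hU0'
    simp only [id, one_mul, zero_mul, sub_zero] at this
    rwa [show U 0 / U 0 ^ 2 = (U 0)⁻¹ by field_simp] at this
  have hsd' : deriv (fun q ↦ q / U q) 0 ≠ 0 := by rw [hsd.deriv]; exact inv_ne_zero hU0'
  have hl := (hqt.eventually (hs.hasStrictDerivAt.eventually_left_inverse hsd'))
  obtain ⟨Y, hY⟩ := eventually_atImInfty_iff.1 hl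
  refine ⟨Y, fun z w hz hw hzw ↦ ?_⟩
  have hq : 𝕢 1 z = 𝕢 1 w := by
    rw [← hY z hz, ← hY w hw, hUz, hUz, hzw, ← div_div, ← div_div,
      div_self (Function.Periodic.qParam_ne_zero _), div_self (Function.Periodic.qParam_ne_zero _)]
  obtain ⟨m, hm⟩ := Function.Periodic.qParam_left_inv_mod_period one_ne_zero (z : ℂ)
  obtain ⟨n, hn⟩ := Function.Periodic.qParam_left_inv_mod_period one_ne_zero (w : ℂ)
  refine ⟨m - n, ?_⟩
  ext
  rw [hq, hn] at hm
  rw [coe_vadd]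
  push_cast at hm ⊢
  linear_combination hm

end

section

open UpperHalfPlane Matrix Filter Topology Function
open scoped MatrixGroups Manifold
local notation "𝕢" => Function.Periodic.qParam

/-- An invariant function with a simple pole at the cusp is surjective. -/
theorem IsStarInvariant.surjective_of_pole {p : ℕ} (hp : p.Prime) {f : ℍ → ℂ}
    (hfi : IsStarInvariant p f) (hf : MDiff f) (hc : ∃ a b, f a ≠ f b)
    (ht : Tendsto (fun z ↦ ‖f z‖) atImInfty atTop) : Surjective f := by
  have hp0 : (0 : ℝ) < p := by exact_mod_cast hp.pos
  have hopen : IsOpen (Set.range f) := by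
    rw [isOpen_iff_mem_nhds]
    rintro _ ⟨z, rfl⟩
    exact nhds_le_map_nhds_of_mdifferentiable hf hc z (by simp)
  have hclosed : IsClosed (Set.range f) := by
    refine isClosed_of_closure_subset fun v hv ↦ ?_
    obtain ⟨Y, hY⟩ := eventually_atImInfty_iff.1 (ht.eventually_gt_atTop (‖v‖ + 1))
    have hK := (isCompact_im_re_le (c := 1 / (2 * p)) (Y := Y) (B := 1) (by positivity)).image
      hf.continuous
    suffices h : v ∈ closure (f '' {z : ℍ | 1 / (2 * p : ℝ) ≤ z.im ∧ z.im ≤ Y ∧ |z.re| ≤ 1}) by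
      rw [hK.isClosed.closure_eq] at h
      exact Set.image_subset_range _ _ h
    have h1 : v ∈ closure (Metric.ball v 1 ∩ Set.range f) :=
      (Metric.isOpen_ball.inter_closure) ⟨Metric.mem_ball_self one_pos, hv⟩
    refine closure_mono ?_ h1
    rintro _ ⟨hx, z, rfl⟩
    obtain ⟨γ, hγ, h2, h3⟩ := Gamma0Star.exists_le_im hp z
    refine ⟨γ • z, ⟨h2, ?_, h3⟩, hfi γ hγ z⟩
    by_contra! hlt
    have h4 := hY _ hlt
    rw [hfi γ hγ] at h4
    have h5 := norm_sub_norm_le (f z) v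
    rw [mem_ball_iff_norm] at hx
    linarith
  have := IsClopen.eq_univ ⟨hclosed, hopen⟩ (Set.range_nonempty f)
  exact Set.range_eq_univ.1 this

theorem IsStarInvariant.exists_smul_eq_of_eq {p : ℕ} (hp : p.Prime) {f : ℍ → ℂ}
    (hfi : IsStarInvariant p f) (hf : MDiff f) (hc : ∃ a b, f a ≠ f b)
    (ht : Tendsto (fun z ↦ ‖f z‖) atImInfty atTop)
    (hinj : ∃ Y : ℝ, ∀ z w : ℍ, Y < z.im → Y < w.im → f z = f w → ∃ n : ℤ, w = (n : ℝ) +ᵥ z)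
    {z w : ℍ} (hzw : f z = f w) : ∃ γ ∈ Gamma0Star p, γ • z = w := by
  have hp0 : (0 : ℝ) < p := by exact_mod_cast hp.pos
  have hfc : Continuous f := hf.continuous
  by_contra hne
  set D : Set (ℍ × ℍ) := {q | f q.1 = f q.2 ∧ ¬ ∃ γ ∈ Gamma0Star p, γ • q.1 = q.2} with hD
  have hmove : ∀ q ∈ D, ∀ γ ∈ Gamma0Star p, ∀ δ ∈ Gamma0Star p, (γ • q.1, δ • q.2) ∈ D := by
    rintro q ⟨h1, h2⟩ γ hγ δ hδ
    refine ⟨by rw [hfi γ hγ, hfi δ hδ, h1], ?_⟩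
    rintro ⟨η, hη, h⟩
    refine h2 ⟨δ⁻¹ * (η * γ), mul_mem (inv_mem hδ) (mul_mem hη hγ), ?_⟩
    rw [mul_smul, mul_smul, h, inv_smul_smul]
  -- `D` is bounded
  obtain ⟨B, hB⟩ : ∃ B : ℝ, ∀ q ∈ D, ‖f q.1‖ ≤ B := by
    obtain ⟨Y, hY⟩ := hinj
    have hK := isCompact_im_re_le (c := 1 / (2 * p)) (Y := Y) (B := 1) (by positivity)
    obtain ⟨B, hB⟩ := hK.exists_bound_of_continuousOn hfc.continuousOn
    refine ⟨B, fun q hq ↦ ?_⟩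
    obtain ⟨γ, hγ, h1, h2⟩ := Gamma0Star.exists_le_im hp q.1
    obtain ⟨δ, hδ, h3, h4⟩ := Gamma0Star.exists_le_im hp q.2
    obtain ⟨h5, h6⟩ := hmove q hq γ hγ δ hδ
    by_contra! hlt
    have h7 : Y < (γ • q.1).im := by
      by_contra! h
      have := hB _ ⟨h1, h, h2⟩
      rw [hfi γ hγ] at this
      linarith
    have h8 : Y < (δ • q.2).im := by
      by_contra! h
      have := hB _ ⟨h3, h, h4⟩
      rw [hfi δ hδ, ← hq.1] at this
      linarith
    obtain ⟨n, hn⟩ := hY _ _ h7 h8 h5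
    obtain ⟨η, hη, hηn⟩ := Gamma0Star.exists_vadd_eq p n
    exact h6 ⟨η, hη, by rw [hηn]; exact hn.symm⟩
  -- a limit point of `D` maximizing `‖f‖`
  obtain ⟨q₀, hq₀, hmax⟩ : ∃ q₀ ∈ closure D, ∀ q ∈ D, ‖f q.1‖ ≤ ‖f q₀.1‖ := by
    obtain ⟨Y, hY⟩ := eventually_atImInfty_iff.1 (ht.eventually_gt_atTop B)
    have hK := isCompact_im_re_le (c := 1 / (2 * p)) (Y := Y) (B := 1) (by positivity)
    set K := {z : ℍ | 1 / (2 * p : ℝ) ≤ z.im ∧ z.im ≤ Y ∧ |z.re| ≤ 1} with hKdef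
    have hmem : ∀ q ∈ D, ∃ q' ∈ D ∩ K ×ˢ K, f q'.1 = f q.1 := by
      intro q hq
      obtain ⟨γ, hγ, h1, h2⟩ := Gamma0Star.exists_le_im hp q.1
      obtain ⟨δ, hδ, h3, h4⟩ := Gamma0Star.exists_le_im hp q.2
      have h5 := hmove q hq γ hγ δ hδ
      have h6 := hB _ h5
      refine ⟨_, ⟨h5, ⟨h1, ?_, h2⟩, ⟨h3, ?_, h4⟩⟩, hfi γ hγ _⟩
      · by_contra! h
        exact (hY _ h).not_ge h6
      · by_contra! h
        refine (hY _ h).not_ge ?_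
        rw [← h5.1]; exact h6
    have hcl : closure (D ∩ K ×ˢ K) ⊆ K ×ˢ K :=
      closure_minimal Set.inter_subset_right (hK.prod hK).isClosed
    have hcc : IsCompact (closure (D ∩ K ×ˢ K)) :=
      (hK.prod hK).of_isClosed_subset isClosed_closure hcl
    obtain ⟨q1, hq1, -⟩ := hmem (z, w) ⟨hzw, hne⟩
    obtain ⟨q₀, hq₀, hm⟩ := hcc.exists_isMaxOn ⟨q1, subset_closure hq1⟩
      (f := fun q ↦ ‖f q.1‖) (by fun_prop)
    refine ⟨q₀, closure_mono Set.inter_subset_left hq₀, fun q hq ↦ ?_⟩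
    obtain ⟨q', hq', h⟩ := hmem q hq
    rw [← h]
    exact hm (subset_closure hq')
  have hq₀f : f q₀.1 = f q₀.2 := by
    have hcl : IsClosed {q : ℍ × ℍ | f q.1 = f q.2} := isClosed_eq (by fun_prop) (by fun_prop)
    exact closure_minimal (fun q hq ↦ hq.1) hcl hq₀
  -- there are larger values nearby
  have hlarge : ∃ᶠ v in 𝓝 (f q₀.1), ‖f q₀.1‖ < ‖v‖ := by
    intro hev
    rw [Metric.eventually_nhds_iff] at hev
    obtain ⟨ε, hε, h⟩ := hev
    set x := f q₀.1
    by_cases hx : x = 0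
    · refine h (y := ((ε / 2 : ℝ) : ℂ)) ?_ ?_
      · rw [hx, dist_zero_right, Complex.norm_real, Real.norm_of_nonneg (by linarith)]; linarith
      · show ‖x‖ < ‖((ε / 2 : ℝ) : ℂ)‖
        rw [hx, norm_zero, Complex.norm_real, Real.norm_of_nonneg (by linarith)]; linarith
    · have hx' := norm_pos_iff.2 hx
      have hpos : (0 : ℝ) < ε / (2 * ‖x‖) := by positivity
      refine h (y := ((1 + ε / (2 * ‖x‖) : ℝ) : ℂ) * x) ?_ ?_
      · rw [dist_eq_norm,
          show ((1 + ε / (2 * ‖x‖) : ℝ) : ℂ) * x - x = ((ε / (2 * ‖x‖) : ℝ) : ℂ) * x by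
          push_cast; ring, norm_mul, Complex.norm_real, Real.norm_of_nonneg hpos.le]
        rw [show ε / (2 * ‖x‖) * ‖x‖ = ε / 2 by field_simp]
        linarith
      · show ‖x‖ < ‖((1 + ε / (2 * ‖x‖) : ℝ) : ℂ) * x‖
        rw [norm_mul, Complex.norm_real, Real.norm_of_nonneg (by linarith)]
        nlinarith
  have hopen1 := nhds_le_map_nhds_of_mdifferentiable hf hc q₀.1
  have hopen2 := nhds_le_map_nhds_of_mdifferentiable hf hc q₀.2
  have hfreq : ∃ᶠ q in 𝓝 q₀, q ∈ D := mem_closure_iff_frequently.1 hq₀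
  by_cases heq : ∃ γ ∈ Gamma0Star p, γ • q₀.1 = q₀.2
  swap
  · obtain ⟨S, -, hS, hev⟩ := Gamma0Star.exists_finite hp q₀.1 q₀.2
    have hev' : ∀ᶠ q : ℍ × ℍ in 𝓝 (q₀.1, q₀.2), ¬ ∃ γ ∈ Gamma0Star p, γ • q.1 = q.2 := by
      filter_upwards [hev] with q hq h
      obtain ⟨γ, hγ, -⟩ := hq h
      exact heq ⟨γ, hS γ hγ⟩
    rw [nhds_prod_eq, Filter.eventually_prod_iff] at hev'
    obtain ⟨P1, h1, P2, h2, h12⟩ := hev'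
    have h3 : ∀ᶠ v in 𝓝 (f q₀.1), ∃ a, P1 a ∧ f a = v :=
      hopen1 (by
        rw [mem_map]
        filter_upwards [h1] with a ha
        exact ⟨a, ha, rfl⟩)
    have h4 : ∀ᶠ v in 𝓝 (f q₀.1), ∃ a, P2 a ∧ f a = v := by
      rw [hq₀f]
      exact hopen2 (by
        rw [mem_map]
        filter_upwards [h2] with a ha
        exact ⟨a, ha, rfl⟩)
    obtain ⟨v, hv, ⟨a, ha, hav⟩, b, hb, hbv⟩ := (hlarge.and_eventually (h3.and h4)).exists
    have := hmax (a, b) ⟨hav.trans hbv.symm, h12 ha hb⟩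
    simp only [hav] at this
    linarith
  · obtain ⟨γ₀, hγ₀, hγ₀q⟩ := heq
    set z₀ := q₀.1 with hz₀
    -- move to the diagonal
    have hfreq' : ∃ᶠ q in 𝓝 (z₀, z₀), q ∈ D := by
      have hcont : Tendsto (fun q : ℍ × ℍ ↦ (q.1, γ₀⁻¹ • q.2)) (𝓝 q₀) (𝓝 (z₀, z₀)) := by
        have h1 : Continuous (fun q : ℍ × ℍ ↦ (q.1, γ₀⁻¹ • q.2)) :=
          continuous_fst.prodMk ((continuous_smul_SLR γ₀⁻¹).comp continuous_snd)
        have h2 := h1.tendsto q₀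
        rwa [← hγ₀q, inv_smul_smul] at h2
      refine hcont.frequently (hfreq.mono fun q hq ↦ ?_)
      simpa using hmove q hq 1 (one_mem _) γ₀⁻¹ (inv_mem hγ₀)
    obtain ⟨k, hk0, -, s, hs, hs0, hs', hfs⟩ :=
      (analyticAt_comp_ofComplex hf z₀).exists_eventually_eq_add_pow
        (not_eventually_comp_ofComplex_eq hf hc z₀)
    have hct : Tendsto (fun z : ℍ ↦ (z : ℂ)) (𝓝 z₀) (𝓝 (z₀ : ℂ)) :=
      UpperHalfPlane.continuous_coe.tendsto z₀
    have hfs' : ∀ᶠ z : ℍ in 𝓝 z₀, f z = f z₀ + s z ^ k := by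
      filter_upwards [hct.eventually hfs] with z hz
      simpa using hz
    have hroots : {ζ : ℂ | ζ ^ k = 1}.Finite := by
      refine (Polynomial.nthRootsFinset k (1 : ℂ)).finite_toSet.subset fun ζ hζ ↦ ?_
      simpa [Polynomial.mem_nthRootsFinset (Nat.pos_of_ne_zero hk0)] using hζ
    obtain ⟨ζ, hζ, hfζ⟩ : ∃ ζ : ℂ, ζ ^ k = 1 ∧
        ∃ᶠ q : ℍ × ℍ in 𝓝 (z₀, z₀), q ∈ D ∧ s q.2 = ζ * s q.1 := by
      by_contra! hcon
      have hall := (Filter.eventually_all_finite hroots).2 fun ζ hζ ↦ hcon ζ hζ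
      rw [nhds_prod_eq] at hall hfreq'
      obtain ⟨q, hq, ⟨h1, h2⟩, h3⟩ := (hfreq'.and_eventually (((tendsto_fst.eventually hfs').and
        (tendsto_snd.eventually hfs')).and hall)).exists
      have h4 : s q.2 ^ k = s q.1 ^ k := by
        have := hq.1
        rw [h1, h2] at this
        exact (add_left_cancel this).symm
      by_cases h5 : s q.1 = 0
      · rw [h5, zero_pow hk0] at h4
        exact h3 1 (one_pow k) hq (by rw [h5, pow_eq_zero_iff hk0 |>.1 h4, mul_zero])
      · exact h3 (s q.2 / s q.1) (by
          rw [Set.mem_ofPred_eq, div_pow, h4, div_self (pow_ne_zero k h5)]) hq (by field_simp)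
    obtain ⟨W, hW, hW0, -, hWs⟩ := hs.exists_twist hs0 hs' ζ
    have hct2 : Tendsto (fun q : ℍ × ℍ ↦ ((q.1 : ℂ), (q.2 : ℂ))) (𝓝 (z₀, z₀))
        (𝓝 ((z₀ : ℂ), (z₀ : ℂ))) :=
      (by fun_prop : Continuous (fun q : ℍ × ℍ ↦ ((q.1 : ℂ), (q.2 : ℂ)))).tendsto (z₀, z₀)
    have hWt : Tendsto (fun z : ℍ ↦ ofComplex (W z)) (𝓝 z₀) (𝓝 z₀) := by
      have h1 := hW.continuousAt.tendsto
      rw [hW0] at h1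
      exact (tendsto_ofComplex_nhds z₀).comp (h1.comp hct)
    have hWc : ∀ᶠ z : ℍ in 𝓝 z₀, (ofComplex (W z) : ℂ) = W z := by
      have h1 := hW.continuousAt.tendsto.comp hct
      rw [hW0] at h1
      filter_upwards [h1.eventually (isOpen_upperHalfPlaneSet.mem_nhds z₀.im_pos)] with z hz
      rw [Function.comp_apply] at hz
      rw [ofComplex_apply_of_im_pos hz]
    have hpair : Tendsto (fun z : ℍ ↦ (z, ofComplex (W z))) (𝓝 z₀) (𝓝 (z₀, z₀)) :=
      tendsto_id.prodMk_nhds hWt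
    have hfW : ∀ᶠ z : ℍ in 𝓝 z₀, f z = f (ofComplex (W z)) := by
      filter_upwards [hfs', hWt.eventually hfs', hpair.eventually (hct2.eventually hWs), hWc]
        with z h1 h2 h3 h4
      rw [h1, h2, h3.2 h4, mul_pow, hζ, one_mul]
    have hfreqz : ∃ᶠ z : ℍ in 𝓝 z₀, (z, ofComplex (W z)) ∈ D := by
      have h1 := hfζ.and_eventually (hct2.eventually hWs)
      have h2 : Tendsto (fun q : ℍ × ℍ ↦ q.1) (𝓝 (z₀, z₀)) (𝓝 z₀) := continuous_fst.tendsto _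
      refine h2.frequently (h1.mono ?_)
      rintro ⟨a, b⟩ ⟨⟨h3, h4⟩, h5⟩
      have h6 := h5.1 h4
      have : ofComplex (W a) = b := by
        rw [← h6, ofComplex_apply]
      simpa only [this] using h3
    obtain ⟨S, hSf, hS, hev⟩ := Gamma0Star.exists_finite hp z₀ z₀
    have hW0' : ofComplex (W z₀) = z₀ := by rw [hW0, ofComplex_apply]
    have hne0 : ∃ᶠ z : ℍ in 𝓝[≠] z₀, (z, ofComplex (W z)) ∈ D := by
      rw [frequently_nhdsWithin_iff]
      refine hfreqz.mono fun z hz ↦ ⟨hz, ?_⟩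
      rintro rfl
      exact hz.2 ⟨1, one_mem _, by simp [hW0']⟩
    have hcp : Tendsto (fun z : ℍ ↦ (z : ℂ)) (𝓝[≠] z₀) (𝓝[≠] (z₀ : ℂ)) :=
      tendsto_nhdsWithin_iff.2 ⟨hct.mono_left nhdsWithin_le_nhds, by
        filter_upwards [self_mem_nhdsWithin] with z hz h
        exact hz (UpperHalfPlane.ext h)⟩
    have hSne : ∀ γ ∈ S, ∀ᶠ z : ℍ in 𝓝[≠] z₀, γ • z ≠ ofComplex (W z) := by
      intro γ hγ
      have ha : AnalyticAt ℂ (fun x ↦ ((γ : GL (Fin 2) ℝ) • ofComplex x : ℍ) : ℂ → ℂ) z₀ :=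
        UpperHalfPlane.analyticAt_smul (by simp) z₀
      rcases ha.eventually_eq_or_eventually_ne hW with h | h
      · exfalso
        have h1 : ∀ᶠ z : ℍ in 𝓝 z₀, γ • z = ofComplex (W z) := by
          filter_upwards [hct.eventually h] with z hz
          rw [← hz, ofComplex_apply, ofComplex_apply]; rfl
        obtain ⟨z, hz, hz'⟩ := (hfreqz.and_eventually h1).exists
        exact hz.2 ⟨γ, (hS γ hγ).1, hz'⟩
      · filter_upwards [hcp.eventually h, hWc.filter_mono nhdsWithin_le_nhds] with z hz hz2 h3
        apply hz
        rw [ofComplex_apply, ← hz2, ← h3]; rfl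
    have hDev : ∀ᶠ z : ℍ in 𝓝[≠] z₀, (z, ofComplex (W z)) ∈ D := by
      filter_upwards [(Filter.eventually_all_finite hSf).2 hSne,
        hfW.filter_mono nhdsWithin_le_nhds,
        (hpair.eventually hev).filter_mono nhdsWithin_le_nhds] with z h1 h2 h3
      refine ⟨h2, fun h ↦ ?_⟩
      obtain ⟨γ, hγ, h4⟩ := h3 h
      exact h1 γ hγ h4
    have hle : ∀ᶠ z : ℍ in 𝓝 z₀, ‖f z‖ ≤ ‖f z₀‖ := by
      rw [eventually_nhdsWithin_iff] at hDev
      filter_upwards [hDev] with z hz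
      by_cases h : z = z₀
      · rw [h]
      · exact hmax _ (hz h)
    have hle' : ∀ᶠ v in 𝓝 (f z₀), ‖v‖ ≤ ‖f z₀‖ := hopen1 hle
    obtain ⟨v, h1, h2⟩ := (hlarge.and_eventually hle').exists
    linarith

/-- An invariant holomorphic function with a simple pole at the cusp is a Hauptmodul. -/
theorem isGenusZeroStar_of_pole {p : ℕ} (hp : p.Prime) {f : ℍ → ℂ}
    (hfi : IsStarInvariant p f) (hf : MDiff f) {u : ℂ} (hu : u ≠ 0)
    (hfu : Tendsto (fun z : ℍ ↦ 𝕢 1 z * f z) atImInfty (𝓝 u)) : IsGenusZeroStar p := by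
  have ht := tendsto_norm_atTop_of_pole hu hfu
  have hc : ∃ a b, f a ≠ f b := by
    by_contra! h
    have h1 := ht.congr (f₂ := fun _ ↦ ‖f I‖) fun z ↦ by rw [h z I]
    exact not_tendsto_const_atTop _ _ h1
  have hinj := exists_injective_near_cusp hf hfi.periodic hu hfu
  refine ⟨f ∘ ofComplex, UpperHalfPlane.mdifferentiable_iff.1 hf, ?_, ?_⟩
  · intro z hz w hw
    lift z to ℍ using hz
    lift w to ℍ using hw
    simp only [Function.comp_apply, ofComplex_apply]
    constructor
    · intro h
      obtain ⟨γ, hγ, h1⟩ := hfi.exists_smul_eq_of_eq hp hf hc ht hinj h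
      exact ⟨γ, hγ, by rw [moebius_eq, h1]⟩
    · rintro ⟨γ, hγ, h1⟩
      rw [moebius_eq] at h1
      rw [← UpperHalfPlane.ext h1, hfi γ hγ]
  · intro v _
    obtain ⟨z, hz⟩ := hfi.surjective_of_pole hp hf hc ht v
    exact ⟨z, z.im_pos, by simp [hz]⟩

end

section

open UpperHalfPlane Matrix Filter Topology Function
open scoped MatrixGroups Manifold
local notation "𝕢" => Function.Periodic.qParam

/-- Multiplication of a point of the upper half plane by a positive integer. -/
noncomputable def natScale (p : ℕ) [NeZero p] (z : ℍ) : ℍ :=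
  ⟨p * z, by
    have : (0 : ℝ) < p := by exact_mod_cast Nat.pos_of_ne_zero (NeZero.ne p)
    simpa using mul_pos this z.im_pos⟩

@[simp] theorem coe_natScale (p : ℕ) [NeZero p] (z : ℍ) : (natScale p z : ℂ) = p * z := rfl

theorem exists_natScale_smul (p : ℕ) [NeZero p] (g : SL(2, ℤ)) (hg : (p : ℤ) ∣ g 1 0) :
    ∃ g' : SL(2, ℤ), p * g' 1 0 = g 1 0 ∧ g' 1 1 = g 1 1 ∧
      ∀ z : ℍ, natScale p (g • z) = g' • natScale p z := by
  obtain ⟨c, hc⟩ := hg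
  have hdet := g.2
  rw [Matrix.det_fin_two] at hdet
  obtain ⟨g', hg'⟩ : ∃ g' : SL(2, ℤ), g'.1 = !![g 0 0, p * g 0 1; c, g 1 1] :=
    ⟨⟨_, by rw [Matrix.det_fin_two]; simp; linear_combination hdet + g.1 0 1 * hc⟩, rfl⟩
  have e00 : g' 0 0 = g 0 0 := by simp [hg']
  have e01 : g' 0 1 = p * g 0 1 := by simp [hg']
  have e10 : g' 1 0 = c := by simp [hg']
  have e11 : g' 1 1 = g 1 1 := by simp [hg']
  refine ⟨g', by rw [e10, hc], e11, fun z ↦ ?_⟩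
  ext
  rw [coe_natScale, coe_specialLinearGroup_apply, coe_specialLinearGroup_apply]
  simp [e00, e01, e10, e11, hc]
  ring

theorem fricke_smul_eq (p : ℕ) [NeZero p] (z : ℍ) :
    fricke p • z = ModularGroup.S • natScale p z := by
  ext
  rw [coe_fricke_smul, modular_S_smul]
  simp [neg_div]

theorem natScale_fricke_smul (p : ℕ) [NeZero p] (z : ℍ) :
    natScale p (fricke p • z) = ModularGroup.S • z := by
  ext
  have h3 : (p : ℂ) ≠ 0 := by exact_mod_cast (NeZero.ne p)
  have := UpperHalfPlane.ne_zero z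
  rw [coe_natScale, coe_fricke_smul, modular_S_smul]
  simp
  field_simp

theorem mdifferentiable_comp_natScale (p : ℕ) [NeZero p] {F : ℍ → ℂ} (hF : MDiff F) :
    MDiff (fun z ↦ F (natScale p z)) := by
  rw [UpperHalfPlane.mdifferentiable_iff] at hF ⊢
  have hp : (0 : ℝ) < p := by exact_mod_cast Nat.pos_of_ne_zero (NeZero.ne p)
  have h : DifferentiableOn ℂ ((F ∘ ofComplex) ∘ fun z : ℂ ↦ p * z) upperHalfPlaneSet := by
    refine hF.comp (by fun_prop) fun z hz ↦ ?_
    simpa using mul_pos hp hz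
  refine h.congr fun z hz ↦ ?_
  have h2 : (0 : ℝ) < ((p : ℂ) * z).im := by simpa using mul_pos hp hz
  simp only [Function.comp_apply]
  congr 1
  ext
  rw [coe_natScale, ofComplex_apply_of_im_pos hz, ofComplex_apply_of_im_pos h2]

/-- Weakly modular functions of weight `2 j` for the full modular group. -/
structure IsLevelOneForm (j : ℕ) (F : ℍ → ℂ) : Prop where
  mdiff : MDiff F
  smul : ∀ (g : SL(2, ℤ)) (z : ℍ), F (g • z) = (((g 1 0 : ℂ) * z + g 1 1) ^ 2) ^ j * F z

/-- Weakly modular functions of weight `2 j` for `Γ₀(p)` that are eigenfunctions of the Fricke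
involution with eigenvalue `ε`. -/
structure IsStarForm (p : ℕ) [NeZero p] (j : ℕ) (ε : ℤ) (F : ℍ → ℂ) : Prop where
  mdiff : MDiff F
  smul : ∀ g : SL(2, ℤ), (p : ℤ) ∣ g 1 0 → ∀ z : ℍ,
    F (g • z) = (((g 1 0 : ℂ) * z + g 1 1) ^ 2) ^ j * F z
  fricke_smul : ∀ z : ℍ, F (fricke p • z) = ε * (p * (z : ℂ) ^ 2) ^ j * F z

namespace IsLevelOneForm

variable {p : ℕ} [NeZero p] {j : ℕ} {F : ℍ → ℂ}

theorem S_smul (hF : IsLevelOneForm j F) (z : ℍ) :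
    F (ModularGroup.S • z) = ((z : ℂ) ^ 2) ^ j * F z := by
  rw [hF.smul]
  simp [ModularGroup.S]

theorem natScale_smul (hF : IsLevelOneForm j F) (g : SL(2, ℤ)) (hg : (p : ℤ) ∣ g 1 0) (z : ℍ) :
    F (natScale p (g • z)) = (((g 1 0 : ℂ) * z + g 1 1) ^ 2) ^ j * F (natScale p z) := by
  obtain ⟨g', h1, h2, h3⟩ := exists_natScale_smul p g hg
  have h1' : (g 1 0 : ℂ) = p * g' 1 0 := by rw [← h1]; push_cast; rfl
  rw [h3, hF.smul, h1', h2, coe_natScale]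
  congr 4
  ring

theorem add_smul_natScale (hF : IsLevelOneForm j F) {ε : ℤ} (hε : ε ^ 2 = 1) :
    IsStarForm p j ε (fun z ↦ F z + (ε * p ^ j : ℤ) * F (natScale p z)) where
  mdiff := hF.mdiff.add (mdifferentiable_const.mul (mdifferentiable_comp_natScale p hF.mdiff))
  smul g hg z := by
    rw [hF.smul, hF.natScale_smul g hg]; ring
  fricke_smul z := by
    have hε' : (ε : ℂ) ^ 2 = 1 := by exact_mod_cast hε
    rw [natScale_fricke_smul, fricke_smul_eq, hF.S_smul, hF.S_smul, coe_natScale]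
    push_cast
    linear_combination (-(p : ℂ) ^ j * p ^ j * ((z : ℂ) ^ 2) ^ j * F (natScale p z)) * hε' +
      F (natScale p z) * (by ring :
        ((p * (z : ℂ)) ^ 2) ^ j = (p : ℂ) ^ j * p ^ j * ((z : ℂ) ^ 2) ^ j)
      + ε * F z * (by rw [mul_pow] : (p : ℂ) ^ j * ((z : ℂ) ^ 2) ^ j = (p * (z : ℂ) ^ 2) ^ j)
      + ε ^ 2 * p ^ j * F (natScale p z) *
        (by rw [mul_pow] : (p : ℂ) ^ j * ((z : ℂ) ^ 2) ^ j = (p * (z : ℂ) ^ 2) ^ j)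

theorem mul_natScale (hF : IsLevelOneForm j F) :
    IsStarForm p (2 * j) 1 (fun z ↦ F z * F (natScale p z)) where
  mdiff := hF.mdiff.mul (mdifferentiable_comp_natScale p hF.mdiff)
  smul g hg z := by
    rw [hF.smul, hF.natScale_smul g hg]; ring
  fricke_smul z := by
    rw [natScale_fricke_smul, fricke_smul_eq, hF.S_smul, hF.S_smul, coe_natScale]
    push_cast
    ring

end IsLevelOneForm

namespace IsStarForm

variable {p : ℕ} [NeZero p] {j j' : ℕ} {ε ε' : ℤ} {F G : ℍ → ℂ}

theorem one : IsStarForm p 0 1 1 where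
  mdiff := mdifferentiable_const
  smul g hg z := by simp
  fricke_smul z := by simp

theorem mul (hF : IsStarForm p j ε F) (hG : IsStarForm p j' ε' G) :
    IsStarForm p (j + j') (ε * ε') (F * G) where
  mdiff := hF.mdiff.mul hG.mdiff
  smul g hg z := by simp only [Pi.mul_apply]; rw [hF.smul g hg, hG.smul g hg]; ring
  fricke_smul z := by
    simp only [Pi.mul_apply]; rw [hF.fricke_smul, hG.fricke_smul]; push_cast; ring

theorem pow (hF : IsStarForm p j ε F) (n : ℕ) : IsStarForm p (n * j) (ε ^ n) (F ^ n) := by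
  induction n with
  | zero => simpa using one
  | succ n ih => simpa [pow_succ, add_mul] using ih.mul hF

theorem add (hF : IsStarForm p j ε F) (hG : IsStarForm p j ε G) : IsStarForm p j ε (F + G) where
  mdiff := hF.mdiff.add hG.mdiff
  smul g hg z := by simp only [Pi.add_apply]; rw [hF.smul g hg, hG.smul g hg]; ring
  fricke_smul z := by
    simp only [Pi.add_apply]; rw [hF.fricke_smul, hG.fricke_smul]; ring

theorem zero : IsStarForm p j ε 0 where
  mdiff := mdifferentiable_const
  smul g hg z := by simp
  fricke_smul z := by simp

theorem const_smul (hF : IsStarForm p j ε F) (c : ℂ) : IsStarForm p j ε (c • F) where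
  mdiff := mdifferentiable_const.mul hF.mdiff
  smul g hg z := by simp only [Pi.smul_apply, smul_eq_mul]; rw [hF.smul g hg]; ring
  fricke_smul z := by
    simp only [Pi.smul_apply, smul_eq_mul]; rw [hF.fricke_smul]; ring

theorem sum {ι : Type*} (s : Finset ι) {F : ι → ℍ → ℂ} (h : ∀ i ∈ s, IsStarForm p j ε (F i)) :
    IsStarForm p j ε (∑ i ∈ s, F i) := by
  classical
  induction s using Finset.induction_on with
  | empty => simpa using zero
  | insert a s ha ih =>
    rw [Finset.sum_insert ha]
    exact (h a (by simp)).add (ih fun i hi ↦ h i (by simp [hi]))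

theorem isStarInvariant_div (hp : p.Prime) (hF : IsStarForm p j ε F) (hG : IsStarForm p j ε G)
    (hε : ε ≠ 0) : IsStarInvariant p (fun z ↦ F z / G z) := by
  have hp0 : (p : ℂ) ≠ 0 := by exact_mod_cast hp.ne_zero
  have hε' : (ε : ℂ) ≠ 0 := by exact_mod_cast hε
  have h1 : ∀ g : SL(2, ℤ), (p : ℤ) ∣ g 1 0 → ∀ z : ℍ, F (g • z) / G (g • z) = F z / G z := by
    intro g hg z
    have h0 : ((g 1 0 : ℂ) * z + g 1 1) ≠ 0 := by
      simpa [denom] using denom_ne_zero g z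
    rw [hF.smul g hg, hG.smul g hg, mul_div_mul_left _ _ (by positivity)]
  have h2 : ∀ z : ℍ, F (fricke p • z) / G (fricke p • z) = F z / G z := by
    intro z
    have := UpperHalfPlane.ne_zero z
    rw [hF.fricke_smul, hG.fricke_smul, mul_div_mul_left _ _ (by positivity)]
  intro γ hγ z
  obtain ⟨g, hg, rfl | rfl⟩ := Gamma0Star.exists_int hp hγ
  · simp only [map_smul_eq]; exact h1 g hg z
  · simp only [mul_smul, map_smul_eq]; rw [h1 g hg, h2]

end IsStarForm

end

section

open UpperHalfPlane Matrix Filter Topology Function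
open scoped MatrixGroups Manifold
local notation "𝕢" => Function.Periodic.qParam

/-- The function `F` on the upper half plane has the integral `q`-expansion `a`. -/
def HasQExp (F : ℍ → ℂ) (a : PowerSeries ℤ) : Prop :=
  ∀ z : ℍ, HasSum (fun n : ℕ ↦ (a.coeff n : ℂ) * 𝕢 1 z ^ n) (F z)

namespace HasQExp

variable {F G : ℍ → ℂ} {a b : PowerSeries ℤ}

theorem add (hF : HasQExp F a) (hG : HasQExp G b) : HasQExp (F + G) (a + b) := fun z ↦ by
  simpa [add_mul] using (hF z).add (hG z)

theorem const_smul (hF : HasQExp F a) (c : ℤ) : HasQExp ((c : ℂ) • F) (c • a) := fun z ↦ by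
  have := (hF z).mul_left (c : ℂ)
  simp only [← mul_assoc] at this
  simpa [-zsmul_eq_mul] using this

theorem mul (hF : HasQExp F a) (hG : HasQExp G b) : HasQExp (F * G) (a * b) := fun z ↦ by
  have h := (hF z).summable.norm
  have h' := (hG z).summable.norm
  have h1 := (summable_norm_sum_mul_antidiagonal_of_summable_norm h h').of_norm.hasSum
  rw [← tsum_mul_tsum_eq_tsum_sum_antidiagonal_of_summable_norm h h', (hF z).tsum_eq,
    (hG z).tsum_eq] at h1
  refine h1.congr_fun fun n ↦ ?_
  rw [PowerSeries.coeff_mul]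
  push_cast
  rw [Finset.sum_mul]
  refine Finset.sum_congr rfl fun kl hkl ↦ ?_
  rw [← Finset.HasAntidiagonal.mem_antidiagonal.1 hkl, pow_add]
  ring

theorem one : HasQExp 1 1 := fun z ↦ by
  convert hasSum_single 0 fun n hn ↦ ?_ using 1
  · simp
  · simp [PowerSeries.coeff_one, hn]

theorem zero : HasQExp 0 0 := fun z ↦ by
  simp [hasSum_zero]

theorem sum {ι : Type*} (s : Finset ι) {F : ι → ℍ → ℂ} {a : ι → PowerSeries ℤ}
    (h : ∀ i ∈ s, HasQExp (F i) (a i)) : HasQExp (∑ i ∈ s, F i) (∑ i ∈ s, a i) := by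
  classical
  induction s using Finset.induction_on with
  | empty => simpa using zero
  | insert i s hi ih =>
    rw [Finset.sum_insert hi, Finset.sum_insert hi]
    exact (h i (by simp)).add (ih fun j hj ↦ h j (by simp [hj]))

theorem natScale (hF : HasQExp F a) (p : ℕ) [NeZero p] :
    HasQExp (fun z ↦ F (natScale p z))
      (PowerSeries.mk fun n ↦ if p ∣ n then a.coeff (n / p) else 0) := fun z ↦ by
  have hp : p ≠ 0 := NeZero.ne p
  have hinj : Injective fun n : ℕ ↦ p * n := mul_right_injective₀ hp
  rw [← hinj.hasSum_iff]
  · convert hF (_root_.natScale p z) using 2 with n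
    simp [hp, pow_mul]
    left
    congr 1
    rw [Periodic.qParam, Periodic.qParam, ← Complex.exp_nat_mul]
    congr 1
    ring
  · intro n hn
    have : ¬ p ∣ n := fun ⟨k, hk⟩ ↦ hn ⟨k, hk.symm⟩
    simp [this]

end HasQExp

/-- The coefficients `1 + c ∑ σ_k(n) q^n`. -/
def eisCoeff (c : ℤ) (k : ℕ) : PowerSeries ℤ :=
  PowerSeries.mk fun n ↦ if n = 0 then 1 else c * ArithmeticFunction.sigma k n

theorem hasQExp_E2 : HasQExp EisensteinSeries.E2 (eisCoeff (-24) 1) := fun z ↦ by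
  convert EisensteinSeries.hasSum_qExpansion_E2 (z := z) using 2 with n
  split_ifs <;> simp [eisCoeff, Periodic.qParam, *]

theorem isLevelOneForm_E {k j : ℕ} (hk : 3 ≤ k) (hj : k = 2 * j) :
    IsLevelOneForm j (ModularForm.E hk) where
  mdiff := (ModularForm.E hk).holo'
  smul g z := by
    have h := congrFun (SlashInvariantForm.slash_action_eqn (ModularForm.E hk)
      (SpecialLinearGroup.mapGL ℝ g) ⟨g, rfl⟩) z
    have h' : SlashAction.map (k : ℤ) g (⇑(ModularForm.E hk)) z = ModularForm.E hk z := h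
    rw [ModularForm.SL_slash_apply] at h'
    have h0 : ((g 1 0 : ℂ) * z + g 1 1) ≠ 0 := by
      simpa [denom] using denom_ne_zero g z
    rw [← h', ← pow_mul, ← hj]
    simp [denom]
    field_simp

theorem hasQExp_E {k : ℕ} (hk : 3 ≤ k) (hk2 : Even k) (c : ℤ)
    (hc : -(2 * k / bernoulli k : ℂ) = c) : HasQExp (ModularForm.E hk) (eisCoeff c (k - 1)) :=
  fun z ↦ by
  convert ModularForm.hasSum_qExpansion (ModularForm.E hk) one_pos (by simp) z using 2 with n
  rw [EisensteinSeries.E_qExpansion_coeff hk hk2, hc, eisCoeff, PowerSeries.coeff_mk]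
  split_ifs <;> simp

theorem hasQExp_E4 : HasQExp (ModularForm.E (k := 4) (by norm_num)) (eisCoeff 240 3) :=
  hasQExp_E (by norm_num) ⟨2, rfl⟩ 240 (by simp [bernoulli_eq_bernoulli'_of_ne_one]; norm_num)

theorem hasQExp_E6 : HasQExp (ModularForm.E (k := 6) (by norm_num)) (eisCoeff (-504) 5) :=
  hasQExp_E (by norm_num) ⟨3, rfl⟩ (-504) (by
    rw [bernoulli_eq_bernoulli'_of_ne_one (by norm_num), bernoulli'_def]
    simp [Finset.sum_range_succ]
    norm_num [Nat.choose]
    rw [bernoulli'_eq_zero_of_odd (by decide) (by norm_num)]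
    norm_num)

theorem E2_smul (g : SL(2, ℤ)) (z : ℍ) : EisensteinSeries.E2 (g • z) =
    ((g 1 0 : ℂ) * z + g 1 1) ^ 2 * EisensteinSeries.E2 z
      - (1 / (2 * riemannZeta 2)) * (2 * Real.pi * Complex.I) * (g 1 0) *
        ((g 1 0 : ℂ) * z + g 1 1) := by
  have h0 : ((g 1 0 : ℂ) * z + g 1 1) ≠ 0 := by
    simpa [denom] using denom_ne_zero g z
  have h := congrFun (EisensteinSeries.E2_slash_action g) z
  rw [ModularForm.SL_slash_apply] at h
  simp only [EisensteinSeries.D2, Pi.sub_apply, Pi.smul_apply, smul_eq_mul] at h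
  have hd : denom g z = (g 1 0 : ℂ) * z + g 1 1 := by simp [denom]
  rw [hd] at h
  rw [_root_.zpow_neg, ← div_eq_mul_inv, div_eq_iff (zpow_ne_zero _ h0)] at h
  rw [h]
  field_simp

/-- The weight two Eisenstein series for `Γ₀(p)`. -/
theorem isStarForm_E2 (p : ℕ) [NeZero p] : IsStarForm p 1 (-1)
    (fun z ↦ p * EisensteinSeries.E2 (natScale p z) - EisensteinSeries.E2 z) where
  mdiff := (mdifferentiable_const.mul (mdifferentiable_comp_natScale p
    E2_mdifferentiable)).sub E2_mdifferentiable
  smul g hg z := by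
    obtain ⟨g', h1, h2, h3⟩ := exists_natScale_smul p g hg
    have h1' : (g 1 0 : ℂ) = p * g' 1 0 := by rw [← h1]; push_cast; rfl
    rw [h3, E2_smul, E2_smul, h1', h2, coe_natScale]
    ring
  fricke_smul z := by
    rw [natScale_fricke_smul, fricke_smul_eq, E2_smul, E2_smul, coe_natScale]
    simp [ModularGroup.S]
    ring

theorem isLevelOneForm_discriminant : IsLevelOneForm 6 ModularForm.discriminant where
  mdiff := CuspForm.discriminant.holo'
  smul g z := by
    have h := congrFun (SlashInvariantForm.slash_action_eqn CuspForm.discriminant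
      (SpecialLinearGroup.mapGL ℝ g) ⟨g, rfl⟩) z
    have h' : SlashAction.map (12 : ℤ) g ModularForm.discriminant z = ModularForm.discriminant z :=
      h
    rw [ModularForm.SL_slash_apply] at h'
    have h0 : ((g 1 0 : ℂ) * z + g 1 1) ≠ 0 := by
      simpa [denom] using denom_ne_zero g z
    rw [← h', ← pow_mul]
    simp [denom]
    field_simp

theorem tendsto_qParam_inv_mul_discriminant :
    Tendsto (fun z : ℍ ↦ ModularForm.discriminant z / 𝕢 1 z) atImInfty (𝓝 1) := by
  refine ModularForm.tendsto_atImInfty_tprod_one_sub_eta_q_pow.congr fun z ↦ ?_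
  rw [ModularForm.discriminant_eq_q_prod, mul_div_cancel_left₀ _ (Periodic.qParam_ne_zero _)]

theorem tendsto_natScale_atImInfty (p : ℕ) [NeZero p] :
    Tendsto (natScale p) atImInfty atImInfty := by
  have hp : (1 : ℝ) ≤ p := by exact_mod_cast Nat.pos_of_ne_zero (NeZero.ne p)
  refine tendsto_comap_iff.2 (tendsto_atTop_mono (fun z : ℍ ↦ ?_) tendsto_comap)
  have : (natScale p z).im = p * z.im := by
    rw [← coe_im, coe_natScale]; simp
  simp only [Function.comp_apply, this]
  nlinarith [z.im_pos]

theorem qParam_natScale (p : ℕ) [NeZero p] (z : ℍ) : 𝕢 1 (natScale p z) = 𝕢 1 z ^ p := by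
  rw [Periodic.qParam, Periodic.qParam, ← Complex.exp_nat_mul, coe_natScale]
  congr 1
  push_cast
  ring

/-- Extracting the leading coefficient of a `q`-expansion. -/
theorem HasQExp.tendsto_div_pow {F : ℍ → ℂ} {a : PowerSeries ℤ} (hF : HasQExp F a) {N : ℕ}
    (h : ∀ n < N, a.coeff n = 0) :
    Tendsto (fun z : ℍ ↦ F z / 𝕢 1 z ^ N) atImInfty (𝓝 (a.coeff N)) := by
  have hq (z : ℍ) : 𝕢 1 z ≠ 0 := Periodic.qParam_ne_zero _
  have h1 (z : ℍ) : HasSum (fun n : ℕ ↦ (a.coeff (n + N) : ℂ) * 𝕢 1 z ^ n) (F z / 𝕢 1 z ^ N) := by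
    have h2 := (hasSum_nat_add_iff' N).2 (hF z)
    rw [Finset.sum_eq_zero fun n hn ↦ by simp [h n (Finset.mem_range.1 hn)], sub_zero] at h2
    refine (h2.div_const (𝕢 1 z ^ N)).congr_fun fun n ↦ ?_
    have := hq z
    rw [pow_add]
    field_simp
  have h2 (z : ℍ) : F z / 𝕢 1 z ^ N = ∑' n : ℕ, (a.coeff (n + N) : ℂ) * 𝕢 1 z ^ n :=
    (h1 z).tsum_eq.symm
  have h3 : (a.coeff N : ℂ) = ∑' n : ℕ, if n = 0 then (a.coeff N : ℂ) else 0 := by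
    rw [tsum_ite_eq]
  simp only [h2]
  rw [h3]
  refine tendsto_tsum_of_dominated_convergence (h1 UpperHalfPlane.I).summable.norm (fun n ↦ ?_) ?_
  · have h4 : Tendsto (fun z : ℍ ↦ 𝕢 1 z) atImInfty (𝓝 0) :=
      qParam_tendsto_atImInfty one_pos
    rcases eq_or_ne n 0 with rfl | hn
    · simp
    · simpa [hn] using (h4.pow n).const_mul ((a.coeff (n + N) : ℂ))
  · refine eventually_atImInfty_iff.2 ⟨1, fun z hz n ↦ ?_⟩
    rw [norm_mul, norm_mul, norm_pow, norm_pow]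
    gcongr
    rw [Periodic.norm_qParam, Periodic.norm_qParam]
    simp
    nlinarith [Real.pi_pos, hz]

theorem isGenusZeroStar_of_isStarForm {p : ℕ} [NeZero p] (hp : p.Prime) {m N : ℕ} {F : ℍ → ℂ}
    {a : PowerSeries ℤ} (hF : IsStarForm p (12 * m) 1 F) (ha : HasQExp F a)
    (hN : N + 1 = m * (p + 1)) (h : ∀ n < N, a.coeff n = 0) (h0 : a.coeff N ≠ 0) :
    IsGenusZeroStar p := by
  set G : ℍ → ℂ := fun z ↦ ModularForm.discriminant z * ModularForm.discriminant (natScale p z)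
  have hG : IsStarForm p (12 * m) 1 (G ^ m) := by
    have := (isLevelOneForm_discriminant.mul_natScale (p := p)).pow m
    simpa [mul_comm] using this
  have hG0 : ∀ z, (G ^ m) z ≠ 0 := fun z ↦ pow_ne_zero _
    (mul_ne_zero (ModularForm.discriminant_ne_zero _) (ModularForm.discriminant_ne_zero _))
  have hinv := hF.isStarInvariant_div hp hG one_ne_zero
  have hmd : MDiff (fun z ↦ F z / (G ^ m) z) := by
    have h1 := UpperHalfPlane.mdifferentiable_iff.1 hF.mdiff
    have h2 := UpperHalfPlane.mdifferentiable_iff.1 hG.mdiff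
    exact UpperHalfPlane.mdifferentiable_iff.2 (h1.div h2 fun z _ ↦ hG0 _)
  have ha0 : ((a.coeff N : ℤ) : ℂ) ≠ 0 := by exact_mod_cast h0
  refine isGenusZeroStar_of_pole hp hinv hmd ha0 ?_
  have hd := tendsto_qParam_inv_mul_discriminant
  have hGt : Tendsto (fun z : ℍ ↦ ((ModularForm.discriminant z / 𝕢 1 z) *
      (ModularForm.discriminant (natScale p z) / 𝕢 1 (natScale p z))) ^ m) atImInfty (𝓝 1) := by
    simpa using (hd.mul (hd.comp (tendsto_natScale_atImInfty p))).pow m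
  have := (ha.tendsto_div_pow h).div hGt one_ne_zero
  rw [div_one] at this
  refine this.congr fun z ↦ ?_
  have hq : 𝕢 1 z ≠ 0 := Periodic.qParam_ne_zero _
  have hD : G z ≠ 0 := mul_ne_zero (ModularForm.discriminant_ne_zero _)
      (ModularForm.discriminant_ne_zero _)
  have e : (ModularForm.discriminant z / 𝕢 1 z) *
      (ModularForm.discriminant (natScale p z) / 𝕢 1 (natScale p z)) = G z / 𝕢 1 z ^ (p + 1) := by
    rw [qParam_natScale, pow_succ', div_mul_div_comm]
  simp only [Pi.div_apply]
  rw [e, div_pow, ← pow_mul, mul_comm (p + 1), ← hN, pow_succ, Pi.pow_apply]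
  field_simp

end

section

open UpperHalfPlane Matrix Filter Topology Function
open scoped MatrixGroups Manifold Polynomial

namespace QPack

/-- The base in which truncated power series are packed into natural numbers. -/
abbrev base : ℕ := 4294967296

/-- The auxiliary modulus. -/
abbrev modulus : ℕ := 1009

/-- Reduce the first `n` digits modulo `modulus` and drop the others. -/
def normalize : ℕ → ℕ → ℕ
  | 0, _ => 0
  | n + 1, x => x % base % modulus + base * normalize n (x / base)

/-- The number with digits `f i, f (i + 1), …, f (i + n - 1)`, reduced modulo `modulus`. -/
def pack (f : ℕ → ℕ) (i : ℕ) : ℕ → ℕ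
  | 0 => 0
  | n + 1 => f i % modulus + base * pack f (i + 1) n

/-- `∑ d ^ k` over the divisors `d ≤ m` of `n`. -/
def sigmaUpTo (k n : ℕ) : ℕ → ℕ
  | 0 => 0
  | d + 1 => bif Nat.beq (n % (d + 1)) 0 then sigmaUpTo k n d + (d + 1) ^ k else sigmaUpTo k n d

/-- Coefficients of Eisenstein series. -/
def eisNat (c k n : ℕ) : ℕ := bif Nat.beq n 0 then 1 else c * sigmaUpTo k n n

/-- Coefficients of `f (q ^ p)`. -/
def scaleNat (p : ℕ) (f : ℕ → ℕ) (n : ℕ) : ℕ := bif Nat.beq (n % p) 0 then f (n / p) else 0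

/-- Powers `x ^ n, …, x, 1`, in decreasing order. -/
def powTable (N x : ℕ) : ℕ → List ℕ
  | 0 => [1]
  | n + 1 => normalize N (x * (powTable N x n).headD 0) :: powTable N x n

/-- Reduce `x` by the echelon rows, inserting the result at the first free pivot. -/
def insertRow (N : ℕ) : List ℕ → ℕ → ℕ → List ℕ
  | [], _, _ => []
  | r :: rs, j, x =>
    bif Nat.beq (x / base ^ j % base % modulus) 0 then r :: insertRow N rs (j + 1) x
    else bif Nat.beq r 0 then
      normalize N ((x / base ^ j % base % modulus) ^ (modulus - 2) % modulus * normalize N x) :: rs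
    else r :: insertRow N rs (j + 1) (x + (modulus - x / base ^ j % base % modulus) * r)

/-- Exponents of the monomials of total weight `2 W` and trivial Fricke eigenvalue. -/
def exponents (W : ℕ) : List (ℕ × ℕ × ℕ × ℕ × ℕ) :=
  (List.range (W / 3 + 1)).flatMap fun f ↦
  (List.range (W / 3 + 1 - f)).flatMap fun d ↦
  (List.range ((W - 3 * (d + f)) / 2 + 1)).flatMap fun c ↦
  (List.range ((W - 3 * (d + f)) / 2 + 1 - c)).map fun b ↦
    (W - 3 * (d + f) - 2 * (b + c), b, c, d, f)

/-- Gaussian elimination applied to the given monomials. -/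
def eliminate (N W : ℕ) (te t4 t4' t6 t6' : List ℕ) :
    List (ℕ × ℕ × ℕ × ℕ × ℕ) → List ℕ → List ℕ
  | [], rows => rows
  | (a, b, c, d, f) :: l, rows =>
    eliminate N W te t4 t4' t6 t6' l
     (bif Nat.beq (a + 2 * b + 2 * c + 3 * d + 3 * f) W && Nat.beq ((a + c + f) % 2) 0 then
      insertRow N rows 0
        (normalize N (normalize N (normalize N (te.getD a 0 * t4.getD b 0) *
          normalize N (t4'.getD c 0 * t6.getD d 0)) * t6'.getD f 0))
      else rows)

/-- The first `i` digits of `x` are those of `base ^ j`. -/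
def checkRow (x j : ℕ) : ℕ → Bool
  | 0 => true
  | i + 1 => Nat.beq (x / base ^ i % base % modulus) (bif Nat.beq i j then 1 else 0) &&
      checkRow x j i

/-- The rows are those of a unipotent upper triangular matrix. -/
def checkRows : List ℕ → ℕ → Bool
  | [], _ => true
  | r :: rs, j => checkRow r j (j + 1) && checkRows rs (j + 1)

/-- Gaussian elimination applied to monomials in Eisenstein series produces all possible
leading exponents below `m * (p + 1)`. -/
def certificate (p m K : ℕ) : Bool :=
  let N := m * (p + 1)
  let x2 := pack (eisNat 985 1) 0 N
  let v2 := pack (scaleNat p (eisNat 985 1)) 0 N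
  let x4 := pack (eisNat 240 3) 0 N
  let v4 := pack (scaleNat p (eisNat 240 3)) 0 N
  let x6 := pack (eisNat 505 5) 0 N
  let v6 := pack (scaleNat p (eisNat 505 5)) 0 N
  checkRows (eliminate N (12 * m)
    (powTable N (normalize N (1008 * x2 + p % modulus * v2)) (12 * m)).reverse
    (powTable N (normalize N (1 * x4 + p ^ 2 % modulus * v4)) (6 * m)).reverse
    (powTable N (normalize N (1 * x4 + 1008 * p ^ 2 % modulus * v4)) (6 * m)).reverse
    (powTable N (normalize N (1 * x6 + p ^ 3 % modulus * v6)) (4 * m)).reverse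
    (powTable N (normalize N (1 * x6 + 1008 * p ^ 3 % modulus * v6)) (4 * m)).reverse
    ((exponents (12 * m)).take K) (List.replicate N 0)) 0


/-- `x` packs the first `N` coefficients of `a` modulo `modulus`, with digits at most `M`. -/
def Packs (N M x : ℕ) (a : PowerSeries ℤ) : Prop :=
  ∃ P : ℕ[X], P.eval base = x ∧
    (∀ i < N, ((P.coeff i : ℕ) : ZMod modulus) = ((a.coeff i : ℤ) : ZMod modulus)) ∧
    (∀ i, P.coeff i ≤ M) ∧ ∀ i, N ≤ i → P.coeff i = 0

theorem eval_mod {P : ℕ[X]} (h : ∀ i, P.coeff i < base) : P.eval base % base = P.coeff 0 := by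
  conv_lhs => rw [← P.divX_mul_X_add]
  simp only [Polynomial.eval_add, Polynomial.eval_mul, Polynomial.eval_X, Polynomial.eval_C]
  rw [Nat.mul_add_mod_self_right, Nat.mod_eq_of_lt (h 0)]

theorem eval_div {P : ℕ[X]} (h : ∀ i, P.coeff i < base) :
    P.eval base / base = P.divX.eval base := by
  conv_lhs => rw [← P.divX_mul_X_add]
  simp only [Polynomial.eval_add, Polynomial.eval_mul, Polynomial.eval_X, Polynomial.eval_C]
  rw [add_comm, Nat.add_mul_div_right _ _ (by norm_num), Nat.div_eq_of_lt (h 0), zero_add]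

theorem eval_digit {P : ℕ[X]} (h : ∀ i, P.coeff i < base) (i : ℕ) :
    P.eval base / base ^ i % base = P.coeff i := by
  induction i generalizing P with
  | zero => simpa using eval_mod h
  | succ i ih =>
    rw [pow_succ', ← Nat.div_div_eq_div_mul, eval_div h, ih fun j ↦ by
      simpa [Polynomial.coeff_divX] using h (j + 1)]
    simp [Polynomial.coeff_divX]

theorem exists_normalize (n : ℕ) {P : ℕ[X]} (h : ∀ i, P.coeff i < base) :
    ∃ Q : ℕ[X], Q.eval base = normalize n (P.eval base) ∧
      (∀ i < n, Q.coeff i = P.coeff i % modulus) ∧ ∀ i, n ≤ i → Q.coeff i = 0 := by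
  induction n generalizing P with
  | zero => exact ⟨0, by simp [normalize], by simp, by simp⟩
  | succ n ih =>
    obtain ⟨Q, h1, h2, h3⟩ := ih (P := P.divX) fun j ↦ by
      simpa [Polynomial.coeff_divX] using h (j + 1)
    refine ⟨Polynomial.X * Q + Polynomial.C (P.coeff 0 % modulus), ?_, ?_, ?_⟩
    · rw [normalize, eval_mod h, eval_div h, ← h1]
      simp [add_comm]
    · rintro (_ | i) hi
      · simp
      · simpa [Polynomial.coeff_X_mul, Polynomial.coeff_C_succ, Polynomial.coeff_divX]
          using h2 i (by omega)
    · rintro (_ | i) hi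
      · omega
      · simpa [Polynomial.coeff_X_mul, Polynomial.coeff_C_succ] using h3 i (by omega)

theorem packs_normalize {N : ℕ} {P : ℕ[X]} {a : PowerSeries ℤ} (h : ∀ i, P.coeff i < base)
    (ha : ∀ i < N, ((P.coeff i : ℕ) : ZMod modulus) = ((a.coeff i : ℤ) : ZMod modulus)) :
    Packs N modulus (normalize N (P.eval base)) a := by
  obtain ⟨Q, h1, h2, h3⟩ := exists_normalize N h
  refine ⟨Q, h1, fun i hi ↦ ?_, fun i ↦ ?_, h3⟩
  · rw [h2 i hi, ZMod.natCast_mod, ha i hi]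
  · rcases lt_or_ge i N with hi | hi
    · rw [h2 i hi]; exact (Nat.mod_lt _ (by norm_num)).le
    · rw [h3 i hi]; exact Nat.zero_le _

theorem coeff_mul_le {N M M' : ℕ} {P Q : ℕ[X]} (hP : ∀ i, P.coeff i ≤ M) (hQ : ∀ i, Q.coeff i ≤ M')
    (hN : ∀ i, N ≤ i → P.coeff i = 0) (n : ℕ) : (P * Q).coeff n ≤ N * (M * M') := by
  rw [Polynomial.coeff_mul, Finset.Nat.sum_antidiagonal_eq_sum_range_succ_mk]
  calc _ ≤ ∑ k ∈ Finset.range (n + 1), if k < N then M * M' else 0 := by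
        refine Finset.sum_le_sum fun k _ ↦ ?_
        split_ifs with hk
        · exact Nat.mul_le_mul (hP _) (hQ _)
        · simp [hN k (not_lt.1 hk)]
    _ = ((Finset.range (n + 1)).filter (· < N)).card * (M * M') := by
        rw [← Finset.sum_filter, Finset.sum_const, smul_eq_mul]
    _ ≤ N * (M * M') := by
        gcongr
        calc _ ≤ (Finset.range N).card := Finset.card_le_card fun x hx ↦ by
              simpa using (Finset.mem_filter.1 hx).2
          _ = N := Finset.card_range N

namespace Packs

variable {N M x y : ℕ} {a b : PowerSeries ℤ}

theorem mul (hN : N ≤ 1000) (hx : Packs N modulus x a) (hy : Packs N modulus y b) :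
    Packs N modulus (normalize N (x * y)) (a * b) := by
  obtain ⟨P, rfl, h1, h2, h3⟩ := hx
  obtain ⟨Q, rfl, h1', h2', h3'⟩ := hy
  rw [← Polynomial.eval_mul]
  refine packs_normalize (fun i ↦ (coeff_mul_le h2 h2' h3 i).trans_lt ?_) fun i hi ↦ ?_
  · calc N * (modulus * modulus) ≤ 1000 * (modulus * modulus) := by gcongr
      _ < base := by norm_num
  · rw [Polynomial.coeff_mul, PowerSeries.coeff_mul]
    push_cast
    refine Finset.sum_congr rfl fun kl hkl ↦ ?_
    have := Finset.HasAntidiagonal.mem_antidiagonal.1 hkl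
    rw [h1 _ (by omega), h1' _ (by omega)]

theorem add_mul {M' : ℕ} (c : ℕ) (hx : Packs N M x a) (hy : Packs N M' y b) :
    Packs N (M + c * M') (x + c * y) (a + (c : ℤ) • b) := by
  obtain ⟨P, rfl, h1, h2, h3⟩ := hx
  obtain ⟨Q, rfl, h1', h2', h3'⟩ := hy
  refine ⟨P + Polynomial.C c * Q, by simp, fun i hi ↦ ?_, fun i ↦ ?_, fun i hi ↦ ?_⟩
  · simp [-zsmul_eq_mul, -nsmul_eq_mul, h1 i hi, h1' i hi]
  · simpa using Nat.add_le_add (h2 i) (Nat.mul_le_mul_left c (h2' i))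
  · simp [h3 i hi, h3' i hi]

theorem const_mul (c : ℕ) (hx : Packs N M x a) : Packs N (c * M) (c * x) ((c : ℤ) • a) := by
  obtain ⟨P, rfl, h1, h2, h3⟩ := hx
  refine ⟨Polynomial.C c * P, by simp, fun i hi ↦ ?_, fun i ↦ ?_, fun i hi ↦ ?_⟩
  · simp [-zsmul_eq_mul, -nsmul_eq_mul, h1 i hi]
  · simpa using Nat.mul_le_mul_left c (h2 i)
  · simp [h3 i hi]

theorem norm (hM : M < base) (hx : Packs N M x a) : Packs N modulus (normalize N x) a := by
  obtain ⟨P, rfl, h1, h2, h3⟩ := hx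
  exact packs_normalize (fun i ↦ (h2 i).trans_lt hM) h1

theorem congr (hx : Packs N M x a)
    (h : ∀ i < N, ((a.coeff i : ℤ) : ZMod modulus) = ((b.coeff i : ℤ) : ZMod modulus)) :
    Packs N M x b := by
  obtain ⟨P, rfl, h1, h2, h3⟩ := hx
  exact ⟨P, rfl, fun i hi ↦ (h1 i hi).trans (h i hi), h2, h3⟩

theorem digit (hM : M < base) (hx : Packs N M x a) {i : ℕ} (hi : i < N) :
    ((x / base ^ i % base % modulus : ℕ) : ZMod modulus) = ((a.coeff i : ℤ) : ZMod modulus) := by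
  obtain ⟨P, rfl, h1, h2, h3⟩ := hx
  rw [eval_digit (fun i ↦ (h2 i).trans_lt hM), ZMod.natCast_mod, h1 i hi]

theorem of_pack (f : ℕ → ℕ)
    (h : ∀ i < N, ((f i : ℕ) : ZMod modulus) = ((a.coeff i : ℤ) : ZMod modulus)) :
    Packs N modulus (pack f 0 N) a := by
  have key (n i : ℕ) : ∃ P : ℕ[X], P.eval base = pack f i n ∧
      (∀ k < n, P.coeff k = f (i + k) % modulus) ∧ ∀ k, n ≤ k → P.coeff k = 0 := by
    induction n generalizing i with
    | zero => exact ⟨0, by simp [pack], by simp, by simp⟩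
    | succ n ih =>
      obtain ⟨Q, h1, h2, h3⟩ := ih (i + 1)
      refine ⟨Polynomial.X * Q + Polynomial.C (f i % modulus), ?_, ?_, ?_⟩
      · rw [pack, ← h1]
        simp [add_comm]
      · rintro (_ | k) hk
        · simp
        · simpa [Polynomial.coeff_X_mul, Polynomial.coeff_C_succ, add_assoc, add_comm 1]
            using h2 k (by omega)
      · rintro (_ | k) hk
        · omega
        · simpa [Polynomial.coeff_X_mul, Polynomial.coeff_C_succ] using h3 k (by omega)
  obtain ⟨P, h1, h2, h3⟩ := key N 0
  refine ⟨P, h1, fun i hi ↦ ?_, fun i ↦ ?_, h3⟩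
  · rw [h2 i hi, ZMod.natCast_mod, zero_add, h i hi]
  · rcases lt_or_ge i N with hi | hi
    · rw [h2 i hi]; exact (Nat.mod_lt _ (by norm_num)).le
    · rw [h3 i hi]; exact Nat.zero_le _

end Packs

theorem sigmaUpTo_eq (k n m : ℕ) :
    sigmaUpTo k n m = ∑ d ∈ (Finset.Icc 1 m).filter (· ∣ n), d ^ k := by
  induction m with
  | zero => simp [sigmaUpTo]
  | succ d ih =>
    rw [sigmaUpTo, ← Finset.insert_Icc_right_eq_Icc_add_one (by omega), Finset.filter_insert, ih]
    by_cases h : d + 1 ∣ n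
    · rw [if_pos h, Finset.sum_insert (by simp)]
      simp [Nat.mod_eq_zero_of_dvd h, add_comm]
    · have : Nat.beq (n % (d + 1)) 0 = false :=
        Bool.eq_false_iff.2 fun h' ↦ h (Nat.dvd_of_mod_eq_zero (Nat.eq_of_beq_eq_true h'))
      simp [h, this]

theorem eisNat_cast {c : ℕ} {c' : ℤ} (hc : (c : ZMod modulus) = c') (k n : ℕ) :
    ((eisNat c k n : ℕ) : ZMod modulus) = (((eisCoeff c' k).coeff n : ℤ) : ZMod modulus) := by
  rcases eq_or_ne n 0 with rfl | hn
  · simp [eisNat, eisCoeff]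
  · have : sigmaUpTo k n n = ArithmeticFunction.sigma k n := by
      rw [sigmaUpTo_eq, ArithmeticFunction.sigma_apply, Nat.divisors]
      rfl
    have h0 : Nat.beq n 0 = false := Bool.eq_false_iff.2 fun h' ↦ hn (Nat.eq_of_beq_eq_true h')
    simp [eisNat, eisCoeff, hn, hc, this, h0]

end QPack

end

section

open UpperHalfPlane Matrix Filter Topology Function
open scoped MatrixGroups Manifold Polynomial

namespace QPack

theorem scaleNat_cast {c : ℕ} {c' : ℤ} (hc : (c : ZMod modulus) = c') (k p n : ℕ) :
    ((scaleNat p (eisNat c k) n : ℕ) : ZMod modulus) = (((PowerSeries.mk fun n ↦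
      if p ∣ n then (eisCoeff c' k).coeff (n / p) else 0).coeff n : ℤ) : ZMod modulus) := by
  rw [PowerSeries.coeff_mk, scaleNat]
  by_cases h : p ∣ n
  · rw [if_pos h, ← eisNat_cast hc]
    simp [Nat.mod_eq_zero_of_dvd h]
  · have h0 : Nat.beq (n % p) 0 = false :=
      Bool.eq_false_iff.2 fun h' ↦ h (Nat.dvd_of_mod_eq_zero (Nat.eq_of_beq_eq_true h'))
    simp [h, h0]

theorem Packs.mono {N M M' x : ℕ} {a : PowerSeries ℤ} (hM : M ≤ M') (hx : Packs N M x a) :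
    Packs N M' x a := by
  obtain ⟨P, h0, h1, h2, h3⟩ := hx
  exact ⟨P, h0, h1, fun i ↦ (h2 i).trans hM, h3⟩

theorem Packs.combination {N x y : ℕ} {a b : PowerSeries ℤ} {c d : ℕ} {c' d' : ℤ}
    (hx : Packs N modulus x a) (hy : Packs N modulus y b) (hc : (c : ZMod modulus) = c')
    (hd : (d : ZMod modulus) = d') (hc' : c ≤ modulus) (hd' : d ≤ modulus) :
    Packs N modulus (normalize N (c * x + d * y)) (c' • a + d' • b) := by
  refine (((hx.const_mul c).add_mul d hy).norm ?_).congr fun i _ ↦ ?_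
  · calc c * modulus + d * modulus ≤ modulus * modulus + modulus * modulus := by gcongr
      _ < base := by norm_num
  · simp [-zsmul_eq_mul, -nsmul_eq_mul, hc, hd]

/-- `x` packs the `q`-expansion of a form of weight `2 j` with Fricke eigenvalue `ε`. -/
def Good (p N : ℕ) [NeZero p] (j : ℕ) (ε : ℤ) (M x : ℕ) : Prop :=
  ∃ F a, IsStarForm p j ε F ∧ HasQExp F a ∧ Packs N M x a

namespace Good

variable {p N j j' M M' x y : ℕ} [NeZero p] {ε ε' : ℤ}

theorem mul (hN : N ≤ 1000) (hx : Good p N j ε modulus x) (hy : Good p N j' ε' modulus y) :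
    Good p N (j + j') (ε * ε') modulus (normalize N (x * y)) := by
  obtain ⟨F, a, h1, h2, h3⟩ := hx
  obtain ⟨G, b, h1', h2', h3'⟩ := hy
  exact ⟨F * G, a * b, h1.mul h1', h2.mul h2', h3.mul hN h3'⟩

theorem add_mul (c : ℕ) (hx : Good p N j ε M x) (hy : Good p N j ε M' y) :
    Good p N j ε (M + c * M') (x + c * y) := by
  obtain ⟨F, a, h1, h2, h3⟩ := hx
  obtain ⟨G, b, h1', h2', h3'⟩ := hy
  exact ⟨_, _, h1.add (h1'.const_smul _), h2.add (h2'.const_smul c), h3.add_mul c h3'⟩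

theorem const_mul (c : ℕ) (hx : Good p N j ε M x) : Good p N j ε (c * M) (c * x) := by
  obtain ⟨F, a, h1, h2, h3⟩ := hx
  exact ⟨_, _, h1.const_smul _, h2.const_smul c, h3.const_mul c⟩

theorem norm (hM : M < base) (hx : Good p N j ε M x) : Good p N j ε modulus (normalize N x) := by
  obtain ⟨F, a, h1, h2, h3⟩ := hx
  exact ⟨F, a, h1, h2, h3.norm hM⟩

theorem mono (hM : M ≤ M') (hx : Good p N j ε M x) : Good p N j ε M' x := by
  obtain ⟨F, a, h1, h2, h3⟩ := hx
  exact ⟨F, a, h1, h2, h3.mono hM⟩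

theorem zero : Good p N j ε M 0 :=
  ⟨0, 0, .zero, .zero, 0, by simp, by simp, by simp, by simp⟩

theorem one (hN : 1 ≤ N) : Good p N 0 1 modulus 1 := by
  refine ⟨1, 1, .one, .one, 1, by simp, fun i _ ↦ ?_, fun i ↦ ?_, fun i hi ↦ ?_⟩
  · simp only [Polynomial.coeff_one, PowerSeries.coeff_one, eq_comm]
    split_ifs <;> simp
  · rw [Polynomial.coeff_one]; split_ifs <;> norm_num
  · rw [Polynomial.coeff_one, if_neg (by omega)]

theorem powTable (hN : N ≤ 1000) (hN' : 1 ≤ N) (hx : Good p N j ε modulus x) (n i : ℕ) :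
    Good p N (i * j) (ε ^ i) modulus ((powTable N x n).reverse.getD i 0) := by
  have hlen (n : ℕ) : (QPack.powTable N x n).length = n + 1 := by
    induction n with
    | zero => rfl
    | succ n ih => simp [QPack.powTable, ih]
  have hhead (n : ℕ) : Good p N (n * j) (ε ^ n) modulus ((QPack.powTable N x n).headD 0) := by
    induction n with
    | zero => simpa [QPack.powTable] using one hN'
    | succ n ih =>
      simpa [QPack.powTable, pow_succ', add_one_mul, add_comm] using hx.mul hN ih
  induction n with
  | zero =>
    rcases i with _ | i
    · simpa [QPack.powTable] using one hN'
    · simpa [QPack.powTable] using zero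
  | succ n ih =>
    have h := hhead (n + 1)
    rw [QPack.powTable] at h ⊢
    rw [List.reverse_cons]
    rcases lt_trichotomy i (n + 1) with hi | rfl | hi
    · rw [List.getD_append _ _ _ _ (by simpa [hlen] using hi)]
      exact ih
    · rw [List.getD_append_right _ _ _ _ (by simp [hlen])]
      simpa [hlen] using h
    · rw [List.getD_eq_default _ _ (by simpa [hlen] using hi)]
      exact zero

theorem of_E2 : Good p N 1 (-1) modulus (normalize N (1008 * pack (eisNat 985 1) 0 N +
    p % modulus * pack (scaleNat p (eisNat 985 1)) 0 N)) := by
  have hc : ((985 : ℕ) : ZMod modulus) = ((-24 : ℤ) : ZMod modulus) := by decide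
  have h := (hasQExp_E2.const_smul (-1)).add ((hasQExp_E2.natScale p).const_smul p)
  have h1 := (Packs.of_pack (N := N) (a := eisCoeff (-24) 1) (eisNat 985 1)
    fun i _ ↦ eisNat_cast hc 1 i)
  have h2 := (Packs.of_pack (N := N) (scaleNat p (eisNat 985 1)) fun i _ ↦ scaleNat_cast hc 1 p i)
  refine ⟨_, _, isStarForm_E2 p, ?_, h1.combination h2 (c' := -1) (d' := p) (by decide) (by simp)
    (by norm_num) (Nat.mod_lt _ (by norm_num)).le⟩
  convert h using 1
  · ext z
    simp
    ring

theorem of_levelOne {F : ℍ → ℂ} (hF : IsLevelOneForm j F) {c k : ℕ} {c' : ℤ}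
    (ha : HasQExp F (eisCoeff c' k)) (hc : (c : ZMod modulus) = c') (hε : ε ^ 2 = 1) {d : ℕ}
    (hd : (d : ZMod modulus) = (ε * p ^ j : ℤ)) (hd' : d ≤ modulus) :
    Good p N j ε modulus (normalize N (1 * pack (eisNat c k) 0 N +
      d * pack (scaleNat p (eisNat c k)) 0 N)) := by
  have h := ha.add ((ha.natScale p).const_smul (ε * p ^ j))
  have h1 := (Packs.of_pack (N := N) (a := eisCoeff c' k) (eisNat c k)
    fun i _ ↦ eisNat_cast hc k i)
  have h2 := (Packs.of_pack (N := N) (scaleNat p (eisNat c k)) fun i _ ↦ scaleNat_cast hc k p i)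
  refine ⟨_, _, hF.add_smul_natScale hε, ?_, h1.combination h2 (c' := 1) (by simp) hd
    (by norm_num) hd'⟩
  convert h using 1
  · ext z
    simp
  · simp

theorem insertRow {rows : List ℕ} (h : ∀ r ∈ rows, Good p N j ε modulus r)
    (hx : Good p N j ε M x) (hM : M + rows.length * modulus ^ 2 < base) (i : ℕ) :
    (insertRow N rows i x).length = rows.length ∧
      ∀ r ∈ insertRow N rows i x, Good p N j ε modulus r := by
  induction rows generalizing i x M with
  | nil => simp [QPack.insertRow]
  | cons r rs ih =>
    simp only [List.mem_cons, forall_eq_or_imp] at h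
    simp only [List.length_cons, _root_.add_mul, one_mul] at hM
    rw [QPack.insertRow]
    cases Nat.beq (x / base ^ i % base % modulus) 0
    · cases Nat.beq r 0
      · simp only [cond_false]
        have hm : modulus - x / base ^ i % base % modulus ≤ modulus := Nat.sub_le _ _
        have := ih h.2 (x := x + (modulus - x / base ^ i % base % modulus) * r)
          (M := M + modulus ^ 2) (hx.add_mul _ h.1 |>.mono (by rw [pow_two]; gcongr))
          (by omega) (i + 1)
        simpa [h.1, this.1] using this.2
      · simp only [cond_false, cond_true, List.length_cons, List.mem_cons, forall_eq_or_imp,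
          true_and]
        refine ⟨((hx.norm (by omega)).const_mul _).norm ?_, h.2⟩
        calc _ ≤ modulus * modulus := by
              gcongr; exact (Nat.mod_lt _ (by norm_num)).le
          _ < base := by norm_num
    · have := ih h.2 hx (hM.trans_le' (Nat.add_le_add_left (Nat.le_add_right _ _) _)) (i + 1)
      simpa [h.1, this.1] using this.2

theorem eliminate (hN : N ≤ 1000) {W : ℕ} {te t4 t4' t6 t6' : List ℕ}
    (he : ∀ i, Good p N (i * 1) ((-1) ^ i) modulus (te.getD i 0))
    (h4 : ∀ i, Good p N (i * 2) (1 ^ i) modulus (t4.getD i 0))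
    (h4' : ∀ i, Good p N (i * 2) ((-1) ^ i) modulus (t4'.getD i 0))
    (h6 : ∀ i, Good p N (i * 3) (1 ^ i) modulus (t6.getD i 0))
    (h6' : ∀ i, Good p N (i * 3) ((-1) ^ i) modulus (t6'.getD i 0))
    (l : List (ℕ × ℕ × ℕ × ℕ × ℕ)) {rows : List ℕ} (hrows : rows.length = N)
    (h : ∀ r ∈ rows, Good p N W 1 modulus r) :
    (eliminate N W te t4 t4' t6 t6' l rows).length = N ∧
      ∀ r ∈ eliminate N W te t4 t4' t6 t6' l rows, Good p N W 1 modulus r := by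
  induction l generalizing rows with
  | nil => exact ⟨hrows, h⟩
  | cons m l ih =>
    obtain ⟨a, b, c, d, f⟩ := m
    rw [QPack.eliminate]
    cases hb : Nat.beq (a + 2 * b + 2 * c + 3 * d + 3 * f) W && Nat.beq ((a + c + f) % 2) 0
    · exact ih hrows h
    · rw [Bool.and_eq_true] at hb
      have hW := Nat.eq_of_beq_eq_true hb.1
      have hε := Nat.eq_of_beq_eq_true hb.2
      have hx := (((he a).mul hN (h4 b)).mul hN ((h4' c).mul hN (h6 d))).mul hN (h6' f)
      rw [show a * 1 + b * 2 + (c * 2 + d * 3) + f * 3 = W by omega,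
        show (-1 : ℤ) ^ a * 1 ^ b * ((-1) ^ c * 1 ^ d) * (-1) ^ f = 1 by
          rw [one_pow, one_pow, mul_one, mul_one, ← pow_add, ← pow_add]
          exact Even.neg_one_pow (Nat.even_iff.2 hε)] at hx
      have := insertRow h hx (by
        rw [hrows]
        calc modulus + N * modulus ^ 2 ≤ modulus + 1000 * modulus ^ 2 := by gcongr
          _ < base := by norm_num) 0
      exact ih (this.1.trans hrows) this.2

end Good

theorem of_checkRow {x j n : ℕ} (h : checkRow x j n = true) : ∀ i < n,
    x / base ^ i % base % modulus = if i = j then 1 else 0 := by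
  induction n with
  | zero => simp
  | succ n ih =>
    rw [checkRow, Bool.and_eq_true] at h
    intro i hi
    rcases Nat.lt_succ_iff_lt_or_eq.1 hi with hi | rfl
    · exact ih h.2 i hi
    · rw [Nat.eq_of_beq_eq_true h.1]
      by_cases hij : i = j
      · simp [hij]
      · have h0 : Nat.beq i j = false :=
          Bool.eq_false_iff.2 fun h' ↦ hij (Nat.eq_of_beq_eq_true h')
        simp [hij, h0]

theorem of_checkRows {L : List ℕ} {j : ℕ} (h : checkRows L j = true) (k : ℕ) (hk : k < L.length) :
    ∀ i ≤ j + k, L[k] / base ^ i % base % modulus = if i = j + k then 1 else 0 := by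
  induction L generalizing j k with
  | nil => simp at hk
  | cons r rs ih =>
    rw [checkRows, Bool.and_eq_true] at h
    rcases k with _ | k
    · intro i hi
      exact of_checkRow h.1 i (by simpa [Nat.lt_succ_iff] using hi)
    · have := ih h.2 k (by simpa using hk)
      simpa [add_assoc, add_comm 1] using this

theorem exists_combination {N : ℕ} {ℓ : ℕ} [Nontrivial (ZMod ℓ)]
    {A : Matrix (Fin (N + 1)) (Fin (N + 1)) ℤ}
    (h : ∀ r i, i ≤ r → ((A r i : ℤ) : ZMod ℓ) = if i = r then 1 else 0) :
    ∃ v : Fin (N + 1) → ℤ, (∀ i, i ≠ Fin.last N → ∑ r, v r * A r i = 0) ∧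
      ∑ r, v r * A r (Fin.last N) ≠ 0 := by
  have hdet : ((A.det : ℤ) : ZMod ℓ) = 1 := by
    have h1 : ((A.det : ℤ) : ZMod ℓ) = (A.map (Int.castRingHom (ZMod ℓ))).det :=
      RingHom.map_det (Int.castRingHom (ZMod ℓ)) A
    rw [h1, Matrix.det_of_isUpperTriangular]
    · exact Finset.prod_eq_one fun i _ ↦ by simpa using h i i le_rfl
    · intro r i hri
      have hri : i < r := hri
      simpa [hri.ne] using h r i hri.le
  have hdet0 : A.det ≠ 0 := fun h0 ↦ by simp [h0] at hdet
  have key (i) : ∑ r, A.adjugate (Fin.last N) r * A r i =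
      A.det * (1 : Matrix (Fin (N + 1)) (Fin (N + 1)) ℤ) (Fin.last N) i := by
    rw [← Matrix.mul_apply, Matrix.adjugate_mul, Matrix.smul_apply, smul_eq_mul]
  refine ⟨A.adjugate (Fin.last N), fun i hi ↦ ?_, ?_⟩
  · rw [key, Matrix.one_apply_ne hi.symm, mul_zero]
  · rwa [key, Matrix.one_apply_eq, mul_one]

theorem isGenusZeroStar_of_certificate {p m K : ℕ} (hp : p.Prime) (hm : 1 ≤ m)
    (hN : m * (p + 1) ≤ 1000) (h : certificate p m K = true) : IsGenusZeroStar p := by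
  have : NeZero p := ⟨hp.ne_zero⟩
  have : Nontrivial (ZMod modulus) := ZMod.nontrivial_iff.2 (by norm_num)
  obtain ⟨N, hN1⟩ : ∃ N, N + 1 = m * (p + 1) :=
    ⟨m * (p + 1) - 1, Nat.sub_add_cancel (Nat.mul_pos hm (by omega))⟩
  rw [certificate] at h
  simp only [← hN1] at h hN
  have hmod (n : ℕ) : n % modulus ≤ modulus := (Nat.mod_lt _ (by norm_num)).le
  have hm1 (n : ℕ) : ((1008 * n % modulus : ℕ) : ZMod modulus) = ((-1 * n : ℤ) : ZMod modulus) := by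
    rw [ZMod.natCast_mod]
    push_cast
    rw [show (1008 : ZMod modulus) = -1 by decide]
  have hgood := fun K ↦ Good.eliminate (p := p) hN (W := 12 * m)
    (Good.of_E2.powTable hN (by omega) (12 * m))
    (Good.powTable (ε := 1) hN (by omega) (Good.of_levelOne (isLevelOneForm_E
      (k := 4) (by norm_num) rfl)
      hasQExp_E4 (c := 240) (by simp) (by simp) (d := p ^ 2 % modulus) (by simp) (hmod _)) (6 * m))
    (Good.powTable (ε := -1) hN (by omega) (Good.of_levelOne (isLevelOneForm_E
      (k := 4) (by norm_num) rfl)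
      hasQExp_E4 (c := 240) (by simp) (by simp) (d := 1008 * p ^ 2 % modulus)
      (by rw [hm1]; push_cast; rfl) (hmod _)) (6 * m))
    (Good.powTable (ε := 1) hN (by omega) (Good.of_levelOne (isLevelOneForm_E
      (k := 6) (by norm_num) rfl)
      hasQExp_E6 (c := 505) (by decide) (by simp) (d := p ^ 3 % modulus) (by simp) (hmod _))
      (4 * m))
    (Good.powTable (ε := -1) hN (by omega) (Good.of_levelOne (isLevelOneForm_E
      (k := 6) (by norm_num) rfl)
      hasQExp_E6 (c := 505) (by decide) (by simp) (d := 1008 * p ^ 3 % modulus)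
      (by rw [hm1]; push_cast; rfl) (hmod _)) (4 * m))
    ((exponents (12 * m)).take K) (List.length_replicate (n := N + 1) (a := 0))
    (fun r hr ↦ by rw [List.eq_of_mem_replicate hr]; exact Good.zero)
  obtain ⟨hlen, hrows⟩ := hgood K
  have hch := of_checkRows h
  generalize eliminate _ _ _ _ _ _ _ _ _ = L at hlen hrows hch
  have hex (r : Fin (N + 1)) : ∃ F a, IsStarForm p (12 * m) 1 F ∧ HasQExp F a ∧
      ∀ i ≤ (r : ℕ), ((a.coeff i : ℤ) : ZMod modulus) = if i = r then 1 else 0 := by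
    obtain ⟨F, a, h1, h2, h3⟩ := hrows _ (L.getElem_mem (n := r) (by omega))
    refine ⟨F, a, h1, h2, fun i hi ↦ ?_⟩
    rw [← h3.digit (by norm_num) (by omega), hch r (by omega) i (by omega)]
    simp
  choose F a h1 h2 h3 using hex
  obtain ⟨v, hv, hv'⟩ := exists_combination (ℓ := modulus) (A := .of fun r i ↦ (a r).coeff (i : ℕ))
    fun r i hri ↦ by simpa [Fin.ext_iff] using h3 r i hri
  refine isGenusZeroStar_of_isStarForm hp (m := m) (N := N) (F := ∑ r, ((v r : ℤ) : ℂ) • F r)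
    (a := ∑ r, v r • a r) (.sum _ fun r _ ↦ (h1 r).const_smul _)
    (.sum _ fun r _ ↦ (h2 r).const_smul _) hN1 (fun n hn ↦ ?_) ?_
  · simpa [-zsmul_eq_mul] using hv ⟨n, by omega⟩ (by simpa [Fin.ext_iff] using hn.ne)
  · simpa [-zsmul_eq_mul] using hv'

end QPack

end

theorem isGenusZeroStar_of_mem {p : ℕ}
    (h : p ∈ ({2, 3, 5, 7, 11, 13, 17, 19, 23, 29, 31, 41, 47, 59, 71} : Finset ℕ)) :
    IsGenusZeroStar p := by
  simp only [Finset.mem_insert, Finset.mem_singleton] at h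
  rcases h with rfl | rfl | rfl | rfl | rfl | rfl | rfl | rfl | rfl | rfl | rfl | rfl | rfl | rfl |
    rfl
  · exact QPack.isGenusZeroStar_of_certificate (m := 1) (K := 23) (by norm_num) (by norm_num)
      (by norm_num) (by decide +kernel)
  · exact QPack.isGenusZeroStar_of_certificate (m := 1) (K := 28) (by norm_num) (by norm_num)
      (by norm_num) (by decide +kernel)
  · exact QPack.isGenusZeroStar_of_certificate (m := 1) (K := 6) (by norm_num) (by norm_num)
      (by norm_num) (by decide +kernel)
  · exact QPack.isGenusZeroStar_of_certificate (m := 1) (K := 47) (by norm_num) (by norm_num)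
      (by norm_num) (by decide +kernel)
  · exact QPack.isGenusZeroStar_of_certificate (m := 1) (K := 18) (by norm_num) (by norm_num)
      (by norm_num) (by decide +kernel)
  · exact QPack.isGenusZeroStar_of_certificate (m := 1) (K := 47) (by norm_num) (by norm_num)
      (by norm_num) (by decide +kernel)
  · exact QPack.isGenusZeroStar_of_certificate (m := 1) (K := 36) (by norm_num) (by norm_num)
      (by norm_num) (by decide +kernel)
  · exact QPack.isGenusZeroStar_of_certificate (m := 1) (K := 47) (by norm_num) (by norm_num)
      (by norm_num) (by decide +kernel)
  · exact QPack.isGenusZeroStar_of_certificate (m := 1) (K := 45) (by norm_num) (by norm_num)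
      (by norm_num) (by decide +kernel)
  · exact QPack.isGenusZeroStar_of_certificate (m := 1) (K := 57) (by norm_num) (by norm_num)
      (by norm_num) (by decide +kernel)
  · exact QPack.isGenusZeroStar_of_certificate (m := 1) (K := 59) (by norm_num) (by norm_num)
      (by norm_num) (by decide +kernel)
  · exact QPack.isGenusZeroStar_of_certificate (m := 1) (K := 79) (by norm_num) (by norm_num)
      (by norm_num) (by decide +kernel)
  · exact QPack.isGenusZeroStar_of_certificate (m := 1) (K := 89) (by norm_num) (by norm_num)
      (by norm_num) (by decide +kernel)
  · exact QPack.isGenusZeroStar_of_certificate (m := 2) (K := 237) (by norm_num) (by norm_num)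
      (by norm_num) (by decide +kernel)
  · exact QPack.isGenusZeroStar_of_certificate (m := 2) (K := 284) (by norm_num) (by norm_num)
      (by norm_num) (by decide +kernel)

section

open UpperHalfPlane Matrix Filter Topology Function
open scoped MatrixGroups Manifold
local notation "𝕢" => Function.Periodic.qParam

/-- Near a point where `f` takes its value `k` times, `f` is invariant under a local rotation. -/
theorem AnalyticAt.exists_twist_invariant {f : ℂ → ℂ} {z₀ : ℂ} (hf : AnalyticAt ℂ f z₀)
    (hnc : ¬ ∀ᶠ z in 𝓝 z₀, f z = f z₀) {k : ℕ}
    (hk : analyticOrderAt (fun z ↦ f z - f z₀) z₀ = k) {ζ : ℂ} (hζ : ζ ^ k = 1) :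
    ∃ w : ℂ → ℂ, AnalyticAt ℂ w z₀ ∧ w z₀ = z₀ ∧ HasDerivAt w ζ z₀ ∧
      ∀ᶠ z in 𝓝 z₀, f (w z) = f z := by
  obtain ⟨k', -, hk', s, hs, hs0, hs', hfs⟩ := hf.exists_eventually_eq_add_pow hnc
  obtain rfl : k' = k := by exact_mod_cast hk'.symm.trans hk
  obtain ⟨w, hw, hw0, hw', hws⟩ := hs.exists_twist hs0 hs' ζ
  refine ⟨w, hw, hw0, hw', ?_⟩
  have hwt : Tendsto w (𝓝 z₀) (𝓝 z₀) := by simpa [hw0] using hw.continuousAt.tendsto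
  filter_upwards [hfs, hwt.eventually hfs, (tendsto_id.prodMk_nhds hwt).eventually hws]
    with z h1 h2 h3
  rw [h2, h1, h3.2 rfl, mul_pow, hζ, one_mul, id]

theorem AnalyticAt.deriv_ne_zero_of_injOn {f : ℂ → ℂ} {z₀ : ℂ} (hf : AnalyticAt ℂ f z₀)
    {U : Set ℂ} (hU : U ∈ 𝓝 z₀) (hinj : Set.InjOn f U) : deriv f z₀ ≠ 0 := by
  have hnc : ¬ ∀ᶠ z in 𝓝 z₀, f z = f z₀ := by
    intro h
    obtain ⟨z, ⟨h1, h2⟩, h3⟩ := (((h.and hU).filter_mono nhdsWithin_le_nhds).and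
      (self_mem_nhdsWithin : ∀ᶠ z in 𝓝[≠] z₀, z ∈ ({z₀}ᶜ : Set ℂ))).exists
    exact h3 (hinj h2 (mem_of_mem_nhds hU) h1)
  obtain ⟨k, hk0, hk, s, hs, hs0, hs', hfs⟩ := hf.exists_eventually_eq_add_pow hnc
  obtain rfl | hk1 := eq_or_ne k 1
  · have : f =ᶠ[𝓝 z₀] fun z ↦ f z₀ + s z := by
      filter_upwards [hfs] with z hz using by simpa using hz
    rw [this.deriv_eq]
    simpa using hs'
  · exfalso
    have hζ := Complex.isPrimitiveRoot_exp k hk0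
    obtain ⟨w, hw, hw0, hw', hfw⟩ := hf.exists_twist_invariant hnc hk hζ.pow_eq_one
    have hwt : Tendsto w (𝓝 z₀) (𝓝 z₀) := by simpa [hw0] using hw.continuousAt.tendsto
    have hid : w =ᶠ[𝓝 z₀] id := by
      filter_upwards [hfw, hU, hwt hU] with z h1 h2 h3 using hinj h3 h2 h1
    exact hζ.ne_one (by omega) ((hw'.congr_of_eventuallyEq hid.symm).unique (hasDerivAt_id z₀))

/-- A function identifying the orbits of `Γ₀(p)*` with `ℂ`. -/
structure IsHauptmodul (p : ℕ) (F : ℍ → ℂ) : Prop where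
  mdiff : MDiff F
  eq_iff : ∀ z w : ℍ, F z = F w ↔ ∃ γ ∈ Gamma0Star p, γ • z = w
  surjective : Surjective F

theorem IsGenusZeroStar.exists_isHauptmodul {p : ℕ} (h : IsGenusZeroStar p) :
    ∃ F, IsHauptmodul p F := by
  obtain ⟨f, h1, h2, h3⟩ := h
  refine ⟨fun z ↦ f z, ?_, fun z w ↦ ?_, fun v ↦ ?_⟩
  · rw [UpperHalfPlane.mdifferentiable_iff]
    refine h1.congr fun z hz ↦ ?_
    simp [ofComplex_apply_of_im_pos hz]
  · rw [h2 z z.im_pos w w.im_pos]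
    simp only [moebius_eq, UpperHalfPlane.ext_iff]
  · obtain ⟨z, hz, rfl⟩ := h3 (Set.mem_univ v)
    exact ⟨⟨z, hz⟩, rfl⟩

namespace IsHauptmodul

variable {p : ℕ} {F : ℍ → ℂ}

theorem isStarInvariant (hF : IsHauptmodul p F) : IsStarInvariant p F := fun γ hγ _ ↦
  ((hF.eq_iff _ _).2 ⟨γ, hγ, rfl⟩).symm

theorem exists_ne (hF : IsHauptmodul p F) : ∃ a b, F a ≠ F b := by
  obtain ⟨a, ha⟩ := hF.surjective 0
  obtain ⟨b, hb⟩ := hF.surjective 1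
  exact ⟨a, b, by simp [ha, hb]⟩

/-- A Hauptmodul has a simple pole at the cusp. -/
theorem exists_inv (hp : p.Prime) (hF : IsHauptmodul p F) : ∃ (h : ℂ → ℂ) (c : ℂ),
    AnalyticAt ℂ h 0 ∧ h 0 = 0 ∧ deriv h 0 ≠ 0 ∧
      ∀ᶠ z : ℍ in atImInfty, h (𝕢 1 z) ≠ 0 ∧ F z = c + (h (𝕢 1 z))⁻¹ := by
  set z₀ : ℍ := ⟨2 * Complex.I, by simp⟩ with hz₀
  have hz₀im : z₀.im = 2 := by simp [hz₀, UpperHalfPlane.im]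
  set c := F z₀ with hc
  -- `F` omits a neighborhood of `c` near the cusp
  obtain ⟨r, hr, hfar⟩ : ∃ r > 0, ∀ z : ℍ, 3 < z.im → r ≤ ‖F z - c‖ := by
    have hio : ∀ᶠ y : ℝ in 𝓝 z₀.im, 1 < y ∧ y < 3 := by
      rw [hz₀im]
      exact Ioo_mem_nhds (by norm_num) (by norm_num)
    have hev : ∀ᶠ z : ℍ in 𝓝 z₀, 1 < z.im ∧ z.im < 3 :=
      (UpperHalfPlane.continuous_im.tendsto z₀).eventually hio
    have h1 : ∀ᶠ v in 𝓝 c, ∃ z : ℍ, (1 < z.im ∧ z.im < 3) ∧ F z = v :=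
      nhds_le_map_nhds_of_mdifferentiable hF.mdiff hF.exists_ne z₀ (by
        rw [mem_map]
        filter_upwards [hev] with z hz
        exact ⟨z, hz, rfl⟩)
    obtain ⟨r, hr, h2⟩ := Metric.eventually_nhds_iff.1 h1
    refine ⟨r, hr, fun z hz ↦ ?_⟩
    by_contra! hlt
    obtain ⟨w, hw, hwz⟩ := h2 (y := F z) (by rwa [dist_eq_norm])
    obtain ⟨γ, hγ, hγw⟩ := (hF.eq_iff _ _).1 hwz
    obtain ⟨n, hn⟩ := Gamma0Star.eq_vadd_of_one_lt_im hp hγ hw.1 (by rw [hγw]; linarith)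
    have h3 : z.im = w.im := by rw [← hγw, hn, vadd_im]
    linarith
  set H : ℂ → ℂ := fun z ↦ (F (ofComplex z) - c)⁻¹ with hH
  have hper : Periodic H ((1 : ℝ) : ℂ) := fun z ↦ by
    have := hF.isStarInvariant.periodic z
    simp only [Function.comp_apply] at this
    simp only [hH, this]
  have hne : ∀ z : ℍ, 3 < z.im → F z - c ≠ 0 := fun z hz ↦
    norm_pos_iff.1 (hr.trans_le (hfar z hz))
  have h3 : ∀ᶠ z in comap Complex.im atTop, 3 < z.im := preimage_mem_comap (Ioi_mem_atTop 3)
  have hhol : ∀ᶠ z in comap Complex.im atTop, DifferentiableAt ℂ H z := by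
    filter_upwards [h3] with z hz
    have hz0 : 0 < z.im := by linarith
    refine DifferentiableAt.inv (.sub_const ?_ c) ?_
    · exact UpperHalfPlane.mdifferentiableAt_iff.mp (hF.mdiff ⟨z, hz0⟩)
    · rw [ofComplex_apply_of_im_pos hz0]
      exact hne ⟨z, hz0⟩ hz
  have hbd : BoundedAtFilter (comap Complex.im atTop) H := by
    refine Asymptotics.IsBigO.of_bound r⁻¹ ?_
    filter_upwards [h3] with z hz
    have hz0 : 0 < z.im := by linarith
    simp only [hH, norm_inv, Pi.one_apply, norm_one, mul_one]
    rw [ofComplex_apply_of_im_pos hz0]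
    exact inv_anti₀ hr (hfar ⟨z, hz0⟩ hz)
  set h := Function.Periodic.cuspFunction 1 H with hh
  have hhz (z : ℍ) : h (𝕢 1 z) = (F z - c)⁻¹ := by
    rw [hh, Function.Periodic.eq_cuspFunction one_ne_zero hper, hH]
    simp
  have han : AnalyticAt ℂ h 0 := by
    rw [Complex.analyticAt_iff_eventually_differentiableAt]
    have h1 :=
      Function.Periodic.eventually_differentiableAt_cuspFunction_nhds_ne_zero one_pos hper hhol
    rw [eventually_nhdsWithin_iff] at h1
    filter_upwards [h1] with q hq
    by_cases h0 : q = 0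
    · rw [h0]
      exact Function.Periodic.differentiableAt_cuspFunction_zero one_pos hper hhol hbd
    · exact hq h0
  have hFh : ∀ z : ℍ, 3 < z.im → h (𝕢 1 z) ≠ 0 ∧ F z = c + (h (𝕢 1 z))⁻¹ := fun z hz ↦ by
    rw [hhz, inv_inv]
    exact ⟨inv_ne_zero (hne z hz), by ring⟩
  have hcusp : Tendsto (fun z : ℍ ↦ h (𝕢 1 z)) atImInfty (𝓝 (h 0)) :=
    han.continuousAt.tendsto.comp tendsto_qParam
  have h0 : h 0 = 0 := by
    by_contra h0
    have h1 : Tendsto F atImInfty (𝓝 (c + (h 0)⁻¹)) :=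
      (tendsto_const_nhds.add (hcusp.inv₀ h0)).congr'
        (eventually_atImInfty_iff.2 ⟨3, fun z hz ↦ (hFh z hz).2.symm⟩)
    obtain ⟨v, hv⟩ := hF.isStarInvariant.eq_const hp hF.mdiff (h1.isBigO_one ℝ)
    obtain ⟨a, b, hab⟩ := hF.exists_ne
    exact hab (by rw [hv, hv])
  refine ⟨h, c, han, h0, ?_, eventually_atImInfty_iff.2 ⟨3, hFh⟩⟩
  set ρ : ℝ := Real.exp (-2 * Real.pi * 3) with hρ
  have hρ1 : ρ < 1 := by
    rw [hρ, Real.exp_lt_one_iff]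
    have := Real.pi_pos
    linarith
  have hlift : ∀ q : ℂ, ‖q‖ < ρ → q ≠ 0 → ∃ z : ℍ, 3 < z.im ∧ 𝕢 1 z = q := by
    intro q hq hq0
    obtain ⟨z, rfl⟩ := exists_qParam_eq hq0 (hq.trans hρ1)
    refine ⟨z, ?_, rfl⟩
    rw [Function.Periodic.norm_qParam, hρ, Real.exp_lt_exp] at hq
    have hq : -2 * Real.pi * z.im < -2 * Real.pi * 3 := by simpa using hq
    nlinarith [Real.pi_pos]
  refine han.deriv_ne_zero_of_injOn (Metric.ball_mem_nhds 0 (Real.exp_pos _ : 0 < ρ)) ?_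
  intro x hx y hy hxy
  rw [mem_ball_zero_iff] at hx hy
  by_cases hx0 : x = 0 <;> by_cases hy0 : y = 0
  · rw [hx0, hy0]
  · obtain ⟨z, hz, rfl⟩ := hlift y hy hy0
    exact absurd (by rw [← hxy, hx0, h0]) (hFh z hz).1
  · obtain ⟨z, hz, rfl⟩ := hlift x hx hx0
    exact absurd (by rw [hxy, hy0, h0]) (hFh z hz).1
  · obtain ⟨z, hz, rfl⟩ := hlift x hx hx0
    obtain ⟨w, hw, rfl⟩ := hlift y hy hy0
    have h1 : F z = F w := by rw [(hFh z hz).2, (hFh w hw).2, hxy]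
    obtain ⟨γ, hγ, hγw⟩ := (hF.eq_iff _ _).1 h1
    obtain ⟨n, hn⟩ := Gamma0Star.eq_vadd_of_one_lt_im hp hγ
      (by linarith : 1 < z.im) (by rw [hγw]; linarith)
    rw [← hγw, hn, coe_vadd, Function.Periodic.qParam, Function.Periodic.qParam]
    rw [Complex.exp_eq_exp_iff_exists_int]
    exact ⟨-n, by push_cast; ring⟩

end IsHauptmodul

end

section

open UpperHalfPlane Matrix Filter Topology Function
open scoped MatrixGroups Manifold
local notation "𝕢" => Function.Periodic.qParam

theorem hasDerivAt_qParam_one (z : ℂ) :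
    HasDerivAt (𝕢 1) (2 * Real.pi * Complex.I * 𝕢 1 z) z := by
  have h : HasDerivAt (fun w : ℂ ↦ 2 * Real.pi * Complex.I * w / ((1 : ℝ) : ℂ))
      (2 * Real.pi * Complex.I) z := by
    simpa using ((hasDerivAt_id z).const_mul (2 * Real.pi * Complex.I)).div_const ((1 : ℝ) : ℂ)
  exact h.cexp.congr_deriv (by rw [Function.Periodic.qParam]; ring)

theorem MDiff.hasDerivAt_comp_ofComplex {f : ℍ → ℂ} (hf : MDiff f) (z : ℍ) :
    HasDerivAt (f ∘ ofComplex) (deriv (f ∘ ofComplex) z) z :=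
  (UpperHalfPlane.mdifferentiableAt_iff.mp (hf z)).hasDerivAt

namespace IsHauptmodul

variable {p : ℕ} {F : ℍ → ℂ}

/-- The leading coefficients of a Hauptmodul and of its derivative. -/
theorem exists_tendsto (hp : p.Prime) (hF : IsHauptmodul p F) : ∃ u v : ℂ, u ≠ 0 ∧ v ≠ 0 ∧
    Tendsto (fun z : ℍ ↦ 𝕢 1 z * F z) atImInfty (𝓝 u) ∧
    Tendsto (fun z : ℍ ↦ 𝕢 1 z * deriv (F ∘ ofComplex) z) atImInfty (𝓝 v) := by
  obtain ⟨h, c, han, h0, h', hev⟩ := hF.exists_inv hp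
  have hq0 : Tendsto (fun z : ℍ ↦ 𝕢 1 (z : ℂ)) atImInfty (𝓝[≠] 0) :=
    tendsto_nhdsWithin_iff.2 ⟨tendsto_qParam, .of_forall fun z ↦ Complex.exp_ne_zero _⟩
  have hslope : Tendsto (fun z : ℍ ↦ (𝕢 1 (z : ℂ))⁻¹ * h (𝕢 1 z)) atImInfty (𝓝 (deriv h 0)) := by
    have := (hasDerivAt_iff_tendsto_slope.1 han.differentiableAt.hasDerivAt).comp hq0
    refine this.congr fun z ↦ ?_
    simp [slope, h0]
  have hder : Tendsto (fun z : ℍ ↦ deriv h (𝕢 1 z)) atImInfty (𝓝 (deriv h 0)) :=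
    han.deriv.continuousAt.tendsto.comp tendsto_qParam
  refine ⟨(deriv h 0)⁻¹, -(2 * Real.pi * Complex.I) * deriv h 0 / deriv h 0 ^ 2, inv_ne_zero h',
    ?_, ?_, ?_⟩
  · simp [h', Real.pi_ne_zero]
  · have h1 := (tendsto_qParam.mul_const c).add (hslope.inv₀ h')
    rw [zero_mul, zero_add] at h1
    refine h1.congr' ?_
    filter_upwards [hev] with z hz
    rw [hz.2, mul_inv, inv_inv, mul_add]
  · refine ((hder.const_mul (-(2 * Real.pi * Complex.I))).div (hslope.pow 2)
      (pow_ne_zero 2 h')).congr' ?_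
    have han' : ∀ᶠ z : ℍ in atImInfty, AnalyticAt ℂ h (𝕢 1 z) :=
      tendsto_qParam.eventually han.eventually_analyticAt
    obtain ⟨Y, hY⟩ := eventually_atImInfty_iff.1 hev
    filter_upwards [hev, han', eventually_atImInfty_iff.2 ⟨Y, fun z hz ↦ hz⟩] with z hz hzan hzY
    have hloc : F ∘ ofComplex =ᶠ[𝓝 (z : ℂ)] fun w ↦ c + (h (𝕢 1 w))⁻¹ := by
      have ho : IsOpen {w : ℂ | Y < w.im ∧ 0 < w.im} :=
        (isOpen_lt continuous_const Complex.continuous_im).inter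
          (isOpen_lt continuous_const Complex.continuous_im)
      filter_upwards [ho.mem_nhds (show (z : ℂ) ∈ _ from ⟨hzY, z.im_pos⟩)] with w hw
      rw [Function.comp_apply, ofComplex_apply_of_im_pos hw.2]
      exact (hY ⟨w, hw.2⟩ hw.1).2
    have hd : HasDerivAt (fun w ↦ c + (h (𝕢 1 w))⁻¹)
        (-(deriv h (𝕢 1 z) * (2 * Real.pi * Complex.I * 𝕢 1 z)) / h (𝕢 1 z) ^ 2) z :=
      ((hzan.differentiableAt.hasDerivAt.comp (z : ℂ) (hasDerivAt_qParam_one z)).inv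
        hz.1).const_add c
    rw [hloc.deriv_eq, hd.deriv]
    have hq : 𝕢 1 (z : ℂ) ≠ 0 := Complex.exp_ne_zero _
    have := hz.1
    simp only [Pi.div_apply]
    field_simp

theorem deriv_smul (hF : IsHauptmodul p F) {γ : SL(2, ℝ)} (hγ : γ ∈ Gamma0Star p) (z : ℍ) :
    deriv (F ∘ ofComplex) (γ • z : ℍ) =
      ((γ 1 0 : ℂ) * z + γ 1 1) ^ 2 * deriv (F ∘ ofComplex) z := by
  have hdet : 0 < (γ : GL (Fin 2) ℝ).val.det := by simp
  have h1 := (hasStrictDerivAt_smul hdet z).hasDerivAt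
  have h2 := MDiff.hasDerivAt_comp_ofComplex hF.mdiff ((γ : GL (Fin 2) ℝ) • z)
  have h3 : (F ∘ ofComplex) ∘ (fun w : ℂ ↦ (((γ : GL (Fin 2) ℝ) • ofComplex w : ℍ) : ℂ)) =
      F ∘ ofComplex := by
    ext w
    simp only [Function.comp_apply, ofComplex_apply]
    exact hF.isStarInvariant γ hγ _
  have h4 : ((γ : GL (Fin 2) ℝ) • z : ℍ) = γ • z := rfl
  have hz : ofComplex (z : ℂ) = z := ofComplex_apply z
  have h5 := HasDerivAt.comp (z : ℂ) (h₂ := F ∘ ofComplex) (by rw [hz]; exact h2) h1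
  rw [h3] at h5
  have h6 := h5.deriv
  have h7 : denom (γ : GL (Fin 2) ℝ) z = (γ 1 0 : ℂ) * z + γ 1 1 := rfl
  have h8 : denom (γ : GL (Fin 2) ℝ) z ≠ 0 := denom_ne_zero _ _
  rw [h7] at h6 h8
  rw [h4] at h6
  have h9 : ((γ : GL (Fin 2) ℝ).val.det : ℂ) = 1 := by simp
  rw [h6, h9]
  field_simp

theorem isStarForm_deriv [NeZero p] (hF : IsHauptmodul p F) :
    IsStarForm p 1 1 (fun z ↦ deriv (F ∘ ofComplex) z) where
  mdiff := by
    rw [UpperHalfPlane.mdifferentiable_iff]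
    have h := (UpperHalfPlane.mdifferentiable_iff.1 hF.mdiff).deriv
      (isOpen_lt continuous_const Complex.continuous_im)
    refine h.congr fun w hw ↦ ?_
    simp [ofComplex_apply_of_im_pos hw]
  smul g hg z := by
    have := hF.deriv_smul (Gamma0Star.of_int g hg) z
    rw [map_smul_eq] at this
    rw [this]
    simp
  fricke_smul z := by
    rw [hF.deriv_smul (fricke_mem p) z]
    have h1 : ((√(p : ℝ) : ℝ) : ℂ) ^ 2 = p := by
      rw [← Complex.ofReal_pow, Real.sq_sqrt (Nat.cast_nonneg p)]; simp
    simp [fricke, mul_pow, h1]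

end IsHauptmodul

end

section

open UpperHalfPlane Matrix Filter Topology Function
open scoped MatrixGroups Manifold
local notation "𝕢" => Function.Periodic.qParam

namespace IsHauptmodul

variable {p : ℕ} {F : ℍ → ℂ}

/-- The twelfth power of the derivative of a Hauptmodul `F` is `P(F)` up to a nonvanishing form. -/
theorem exists_polynomial (hp : p.Prime) (hF : IsHauptmodul p F) :
    ∃ (P : Polynomial ℂ) (G : ℍ → ℂ), MDiff G ∧ (∀ z, G z ≠ 0) ∧ p + 13 ≤ P.natDegree ∧
      ∀ z : ℍ, deriv (F ∘ ofComplex) z ^ 12 = P.eval (F z) * G z := by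
  have : NeZero p := ⟨hp.ne_zero⟩
  obtain ⟨u, v, hu, hv, hFu, hFv⟩ := hF.exists_tendsto hp
  set G : ℍ → ℂ := fun z ↦ ModularForm.discriminant z * ModularForm.discriminant (natScale p z)
    with hGdef
  set D : ℍ → ℂ := fun z ↦ deriv (F ∘ ofComplex) z with hD
  have hG : IsStarForm p 12 1 G := isLevelOneForm_discriminant.mul_natScale (j := 6)
  have hD12 : IsStarForm p 12 1 (D ^ 12) := by simpa using hF.isStarForm_deriv.pow 12
  have hG0 : ∀ z, G z ≠ 0 := fun z ↦
    mul_ne_zero (ModularForm.discriminant_ne_zero _) (ModularForm.discriminant_ne_zero _)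
  have hinv := hD12.isStarInvariant_div hp hG one_ne_zero
  have hmd : MDiff (fun z ↦ (D ^ 12) z / G z) := by
    have h1 := UpperHalfPlane.mdifferentiable_iff.1 hD12.mdiff
    have h2 := UpperHalfPlane.mdifferentiable_iff.1 hG.mdiff
    exact UpperHalfPlane.mdifferentiable_iff.2 (h1.div h2 fun z _ ↦ hG0 _)
  have hd := tendsto_qParam_inv_mul_discriminant
  have hGt : Tendsto (fun z : ℍ ↦ (ModularForm.discriminant z / 𝕢 1 z) *
      (ModularForm.discriminant (natScale p z) / 𝕢 1 (natScale p z))) atImInfty (𝓝 1) := by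
    simpa using hd.mul (hd.comp (tendsto_natScale_atImInfty p))
  have ht : Tendsto (fun z : ℍ ↦ 𝕢 1 z ^ (p + 13) * ((D ^ 12) z / G z)) atImInfty (𝓝 (v ^ 12)) := by
    have := (hFv.pow 12).div hGt one_ne_zero
    rw [div_one] at this
    refine this.congr fun z ↦ ?_
    have hq : 𝕢 1 z ≠ 0 := Periodic.qParam_ne_zero _
    have hD : G z ≠ 0 := hG0 z
    have e : (ModularForm.discriminant z / 𝕢 1 z) *
        (ModularForm.discriminant (natScale p z) / 𝕢 1 (natScale p z)) = G z / 𝕢 1 z ^ (p + 1) := by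
      rw [qParam_natScale, pow_succ', div_mul_div_comm]
    simp only [Pi.div_apply]
    rw [e, Pi.pow_apply, mul_pow, show p + 13 = 12 + (p + 1) by ring, pow_add _ 12]
    field_simp
    rfl
  obtain ⟨P, hP⟩ := hF.isStarInvariant.exists_polynomial hp hF.mdiff hu hFu (p + 13) _ hinv hmd
    (ht.isBigO_one ℝ)
  refine ⟨P, G, hG.mdiff, hG0,
    le_natDegree_of_tendsto hFu (p + 13) (pow_ne_zero 12 hv) ht P hP, fun z ↦ ?_⟩
  rw [← hP z, div_mul_cancel₀ _ (hG0 z), Pi.pow_apply]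

theorem exists_order (hF : IsHauptmodul p F) (z₀ : ℍ) : ∃ k : ℕ, k ≠ 0 ∧
    analyticOrderAt (fun w ↦ (F ∘ ofComplex) w - (F ∘ ofComplex) z₀) z₀ = k := by
  obtain ⟨k, hk0, hk, -⟩ := (analyticAt_comp_ofComplex hF.mdiff z₀).exists_eventually_eq_add_pow
    (by
      have := not_eventually_comp_ofComplex_eq hF.mdiff hF.exists_ne z₀
      simpa using this)
  exact ⟨k, hk0, hk⟩

theorem rootMultiplicity_mul (hF : IsHauptmodul p F) {P : Polynomial ℂ} {G : ℍ → ℂ}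
    (hP0 : P ≠ 0) (hG : MDiff G) (hG0 : ∀ z, G z ≠ 0)
    (h : ∀ z : ℍ, deriv (F ∘ ofComplex) z ^ 12 = P.eval (F z) * G z) (z₀ : ℍ) {k : ℕ}
    (hk : analyticOrderAt (fun w ↦ (F ∘ ofComplex) w - (F ∘ ofComplex) z₀) z₀ = k) :
    P.rootMultiplicity (F z₀) * k + 12 = 12 * k := by
  have hFan := analyticAt_comp_ofComplex hF.mdiff z₀
  have hGan := analyticAt_comp_ofComplex hG z₀
  obtain ⟨Q, hQ⟩ := P.exists_eq_pow_rootMultiplicity_mul_and_not_dvd hP0 (F z₀)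
  set m := P.rootMultiplicity (F z₀)
  have hQ0 : Q.eval (F z₀) ≠ 0 := fun h0 ↦ hQ.2 (Polynomial.dvd_iff_isRoot.2 h0)
  have hQan : AnalyticAt ℂ (fun w ↦ Q.eval ((F ∘ ofComplex) w)) z₀ := by
    simpa [Polynomial.coe_aeval_eq_eval] using hFan.aeval_polynomial Q
  have hev : (deriv (F ∘ ofComplex)) ^ 12 =ᶠ[𝓝 (z₀ : ℂ)]
      (fun w ↦ (F ∘ ofComplex) w - (F ∘ ofComplex) z₀) ^ m *
        ((fun w ↦ Q.eval ((F ∘ ofComplex) w)) * (G ∘ ofComplex)) := by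
    have ho : IsOpen {w : ℂ | 0 < w.im} := isOpen_lt continuous_const Complex.continuous_im
    filter_upwards [ho.mem_nhds z₀.im_pos] with w hw
    have := h ⟨w, hw⟩
    rw [hQ.1] at this
    simp [ofComplex_apply_of_im_pos hw] at this ⊢
    rw [this, mul_assoc]
  have h1 : analyticOrderAt (G ∘ ofComplex) z₀ = 0 := by
    rw [hGan.analyticOrderAt_eq_zero]
    simpa using hG0 z₀
  have h2 : analyticOrderAt (fun w ↦ Q.eval ((F ∘ ofComplex) w)) z₀ = 0 := by
    rw [hQan.analyticOrderAt_eq_zero]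
    simpa using hQ0
  have hsub : AnalyticAt ℂ (fun w ↦ (F ∘ ofComplex) w - (F ∘ ofComplex) z₀) z₀ :=
    hFan.sub analyticAt_const
  have h3 := analyticOrderAt_congr hev
  have h4 := hFan.analyticOrderAt_deriv_add_one
  rw [analyticOrderAt_pow hFan.deriv, analyticOrderAt_mul (hsub.pow m) (hQan.mul hGan),
    analyticOrderAt_pow hsub, analyticOrderAt_mul hQan hGan, h1, h2, hk] at h3
  rw [hk] at h4
  obtain ⟨d, hd⟩ := ENat.ne_top_iff_exists.1 (show analyticOrderAt (deriv (F ∘ ofComplex)) z₀ ≠ ⊤ by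
    rintro h
    rw [h] at h4
    simp at h4)
  rw [← hd] at h3 h4
  have h3 : 12 * d = m * k := by
    simp only [nsmul_eq_mul, add_zero] at h3
    exact_mod_cast h3
  have h4 : d + 1 = k := by exact_mod_cast h4
  omega

end IsHauptmodul

end

section

open UpperHalfPlane Matrix Filter Topology Function
open scoped MatrixGroups Manifold

namespace IsHauptmodul

variable {p : ℕ} {F : ℍ → ℂ}

/-- The ramification of a Hauptmodul at a point is realized by the stabilizer of this point. -/
theorem exists_stabilizer (hp : p.Prime) (hF : IsHauptmodul p F) (z₀ : ℍ) {k : ℕ}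
    (hk : analyticOrderAt (fun w ↦ (F ∘ ofComplex) w - (F ∘ ofComplex) z₀) z₀ = k) {ζ : ℂ}
    (hζ : ζ ^ k = 1) :
    ∃ γ ∈ Gamma0Star p, γ • z₀ = z₀ ∧ ((γ 1 0 : ℂ) * z₀ + γ 1 1) ^ 2 * ζ = 1 := by
  obtain ⟨w, hw, hw0, hw', hfw⟩ := (analyticAt_comp_ofComplex hF.mdiff z₀).exists_twist_invariant
    (by simpa using not_eventually_comp_ofComplex_eq hF.mdiff hF.exists_ne z₀) hk hζ
  obtain ⟨S, hSf, hS, hSev⟩ := Gamma0Star.exists_finite hp z₀ z₀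
  have hoc : Tendsto (fun x : ℂ ↦ ofComplex x) (𝓝 (z₀ : ℂ)) (𝓝 z₀) := tendsto_ofComplex_nhds z₀
  have hwt : Tendsto w (𝓝 (z₀ : ℂ)) (𝓝 (z₀ : ℂ)) := by
    simpa [hw0] using hw.continuousAt.tendsto
  have hpair := hoc.prodMk_nhds (hoc.comp hwt)
  have ho : ∀ᶠ x : ℂ in 𝓝 (z₀ : ℂ), 0 < x.im :=
    (isOpen_lt continuous_const Complex.continuous_im).mem_nhds z₀.im_pos
  have hex : ∀ᶠ x : ℂ in 𝓝 (z₀ : ℂ), ∃ γ ∈ S,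
      (((γ : GL (Fin 2) ℝ) • ofComplex x : ℍ) : ℂ) = w x := by
    filter_upwards [hpair.eventually hSev, hwt.eventually ho, hfw] with x h1 h2 h3
    obtain ⟨γ, hγ, h4⟩ := h1 ((hF.eq_iff _ _).1 (by simpa using h3.symm))
    refine ⟨γ, hγ, ?_⟩
    have h5 : γ • ofComplex x = ofComplex (w x) := h4
    have h6 : ((γ : GL (Fin 2) ℝ) • ofComplex x : ℍ) = γ • ofComplex x := rfl
    rw [h6, h5, ofComplex_apply_of_im_pos h2]
  have ha (γ : SL(2, ℝ)) :
      AnalyticAt ℂ (fun x ↦ ((γ : GL (Fin 2) ℝ) • ofComplex x : ℍ) : ℂ → ℂ) z₀ :=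
    UpperHalfPlane.analyticAt_smul (by simp) z₀
  obtain ⟨γ, hγ, hγw⟩ : ∃ γ ∈ S, ∀ᶠ x : ℂ in 𝓝 (z₀ : ℂ),
      (((γ : GL (Fin 2) ℝ) • ofComplex x : ℍ) : ℂ) = w x := by
    by_contra! hcon
    have h1 : ∀ γ ∈ S, ∀ᶠ x : ℂ in 𝓝[≠] (z₀ : ℂ),
        (((γ : GL (Fin 2) ℝ) • ofComplex x : ℍ) : ℂ) ≠ w x := fun γ hγ ↦
      ((ha γ).eventually_eq_or_eventually_ne hw).resolve_left fun h ↦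
        hcon γ hγ (h.mono fun x hx hne ↦ hne hx)
    rw [← eventually_all_finite hSf] at h1
    obtain ⟨x, h2, γ, hγ, h3⟩ := (h1.and (hex.filter_mono nhdsWithin_le_nhds)).exists
    exact h2 γ hγ h3
  refine ⟨γ, (hS γ hγ).1, (hS γ hγ).2, ?_⟩
  have hdet : 0 < (γ : GL (Fin 2) ℝ).val.det := by simp
  have h1 := (hasStrictDerivAt_smul hdet z₀).hasDerivAt
  have h2 := (hw'.congr_of_eventuallyEq hγw).unique h1
  have h7 : denom (γ : GL (Fin 2) ℝ) z₀ = (γ 1 0 : ℂ) * z₀ + γ 1 1 := rfl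
  have h8 : denom (γ : GL (Fin 2) ℝ) z₀ ≠ 0 := denom_ne_zero _ _
  have h9 : ((γ : GL (Fin 2) ℝ).val.det : ℂ) = 1 := by simp
  rw [h7] at h2 h8
  rw [h2, h9]
  field_simp

end IsHauptmodul

end

section

open UpperHalfPlane Matrix Filter Topology Function
open scoped MatrixGroups Manifold

/-- `z` is a root of the integral binary quadratic form `[A, B, C]`, where `A` is positive. -/
structure IsFormRoot (A B C : ℤ) (z : ℍ) : Prop where
  pos : 0 < A
  eq : (A : ℂ) * (z : ℂ) ^ 2 + B * z + C = 0

theorem exists_isFormRoot_of_ne_zero {A B C : ℤ} {z : ℍ} (hA : A ≠ 0)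
    (h : (A : ℂ) * (z : ℂ) ^ 2 + B * z + C = 0) (p : ℤ) (hp : p ∣ A) :
    ∃ A' B' C' : ℤ, IsFormRoot A' B' C' z ∧ p ∣ A' ∧ B' ^ 2 - 4 * A' * C' = B ^ 2 - 4 * A * C := by
  obtain hA | hA := hA.lt_or_gt
  · refine ⟨-A, -B, -C, ⟨by omega, ?_⟩, (dvd_neg).2 hp, by ring⟩
    push_cast
    linear_combination -h
  · exact ⟨A, B, C, ⟨hA, h⟩, hp, rfl⟩

/-- A nontrivial elliptic element of `SL(2, ℝ)` is determined up to conjugacy by its trace. -/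
theorem elliptic_data {γ : SL(2, ℝ)} {z : ℍ} (h : γ • z = z) {ζ : ℂ}
    (hζ : ((γ 1 0 : ℂ) * z + γ 1 1) ^ 2 * ζ = 1) (hζ1 : ζ ≠ 1) :
    γ 1 0 ≠ 0 ∧ (γ 0 0 + γ 1 1) ^ 2 < 4 ∧
      (γ 1 0 : ℂ) * (z : ℂ) ^ 2 + ((γ 1 1 : ℂ) - γ 0 0) * z - γ 0 1 = 0 ∧
      ((γ 1 0 : ℂ) * z + γ 1 1) ^ 2 - ((γ 0 0 : ℂ) + γ 1 1) * ((γ 1 0 : ℂ) * z + γ 1 1) +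
        1 = 0 := by
  have hdet : γ 0 0 * γ 1 1 - γ 0 1 * γ 1 0 = 1 := by
    rw [← Matrix.det_fin_two]; exact γ.2
  have hdetC : (γ 0 0 : ℂ) * γ 1 1 - γ 0 1 * γ 1 0 = 1 := by exact_mod_cast hdet
  have hden : (γ 1 0 : ℂ) * z + γ 1 1 ≠ 0 := by
    intro h0
    rw [h0] at hζ
    simp at hζ
  have hq : (γ 1 0 : ℂ) * (z : ℂ) ^ 2 + ((γ 1 1 : ℂ) - γ 0 0) * z - γ 0 1 = 0 := by
    have h1 := moebius_eq γ z
    rw [h, moebius] at h1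
    rw [div_eq_iff hden] at h1
    linear_combination -h1
  have hu : ((γ 1 0 : ℂ) * z + γ 1 1) ^ 2 - ((γ 0 0 : ℂ) + γ 1 1) * ((γ 1 0 : ℂ) * z + γ 1 1) + 1
      = 0 := by
    linear_combination (γ 1 0 : ℂ) * hq - hdetC
  have hz : 0 < z.im := z.im_pos
  have hc : γ 1 0 ≠ 0 := by
    intro hc
    have him := congrArg Complex.im hq
    simp [hc] at him
    have hd : γ 1 1 = γ 0 0 := by
      rcases him with him | him
      · linarith
      · exact absurd him hz.ne'
    rw [hc, hd] at hdet
    apply hζ1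
    have h2 : (γ 0 0 : ℂ) * γ 0 0 = 1 := by
      have : γ 0 0 * γ 0 0 = 1 := by linarith
      exact_mod_cast this
    rw [hc, hd] at hζ
    simp only [Complex.ofReal_zero, zero_mul, zero_add, sq, h2, one_mul] at hζ
    exact hζ
  refine ⟨hc, ?_, hq, hu⟩
  have hsq : (2 * (γ 1 0 : ℂ) * z + ((γ 1 1 : ℂ) - γ 0 0)) ^ 2 =
      (((γ 0 0 + γ 1 1) ^ 2 - 4 : ℝ) : ℂ) := by
    push_cast
    linear_combination 4 * (γ 1 0 : ℂ) * hq - 4 * hdetC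
  have him := congrArg Complex.im hsq
  have hre := congrArg Complex.re hsq
  simp [sq] at him hre
  set x := 2 * γ 1 0 * z.re + (γ 1 1 - γ 0 0)
  have hy : 2 * γ 1 0 * z.im ≠ 0 := by simp [hc, hz.ne']
  have hx : x = 0 := by
    have : x * (2 * γ 1 0 * z.im) = 0 := by linarith
    simpa [hy] using this
  have := pow_pos (abs_pos.2 hy) 2
  rw [sq_abs] at this
  rw [hx] at hre
  nlinarith

end

section

open UpperHalfPlane Matrix Filter Topology Function
open scoped MatrixGroups Manifold

theorem Int.sq_lt_four_cases {t : ℤ} (h : t ^ 2 < 4) : t = 0 ∨ t ^ 2 = 1 := by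
  have h1 : -2 < t := by nlinarith
  have h2 : t < 2 := by nlinarith
  interval_cases t <;> simp

theorem IsPrimitiveRoot.eq_two_of_inv {ζ u : ℂ} {k : ℕ} (hζ : IsPrimitiveRoot ζ k) (hk : 2 ≤ k)
    (h : u ^ 2 * ζ = 1) (hu : u ^ 2 + 1 = 0) : k = 2 := by
  have h1 : ζ = -1 := by linear_combination -h + ζ * hu
  have h2 : k ∣ 2 := hζ.dvd_of_pow_eq_one 2 (by rw [h1]; norm_num)
  exact le_antisymm (Nat.le_of_dvd two_pos h2) hk

theorem IsPrimitiveRoot.eq_three_of_inv {ζ u t : ℂ} {k : ℕ} (hζ : IsPrimitiveRoot ζ k) (hk : 2 ≤ k)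
    (h : u ^ 2 * ζ = 1) (hu : u ^ 2 - t * u + 1 = 0) (ht : t ^ 2 = 1) : k = 3 := by
  have h6 : u ^ 6 = 1 := by
    have h3 : u ^ 3 = -t := by linear_combination (u + t) * hu + u * ht
    linear_combination (u ^ 3 - t) * h3 + ht
  have h1 : ζ ^ 3 = 1 := by
    have : (u ^ 2 * ζ) ^ 3 = 1 := by rw [h, one_pow]
    linear_combination this - ζ ^ 3 * h6
  have h2 : k ∣ 3 := hζ.dvd_of_pow_eq_one 3 h1
  exact ((Nat.dvd_prime Nat.prime_three).1 h2).resolve_left (by omega)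

/-- Elliptic fixed points of `Γ₀(p)*` are roots of quadratic forms of discriminant `-4`, `-3` or
`-4p` with leading coefficient divisible by `p`. -/
theorem Gamma0Star.exists_isFormRoot {p : ℕ} (hp : p.Prime) (hp5 : 5 ≤ p) {γ : SL(2, ℝ)}
    (hγ : γ ∈ Gamma0Star p) {z : ℍ} (h : γ • z = z) {ζ : ℂ} {k : ℕ} (hζk : IsPrimitiveRoot ζ k)
    (hk : 2 ≤ k) (hζ : ((γ 1 0 : ℂ) * z + γ 1 1) ^ 2 * ζ = 1) :
    ∃ A B C : ℤ, IsFormRoot A B C z ∧ (p : ℤ) ∣ A ∧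
      (k = 2 ∧ B ^ 2 - 4 * A * C = -4 ∨ k = 3 ∧ B ^ 2 - 4 * A * C = -3 ∨
        k = 2 ∧ B ^ 2 - 4 * A * C = -4 * p) := by
  obtain ⟨hc0, htr, hq, hu⟩ := elliptic_data h hζ (hζk.ne_one (by omega))
  have hp0 : (0 : ℝ) < p := by exact_mod_cast hp.pos
  have hdet : γ 0 0 * γ 1 1 - γ 0 1 * γ 1 0 = 1 := by
    rw [← Matrix.det_fin_two]; exact γ.2
  rcases Gamma0Star.isHeckeType_or_isFrickeType hp hγ with
    ⟨a, b, c, d, h1, h2, h3, h4⟩ | ⟨a, b, c, d, h1, h2, h3, h4⟩ <;>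
  change γ 0 0 = _ at h1 <;> change γ 0 1 = _ at h2 <;> change γ 1 0 = _ at h3 <;>
  change γ 1 1 = _ at h4 <;>
  rw [h1, h2, h3, h4] at hdet <;> rw [h1, h4] at htr <;> rw [h3] at hc0 <;>
  rw [h1, h3, h4] at hu <;> rw [h1, h2, h3, h4] at hq <;> rw [h3, h4] at hζ
  · have hdet' : a * d - b * (p * c) = 1 := by exact_mod_cast hdet
    have htr' : (a + d) ^ 2 < 4 := by exact_mod_cast htr
    have hc : (p : ℤ) * c ≠ 0 := by exact_mod_cast hc0
    obtain ⟨A, B, C, hr, hpA, hD⟩ := exists_isFormRoot_of_ne_zero (z := z) (B := d - a) (C := -b) hc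
      (by push_cast at hq ⊢; linear_combination hq) p (dvd_mul_right _ _)
    refine ⟨A, B, C, hr, hpA, ?_⟩
    rw [hD]
    obtain ht | ht := Int.sq_lt_four_cases htr'
    · refine Or.inl ⟨hζk.eq_two_of_inv hk hζ ?_, by linear_combination (a + d) * ht - 4 * hdet'⟩
      have ht' : (a : ℂ) + d = 0 := by exact_mod_cast ht
      push_cast at hu ⊢
      linear_combination hu + ((p * c : ℂ) * z + d) * ht'
    · refine Or.inr (Or.inl ⟨hζk.eq_three_of_inv (t := (a : ℂ) + d) hk hζ ?_ ?_,
        by linear_combination ht - 4 * hdet'⟩)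
      · push_cast at hu ⊢
        exact hu
      · exact_mod_cast ht
  · have hs0 : √(p : ℝ) ≠ 0 := (Real.sqrt_pos.2 hp0).ne'
    have hss : √(p : ℝ) ^ 2 = p := Real.sq_sqrt hp0.le
    have hssC : ((√(p : ℝ) : ℝ) : ℂ) ^ 2 = p := by exact_mod_cast congrArg ((↑) : ℝ → ℂ) hss
    have hs0C : ((√(p : ℝ) : ℝ) : ℂ) ≠ 0 := by exact_mod_cast hs0
    have hc : c ≠ 0 := by
      rintro rfl
      simp at hc0
    have hdet' : p * a * d - b * c = 1 := by
      have : (p * a * d - b * c : ℝ) = 1 := by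
        have e : b / √(p : ℝ) * (c * √(p : ℝ)) = b * c := by field_simp
        linear_combination hdet + e - a * d * hss
      exact_mod_cast this
    have htr' : p * (a + d) ^ 2 < 4 := by
      have : (p * (a + d) ^ 2 : ℝ) < 4 := by
        rw [← hss]; linarith
      exact_mod_cast this
    have ht : a + d = 0 := by
      by_contra hne
      have h1 : 0 < (a + d) ^ 2 := by positivity
      have : (5 : ℤ) ≤ p := by exact_mod_cast hp5
      nlinarith
    have hd : d = -a := by omega
    subst hd
    have hpc : (p : ℤ) * c ≠ 0 := mul_ne_zero (by exact_mod_cast hp.ne_zero) hc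
    obtain ⟨A, B, C, hr, hpA, hD⟩ := exists_isFormRoot_of_ne_zero (z := z) (B := -(2 * a * p))
      (C := -b) hpc (by
        push_cast at hq ⊢
        have h5 : ((√(p : ℝ) : ℝ) : ℂ) * (c * ((√(p : ℝ) : ℝ) : ℂ) * (z : ℂ) ^ 2 +
            (-(a : ℂ) * ((√(p : ℝ) : ℝ) : ℂ) - a * ((√(p : ℝ) : ℝ) : ℂ)) * z -
            b / ((√(p : ℝ) : ℝ) : ℂ)) = 0 := by
          rw [hq, mul_zero]
        field_simp at h5
        rw [hssC] at h5
        linear_combination h5) p (dvd_mul_right _ _)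
    refine ⟨A, B, C, hr, hpA, Or.inr (Or.inr ⟨hζk.eq_two_of_inv hk hζ ?_, ?_⟩)⟩
    · push_cast at hu ⊢
      linear_combination hu
    · rw [hD]
      linear_combination -4 * (p : ℤ) * hdet'

end

section

open UpperHalfPlane Matrix Filter Topology Function
open scoped MatrixGroups Manifold

namespace IsFormRoot

variable {A B C A' B' C' : ℤ} {z w : ℍ}

theorem re_im (h : IsFormRoot A B C z) :
    (B : ℝ) = -2 * A * z.re ∧ (C : ℝ) = A * (z.re ^ 2 + z.im ^ 2) ∧
      (B : ℝ) ^ 2 - 4 * A * C = -4 * A ^ 2 * z.im ^ 2 := by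
  have h1 := congrArg Complex.im h.eq
  have h2 := congrArg Complex.re h.eq
  simp [sq] at h1 h2
  have h3 : (B : ℝ) = -2 * A * z.re := by
    have : z.im * (2 * A * z.re + B) = 0 := by linear_combination h1
    have := (mul_eq_zero.1 this).resolve_left z.im_pos.ne'
    linear_combination this
  have h4 : (C : ℝ) = A * (z.re ^ 2 + z.im ^ 2) := by
    rw [h3] at h2
    linear_combination h2
  exact ⟨h3, h4, by rw [h3, h4]; ring⟩

theorem disc_neg (h : IsFormRoot A B C z) : B ^ 2 - 4 * A * C < 0 := by
  have h1 := h.re_im.2.2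
  have h2 : (0 : ℝ) < A := by exact_mod_cast h.pos
  have h3 := z.im_pos
  have : (B : ℝ) ^ 2 - 4 * A * C < 0 := by
    rw [h1]
    have : (0 : ℝ) < A ^ 2 * z.im ^ 2 := by positivity
    linarith
  exact_mod_cast this

theorem unique (h : IsFormRoot A B C z) (h' : IsFormRoot A' B' C' z)
    (hD : B ^ 2 - 4 * A * C = B' ^ 2 - 4 * A' * C') : A = A' ∧ B = B' ∧ C = C' := by
  obtain ⟨h1, h2, h3⟩ := h.re_im
  obtain ⟨h1', h2', h3'⟩ := h'.re_im
  have hDR : (B : ℝ) ^ 2 - 4 * A * C = B' ^ 2 - 4 * A' * C' := by exact_mod_cast hD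
  have hA : (0 : ℝ) < A := by exact_mod_cast h.pos
  have hA' : (0 : ℝ) < A' := by exact_mod_cast h'.pos
  have hz := pow_pos z.im_pos 2
  have hsq : (A : ℝ) ^ 2 = A' ^ 2 := by
    rw [h3, h3'] at hDR
    have : ((A : ℝ) ^ 2 - A' ^ 2) * z.im ^ 2 = 0 := by linear_combination -hDR / 4
    have := (mul_eq_zero.1 this).resolve_right hz.ne'
    linarith
  have hAA : (A : ℝ) = A' := (sq_eq_sq₀ hA.le hA'.le).1 hsq
  rw [hAA] at h1 h2
  refine ⟨by exact_mod_cast hAA, ?_, ?_⟩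
  · have : (B : ℝ) = B' := h1.trans h1'.symm
    exact_mod_cast this
  · have : (C : ℝ) = C' := h2.trans h2'.symm
    exact_mod_cast this

theorem eq_of_form (h : IsFormRoot A B C z) (h' : IsFormRoot A B C w) : z = w := by
  obtain ⟨h1, h2, h3⟩ := h.re_im
  obtain ⟨h1', h2', h3'⟩ := h'.re_im
  have hA : (0 : ℝ) < A := by exact_mod_cast h.pos
  have hre : z.re = w.re := by
    have : (A : ℝ) * (z.re - w.re) = 0 := by linear_combination (h1' - h1) / (-2)
    have := (mul_eq_zero.1 this).resolve_left hA.ne'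
    linarith
  have him : z.im = w.im := by
    have : (A : ℝ) ^ 2 * (z.im ^ 2 - w.im ^ 2) = 0 := by linear_combination (h3' - h3) / (-4)
    have := (mul_eq_zero.1 this).resolve_left (by positivity)
    exact (sq_eq_sq₀ z.im_pos.le w.im_pos.le).1 (by linarith)
  exact UpperHalfPlane.ext (Complex.ext hre him)

theorem coe_SL2Z_smul (g : SL(2, ℤ)) (z : ℍ) :
    ((g • z : ℍ) : ℂ) = ((g 0 0 : ℂ) * z + g 0 1) / ((g 1 0 : ℂ) * z + g 1 1) := by
  rw [UpperHalfPlane.coe_specialLinearGroup_apply]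
  simp

theorem denom_SL2Z_ne_zero (g : SL(2, ℤ)) (z : ℍ) : (g 1 0 : ℂ) * z + g 1 1 ≠ 0 := by
  have := denom_ne_zero ((SpecialLinearGroup.map (Int.castRingHom ℝ) g : SL(2, ℝ)) : GL (Fin 2) ℝ) z
  simpa [denom] using this

/-- The substitution action on binary quadratic forms. -/
theorem of_smul (g : SL(2, ℤ)) (h : IsFormRoot A B C (g • z)) :
    IsFormRoot (A * g 0 0 ^ 2 + B * g 0 0 * g 1 0 + C * g 1 0 ^ 2)
      (2 * A * g 0 0 * g 0 1 + B * (g 0 0 * g 1 1 + g 0 1 * g 1 0) + 2 * C * g 1 0 * g 1 1)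
      (A * g 0 1 ^ 2 + B * g 0 1 * g 1 1 + C * g 1 1 ^ 2) z := by
  have hdet : g 0 0 * g 1 1 - g 0 1 * g 1 0 = 1 := by
    rw [← Matrix.det_fin_two]; exact g.2
  refine ⟨?_, ?_⟩
  · have hD := h.disc_neg
    have hA := h.pos
    by_cases hc : g 1 0 = 0
    · have ha : g 0 0 ≠ 0 := by
        intro ha
        simp [hc, ha] at hdet
      rw [hc]
      have : 0 < g 0 0 ^ 2 := by positivity
      nlinarith
    · have : 0 < g 1 0 ^ 2 := by positivity
      have h1 : 0 < 4 * A * (A * g 0 0 ^ 2 + B * g 0 0 * g 1 0 + C * g 1 0 ^ 2) := by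
        nlinarith [sq_nonneg (2 * A * g 0 0 + B * g 1 0)]
      exact pos_of_mul_pos_right h1 (by omega)
  · have h1 := h.eq
    rw [coe_SL2Z_smul] at h1
    have h2 := denom_SL2Z_ne_zero g z
    generalize hd : (g 1 0 : ℂ) * z + g 1 1 = d at h1 h2
    field_simp at h1
    push_cast
    rw [← hd] at h1
    linear_combination h1

theorem disc_of_smul (g : SL(2, ℤ)) (A B C : ℤ) :
    (2 * A * g 0 0 * g 0 1 + B * (g 0 0 * g 1 1 + g 0 1 * g 1 0) + 2 * C * g 1 0 * g 1 1) ^ 2 -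
      4 * (A * g 0 0 ^ 2 + B * g 0 0 * g 1 0 + C * g 1 0 ^ 2) *
        (A * g 0 1 ^ 2 + B * g 0 1 * g 1 1 + C * g 1 1 ^ 2) = B ^ 2 - 4 * A * C := by
  have hdet : g 0 0 * g 1 1 - g 0 1 * g 1 0 = 1 := by
    rw [← Matrix.det_fin_two]; exact g.2
  linear_combination (B ^ 2 - 4 * A * C) * (g 0 0 * g 1 1 - g 0 1 * g 1 0 + 1) * hdet

/-- Equivalent points of the same discriminant are roots of equivalent forms. -/
theorem eq_of_smul (h : IsFormRoot A B C z) (h' : IsFormRoot A' B' C' w)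
    (hD : B ^ 2 - 4 * A * C = B' ^ 2 - 4 * A' * C') (g : SL(2, ℤ)) (hg : g • z = w) :
    A = A' * g 0 0 ^ 2 + B' * g 0 0 * g 1 0 + C' * g 1 0 ^ 2 ∧
    B = 2 * A' * g 0 0 * g 0 1 + B' * (g 0 0 * g 1 1 + g 0 1 * g 1 0) + 2 * C' * g 1 0 * g 1 1 := by
  subst hg
  have := h.unique (h'.of_smul g) (by rw [disc_of_smul, hD])
  exact ⟨this.1, this.2.1⟩

/-- Reduction theory of binary quadratic forms. -/
theorem exists_reduced (h : IsFormRoot A B C z) : ∃ (g : SL(2, ℤ)) (A' B' C' : ℤ),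
    IsFormRoot A' B' C' (g • z) ∧ B' ^ 2 - 4 * A' * C' = B ^ 2 - 4 * A * C ∧ |B'| ≤ A' ∧
      A' ≤ C' := by
  obtain ⟨g, hg⟩ := ModularGroup.exists_smul_mem_fd z
  have h0 : IsFormRoot A B C (g⁻¹ • (g • z)) := by rwa [inv_smul_smul]
  have h1 := h0.of_smul g⁻¹
  have hD := disc_of_smul g⁻¹ A B C
  refine ⟨g, _, _, _, h1, hD, ?_⟩
  obtain ⟨h2, h3, h4⟩ := h1.re_im
  have hpos := h1.pos
  generalize A * g⁻¹ 0 0 ^ 2 + B * g⁻¹ 0 0 * g⁻¹ 1 0 + C * g⁻¹ 1 0 ^ 2 = A' at *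
  generalize 2 * A * g⁻¹ 0 0 * g⁻¹ 0 1 + B * (g⁻¹ 0 0 * g⁻¹ 1 1 + g⁻¹ 0 1 * g⁻¹ 1 0) +
    2 * C * g⁻¹ 1 0 * g⁻¹ 1 1 = B' at *
  generalize A * g⁻¹ 0 1 ^ 2 + B * g⁻¹ 0 1 * g⁻¹ 1 1 + C * g⁻¹ 1 1 ^ 2 = C' at *
  have hA' : (0 : ℝ) < A' := by exact_mod_cast hpos
  have hnorm : 1 ≤ (g • z).re ^ 2 + (g • z).im ^ 2 := by
    have := hg.1
    rw [Complex.normSq_apply] at this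
    simpa [sq] using this
  have hre := abs_le.1 hg.2
  constructor
  · have : |(B' : ℝ)| ≤ A' := by
      rw [h2, abs_le]
      constructor <;> nlinarith
    exact_mod_cast this
  · have : (A' : ℝ) ≤ C' := by
      rw [h3]
      nlinarith
    exact_mod_cast this

end IsFormRoot

end

section

open UpperHalfPlane Matrix Filter Topology Function
open scoped MatrixGroups Manifold

/-- All roots of forms of discriminant `D` are equivalent under `SL(2, ℤ)`. -/
def IsClassNumberOne (D : ℤ) : Prop :=
  ∃ τ : ℍ, ∀ (A B C : ℤ) (z : ℍ), IsFormRoot A B C z → B ^ 2 - 4 * A * C = D →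
    ∃ g : SL(2, ℤ), g • z = τ

namespace IsFormRoot

variable {A B C A' B' C' : ℤ} {z w : ℍ} {p : ℕ}

theorem fricke_smul [NeZero p] (h : IsFormRoot (p * A) B C z) :
    IsFormRoot (p * C) (-B) A (fricke p • z) := by
  have hp0 : (0 : ℤ) < p := by exact_mod_cast Nat.pos_of_ne_zero (NeZero.ne p)
  have hpC : (p : ℂ) ≠ 0 := NeZero.ne _
  have hz := z.ne_zero
  refine ⟨mul_pos hp0 ?_, ?_⟩
  · obtain ⟨-, h2, -⟩ := h.re_im
    have h3 : (0 : ℝ) < (p * A : ℤ) := by exact_mod_cast h.pos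
    have h4 := z.im_pos
    have : (0 : ℝ) < C := by rw [h2]; positivity
    exact_mod_cast this
  · have := h.eq
    rw [coe_fricke_smul]
    push_cast at this ⊢
    field_simp
    linear_combination this

end IsFormRoot

theorem isClassNumberOne_neg_four : IsClassNumberOne (-4) := by
  have hI : IsFormRoot 1 0 1 UpperHalfPlane.I := ⟨one_pos, by simp⟩
  refine ⟨UpperHalfPlane.I, fun A B C z h hD ↦ ?_⟩
  obtain ⟨g, A', B', C', h', hD', h1, h2⟩ := h.exists_reduced
  refine ⟨g, ?_⟩
  rw [hD] at hD'
  rw [abs_le] at h1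
  have hpos := h'.pos
  obtain rfl : A' = 1 := by nlinarith
  have : B' = 0 ∧ C' = 1 := by
    obtain ⟨h3, h4⟩ := h1
    interval_cases B' <;> omega
  obtain ⟨rfl, rfl⟩ := this
  exact h'.eq_of_form hI

theorem isClassNumberOne_neg_three : IsClassNumberOne (-3) := by
  have hex : ∃ τ : ℍ, IsFormRoot 1 1 1 τ := by
    refine ⟨⟨⟨-1 / 2, √3 / 2⟩, by simp⟩, one_pos, ?_⟩
    have h3 : √(3 : ℝ) ^ 2 = 3 := Real.sq_sqrt (by norm_num)
    apply Complex.ext <;> simp [sq] <;> nlinarith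
  obtain ⟨τ, hτ⟩ := hex
  refine ⟨τ, fun A B C z h hD ↦ ?_⟩
  obtain ⟨g, A', B', C', h', hD', h1, h2⟩ := h.exists_reduced
  rw [hD] at hD'
  rw [abs_le] at h1
  have hpos := h'.pos
  obtain rfl : A' = 1 := by nlinarith
  have : C' = 1 ∧ (B' = 1 ∨ B' = -1) := by
    obtain ⟨h3, h4⟩ := h1
    interval_cases B' <;> omega
  obtain ⟨rfl, rfl | rfl⟩ := this
  · exact ⟨g, h'.eq_of_form hτ⟩
  · refine ⟨ModularGroup.T⁻¹ * g, ?_⟩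
    have h3 : IsFormRoot 1 (-1) 1 (ModularGroup.T • (ModularGroup.T⁻¹ * g) • z) := by
      rwa [mul_smul, smul_inv_smul]
    generalize (ModularGroup.T⁻¹ * g) • z = w at h3 ⊢
    have h4 := h3.of_smul
    simp [ModularGroup.T] at h4
    exact h4.eq_of_form hτ

/-- If `D` has class number one, then `Γ₀(p)*` acts transitively on the roots of the forms
of discriminant `D` with leading coefficient divisible by `p`. -/
theorem IsClassNumberOne.exists_smul_eq {D : ℤ} (hcl : IsClassNumberOne D) {p : ℕ} (hp : p.Prime)
    (hp2 : p ≠ 2) (hpD : ¬ (p : ℤ) ∣ D) {A B C A' B' C' : ℤ} {z w : ℍ} (h : IsFormRoot A B C z)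
    (h' : IsFormRoot A' B' C' w) (hA : (p : ℤ) ∣ A) (hA' : (p : ℤ) ∣ A')
    (hD : B ^ 2 - 4 * A * C = D) (hD' : B' ^ 2 - 4 * A' * C' = D) :
    ∃ γ ∈ Gamma0Star p, γ • z = w := by
  have : NeZero p := ⟨hp.ne_zero⟩
  have hpZ : Prime (p : ℤ) := Nat.prime_iff_prime_int.1 hp
  obtain ⟨τ, hτ⟩ := hcl
  have key : ∀ (A' B' C' : ℤ) (w : ℍ), IsFormRoot A' B' C' w → (p : ℤ) ∣ A' →
      B' ^ 2 - 4 * A' * C' = D → (∃ γ ∈ Gamma0Star p, γ • z = w) ∨ (p : ℤ) ∣ B + B' := by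
    intro A' B' C' w h' hA' hD'
    obtain ⟨g, hg⟩ := hτ A B C z h hD
    obtain ⟨g', hg'⟩ := hτ A' B' C' w h' hD'
    set δ := g'⁻¹ * g with hδ
    have hδz : δ • z = w := by rw [hδ, mul_smul, hg, ← hg', inv_smul_smul]
    obtain ⟨e1, e2⟩ := h.eq_of_smul h' (hD.trans hD'.symm) δ hδz
    have hdet : δ 0 0 * δ 1 1 - δ 0 1 * δ 1 0 = 1 := by
      rw [← Matrix.det_fin_two]; exact δ.2
    obtain ⟨x, hx⟩ := hA
    obtain ⟨y, hy⟩ := hA'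
    have h1 : (p : ℤ) ∣ δ 1 0 * (B' * δ 0 0 + C' * δ 1 0) :=
      ⟨x - y * δ 0 0 ^ 2, by linear_combination hx - e1 - δ 0 0 ^ 2 * hy⟩
    obtain h2 | ⟨s, hs⟩ := hpZ.dvd_or_dvd h1
    · exact Or.inl ⟨_, Gamma0Star.of_int δ h2, by rw [map_smul_eq, hδz]⟩
    · refine Or.inr ⟨2 * y * δ 0 0 * δ 0 1 + 2 * s * δ 1 1, ?_⟩
      linear_combination e2 + 2 * δ 0 0 * δ 0 1 * hy + 2 * δ 1 1 * hs - B' * hdet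
  obtain h1 | h1 := key A' B' C' w h' hA' hD'
  · exact h1
  obtain ⟨y, rfl⟩ := hA'
  obtain ⟨γ, hγ, hγz⟩ | h2 := key _ _ _ _ h'.fricke_smul (dvd_mul_right _ _)
    (by rw [← hD']; ring)
  · refine ⟨(fricke p)⁻¹ * γ, mul_mem (inv_mem (fricke_mem p)) hγ, ?_⟩
    rw [mul_smul, hγz, inv_smul_smul]
  · exfalso
    have h3 : (p : ℤ) ∣ 2 * B := by
      have := dvd_add h1 h2
      rwa [show B + B' + (B + -B') = 2 * B by ring] at this
    have h4 : (p : ℤ) ∣ B := by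
      refine (hpZ.dvd_or_dvd h3).resolve_left fun h2 ↦ hp2 ?_
      exact (Nat.prime_dvd_prime_iff_eq hp Nat.prime_two).1 (by exact_mod_cast h2)
    apply hpD
    rw [← hD, sq]
    exact dvd_sub (h4.mul_right B) ((hA.mul_left 4).mul_right C)

/-- Points of discriminant `-4p` which are equivalent under `SL(2, ℤ)` are equivalent
under `Γ₀(p)`. -/
theorem IsFormRoot.exists_smul_eq_of_disc_neg_four_mul {p : ℕ} (hp : p.Prime) (hp2 : p ≠ 2)
    {A B C A' B' C' : ℤ} {z w : ℍ} (h : IsFormRoot A B C z)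
    (h' : IsFormRoot A' B' C' w) (hA : (p : ℤ) ∣ A) (hA' : (p : ℤ) ∣ A')
    (hD : B ^ 2 - 4 * A * C = -4 * p) (hD' : B' ^ 2 - 4 * A' * C' = -4 * p)
    (δ : SL(2, ℤ)) (hδ : δ • z = w) :
    ∃ γ ∈ Gamma0Star p, γ • z = w := by
  have hpZ : Prime (p : ℤ) := Nat.prime_iff_prime_int.1 hp
  obtain ⟨e1, e2⟩ := h.eq_of_smul h' (hD.trans hD'.symm) δ hδ
  obtain ⟨x, hx⟩ := hA
  obtain ⟨y, hy⟩ := hA'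
  obtain ⟨s, hs⟩ : (p : ℤ) ∣ B' :=
    hpZ.dvd_of_dvd_pow (n := 2) ⟨4 * y * C' - 4, by linear_combination hD' + 4 * C' * hy⟩
  have hC' : ¬ (p : ℤ) ∣ C' := by
    rintro ⟨t, rfl⟩
    have h1 : (p : ℤ) * (p * (4 * y * t - s ^ 2)) = p * 4 := by
      rw [hy, hs] at hD'
      linear_combination -hD'
    have h2 := mul_left_cancel₀ hpZ.ne_zero h1
    have h3 : (p : ℤ) ∣ 2 ^ 2 := ⟨_, by rw [h2]; norm_num⟩
    have h4 := hpZ.dvd_of_dvd_pow h3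
    exact hp2 ((Nat.prime_dvd_prime_iff_eq hp Nat.prime_two).1 (by exact_mod_cast h4))
  have h1 : (p : ℤ) ∣ C' * δ 1 0 ^ 2 :=
    ⟨x - y * δ 0 0 ^ 2 - s * δ 0 0 * δ 1 0,
      by linear_combination hx - e1 - δ 0 0 ^ 2 * hy - δ 0 0 * δ 1 0 * hs⟩
  have h2 := hpZ.dvd_of_dvd_pow ((hpZ.dvd_or_dvd h1).resolve_left hC')
  exact ⟨_, Gamma0Star.of_int δ h2, by rw [map_smul_eq, hδ]⟩

end

/-- The values `0 ≤ b ≤ n` for which `(A, 2b, C)` is a form of discriminant `-4p` with `A ≤ C`. -/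
def formCoeffs (p A n : ℕ) : Finset ℕ :=
  {b ∈ Finset.range (n + 1) | A ∣ b ^ 2 + p ∧ A ^ 2 ≤ b ^ 2 + p}

/-- The number of `-n ≤ b ≤ n` for which `(A, 2b, C)` is a form of discriminant `-4p`
with `A ≤ C`, defined so as to evaluate quickly. -/
def formCount (p A n : ℕ) : ℕ :=
  Nat.rec (cond (Nat.beq (p % A) 0) (cond (Nat.ble (A * A) p) 1 0) 0)
    (fun b t ↦ cond (Nat.beq ((b.succ * b.succ + p) % A) 0)
      (cond (Nat.ble (A * A) (b.succ * b.succ + p)) (2 + t) t) t) n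

/-- The number of reduced forms of discriminant `-4p` with leading coefficient at most `X`. -/
def reducedFormCount (p X : ℕ) : ℕ :=
  Nat.rec 0 (fun A s ↦ s + formCount p A.succ (A.succ / 2)) X

theorem Nat.beq_eq_decide (a b : ℕ) : Nat.beq a b = decide (a = b) := by
  rw [Bool.eq_iff_iff]; simp

theorem Nat.ble_eq_decide (a b : ℕ) : Nat.ble a b = decide (a ≤ b) := by
  rw [Bool.eq_iff_iff]; simp

theorem formCount_eq (p A n : ℕ) :
    formCount p A n = (formCoeffs p A n).card + ((formCoeffs p A n).erase 0).card := by
  induction n with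
  | zero =>
    have h : formCoeffs p A 0 = if A ∣ p ∧ A ^ 2 ≤ p then {0} else ∅ := by
      ext b
      by_cases h : A ∣ p ∧ A ^ 2 ≤ p <;> by_cases hb : b = 0 <;> simp [formCoeffs, h, hb]
    rw [h]
    simp only [formCount, Nat.dvd_iff_mod_eq_zero, sq]
    by_cases h1 : p % A = 0 <;> by_cases h2 : A * A ≤ p <;> simp [h1, h2, Nat.beq_eq_decide,
      Nat.ble_eq_decide]
  | succ n ih =>
    have h : formCoeffs p A (n + 1) = if A ∣ (n + 1) ^ 2 + p ∧ A ^ 2 ≤ (n + 1) ^ 2 + p then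
        insert (n + 1) (formCoeffs p A n) else formCoeffs p A n := by
      rw [formCoeffs, Finset.range_add_one, Finset.filter_insert]; rfl
    have hn : n + 1 ∉ formCoeffs p A n := by simp [formCoeffs]
    have h0 : formCount p A (n + 1) = cond (Nat.beq (((n + 1) * (n + 1) + p) % A) 0)
      (cond (Nat.ble (A * A) ((n + 1) * (n + 1) + p)) (2 + formCount p A n)
        (formCount p A n)) (formCount p A n) := rfl
    rw [h, h0]
    simp only [Nat.dvd_iff_mod_eq_zero, sq]
    by_cases h1 : ((n + 1) * (n + 1) + p) % A = 0 <;>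
      by_cases h2 : A * A ≤ (n + 1) * (n + 1) + p <;> simp [h1, h2, ih, Nat.beq_eq_decide,
        Nat.ble_eq_decide]
    rw [Finset.erase_insert_of_ne (by simp), Finset.card_insert_of_notMem hn,
      Finset.card_insert_of_notMem (by simp [hn])]
    ring

theorem reducedFormCount_eq (p X : ℕ) : reducedFormCount p X =
    ∑ A ∈ Finset.Ioc 0 X, ((formCoeffs p A (A / 2)).card +
      ((formCoeffs p A (A / 2)).erase 0).card) := by
  induction X with
  | zero => rfl
  | succ X ih =>
    rw [Finset.sum_Ioc_succ_top (Nat.zero_le X), ← ih, ← formCount_eq]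
    rfl

theorem reducedFormCount_lt_of_lt : ∀ X < 83, ∀ j < 3 * X / 2 + 2,
    Nat.gcd (3 * X ^ 2 / 4 + j) 30030 = 1 →
    3 * X ^ 2 / 4 + j ∈ [1, 17, 19, 23, 29, 31, 41, 47, 59, 71] ∨
      6 * reducedFormCount (3 * X ^ 2 / 4 + j) X + 1 < 3 * X ^ 2 / 4 + j := by
  decide +kernel

/-- A quadratic polynomial `b² + p` has few roots modulo `A`. -/
theorem card_formCoeffs_le {p : ℕ} (hp : p.Prime) {A : ℕ} (hA : 0 < A) (hAp : A < p) :
    (formCoeffs p A (A / 2)).card ≤ A.divisors.card := by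
  have hcop : A.Coprime p := ((Nat.Prime.coprime_iff_not_dvd hp).2
    (Nat.not_dvd_of_pos_of_lt hA hAp)).symm
  obtain hS | ⟨b₀, hb₀⟩ := (formCoeffs p A (A / 2)).eq_empty_or_nonempty
  · simp [hS]
  have hmem : ∀ b ∈ formCoeffs p A (A / 2), b ≤ A / 2 ∧ A ∣ b ^ 2 + p := by
    intro b hb
    simp only [formCoeffs, Finset.mem_filter, Finset.mem_range] at hb
    exact ⟨by omega, hb.2.1⟩
  obtain ⟨-, h0⟩ := hmem b₀ hb₀
  have hcop0 : A.Coprime b₀ := by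
    refine Nat.Coprime.coprime_dvd_right (dvd_refl b₀) ?_
    have h1 : A.gcd b₀ ∣ p :=
      (Nat.dvd_add_right ((Nat.gcd_dvd_right A b₀).trans (dvd_pow_self _ two_ne_zero))).1
        ((Nat.gcd_dvd_left A b₀).trans h0)
    exact Nat.eq_one_of_dvd_coprimes hcop (Nat.gcd_dvd_left A b₀) h1
  refine Finset.card_le_card_of_injOn (fun b ↦ Int.gcd (b - b₀) A) (fun b _ ↦ ?_) ?_
  · simp only [Finset.mem_coe, Nat.mem_divisors]
    exact ⟨Nat.gcd_dvd_right _ _, hA.ne'⟩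
  intro b hb c hc hbc
  simp only at hbc
  obtain ⟨hb1, hb2⟩ := hmem b hb
  obtain ⟨hc1, hc2⟩ := hmem c hc
  have hplus : ∀ x : ℕ, A ∣ x ^ 2 + p → ∀ d e : ℕ, Int.gcd (x - b₀) A = d → A = d * e →
      (e : ℤ) ∣ x + b₀ := by
    intro x hx d e hd he
    have hd0 : 0 < d := Nat.pos_of_mul_pos_right (he ▸ hA)
    have h1 : (A : ℤ) ∣ (x - b₀) * (x + b₀) := by
      have h2 : (A : ℤ) ∣ x ^ 2 + p := by exact_mod_cast hx
      have h3 : (A : ℤ) ∣ b₀ ^ 2 + p := by exact_mod_cast h0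
      rw [show (x - b₀ : ℤ) * (x + b₀) = (x ^ 2 + p) - (b₀ ^ 2 + p) by ring]
      exact dvd_sub h2 h3
    have h4 : (d * e : ℤ) ∣ Int.gcd (x - b₀) A * (x + b₀) := by
      have h5 : A ∣ (x - b₀ : ℤ).natAbs * (x + b₀ : ℤ).natAbs := by
        rw [← Int.natAbs_mul]; exact Int.natCast_dvd.1 h1
      have h6 := Nat.dvd_gcd h5 (dvd_mul_right A (x + b₀ : ℤ).natAbs)
      rw [Nat.gcd_mul_right] at h6
      rw [← Nat.cast_mul, ← he, Int.natCast_dvd, Int.natAbs_mul]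
      exact h6
    rw [hd] at h4
    exact (mul_dvd_mul_iff_left (by exact_mod_cast hd0.ne')).1 h4
  obtain ⟨e, he⟩ : Int.gcd (b - b₀) A ∣ A := Nat.gcd_dvd_right _ _
  set d := Int.gcd (b - b₀) A with hd
  have hb3 := hplus b hb2 d e rfl he
  have hc3 := hplus c hc2 d e hbc.symm he
  have hdb : (d : ℤ) ∣ b - b₀ := Int.gcd_dvd_left ..
  have hdc : (d : ℤ) ∣ c - b₀ := by rw [hbc]; exact Int.gcd_dvd_left ..
  have hm1 : d ∣ (b - c : ℤ).natAbs := by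
    rw [← Int.natCast_dvd, ← sub_sub_sub_cancel_right _ _ (b₀ : ℤ)]; exact dvd_sub hdb hdc
  have hm2 : e ∣ (b - c : ℤ).natAbs := by
    rw [← Int.natCast_dvd, ← add_sub_add_right_eq_sub _ _ (b₀ : ℤ)]; exact dvd_sub hb3 hc3
  have hg : d.gcd e ∣ 2 := by
    have h1 : ((d.gcd e : ℕ) : ℤ) ∣ 2 * b₀ := by
      have h2 : ((d.gcd e : ℕ) : ℤ) ∣ b - b₀ :=
        (Int.natCast_dvd_natCast.2 (Nat.gcd_dvd_left d e)).trans hdb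
      have h3 : ((d.gcd e : ℕ) : ℤ) ∣ b + b₀ :=
        (Int.natCast_dvd_natCast.2 (Nat.gcd_dvd_right d e)).trans hb3
      rw [show (2 : ℤ) * b₀ = (b + b₀) - (b - b₀) by ring]; exact dvd_sub h3 h2
    refine Nat.Coprime.dvd_of_dvd_mul_right (n := b₀) ?_ (by exact_mod_cast h1)
    exact Nat.Coprime.coprime_dvd_left
      ((Nat.gcd_dvd_left d e).trans ⟨e, he⟩) hcop0
  have hlcm : A ∣ 2 * (b - c : ℤ).natAbs := by
    rw [he, ← Nat.gcd_mul_lcm]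
    exact mul_dvd_mul hg (Nat.lcm_dvd hm1 hm2)
  obtain h1 | h1 := Nat.eq_zero_or_pos (2 * (b - c : ℤ).natAbs)
  · omega
  have h2 := Nat.le_of_dvd h1 hlcm
  have h3 : A ∣ p := by
    obtain rfl | rfl : b = 0 ∨ c = 0 := by omega
    · simpa using hb2
    · simpa using hc2
  obtain h | h := (Nat.dvd_prime hp).1 h3 <;> omega

theorem sum_card_divisors (X : ℕ) :
    ∑ A ∈ Finset.Ioc 0 X, A.divisors.card = ∑ d ∈ Finset.Ioc 0 X, X / d := by
  have h1 : ∀ A ∈ Finset.Ioc 0 X, A.divisors.card =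
      ∑ d ∈ Finset.Ioc 0 X, if d ∣ A then 1 else 0 := by
    intro A hA
    rw [Finset.mem_Ioc] at hA
    rw [← Finset.card_filter]
    congr 1
    ext d
    simp only [Nat.mem_divisors, Finset.mem_filter, Finset.mem_Ioc]
    constructor
    · rintro ⟨h, -⟩
      exact ⟨⟨Nat.pos_of_dvd_of_pos h hA.1, (Nat.le_of_dvd hA.1 h).trans hA.2⟩, h⟩
    · rintro ⟨-, h⟩
      exact ⟨h, hA.1.ne'⟩
  rw [Finset.sum_congr rfl h1, Finset.sum_comm]
  refine Finset.sum_congr rfl fun d _ ↦ ?_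
  rw [← Finset.card_filter, Nat.Ioc_filter_dvd_card_eq_div]

theorem sixteen_mul_harmonic_le {X : ℕ} (hX : 83 ≤ X) : 16 * harmonic X ≤ X - 1 := by
  induction X, hX using Nat.le_induction with
  | base => norm_num [harmonic, Finset.sum_range_succ]
  | succ X hX ih =>
    rw [harmonic_succ]
    have : ((X + 1 : ℕ) : ℚ)⁻¹ ≤ 16⁻¹ := by
      apply inv_anti₀ (by norm_num)
      exact_mod_cast (by omega : 16 ≤ X + 1)
    push_cast at *
    linarith

theorem reducedFormCount_lt_of_le {p : ℕ} (hp : p.Prime) {X : ℕ} (hX : 83 ≤ X)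
    (hXp : 3 * X ^ 2 ≤ 4 * p) : 6 * reducedFormCount p X + 1 < p := by
  have h1 : reducedFormCount p X ≤ 2 * ∑ d ∈ Finset.Ioc 0 X, X / d := by
    rw [reducedFormCount_eq, ← sum_card_divisors, Finset.mul_sum]
    refine Finset.sum_le_sum fun A hA ↦ ?_
    rw [Finset.mem_Ioc] at hA
    have h2 := card_formCoeffs_le hp hA.1 (by nlinarith : A < p)
    have h3 := Finset.card_erase_le (s := formCoeffs p A (A / 2)) (a := 0)
    omega
  have h2 : ((∑ d ∈ Finset.Ioc 0 X, X / d : ℕ) : ℚ) ≤ X * harmonic X := by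
    rw [harmonic_eq_sum_Icc, Finset.mul_sum, Nat.cast_sum]
    exact Finset.sum_le_sum fun d _ ↦ Nat.cast_div_le.trans_eq (div_eq_mul_inv _ _)
  have h3 := sixteen_mul_harmonic_le hX
  have h1' : (reducedFormCount p X : ℚ) ≤ 2 * ((∑ d ∈ Finset.Ioc 0 X, X / d : ℕ) : ℚ) := by
    exact_mod_cast h1
  have hXp' : 3 * (X : ℚ) ^ 2 ≤ 4 * p := by exact_mod_cast hXp
  have hX' : (83 : ℚ) ≤ X := by exact_mod_cast hX
  have : 6 * (reducedFormCount p X : ℚ) + 1 < p := by nlinarith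
  exact_mod_cast this

/-- If `X = ⌊√(4p/3)⌋` then the number of reduced forms is small, unless `p` is in the list. -/
theorem mem_of_le_reducedFormCount {p : ℕ} (hp : p.Prime)
    (h : p ≤ 6 * reducedFormCount p (Nat.sqrt (4 * p / 3)) + 1) :
    p ∈ ({2, 3, 5, 7, 11, 13, 17, 19, 23, 29, 31, 41, 47, 59, 71} : Finset ℕ) := by
  set X := Nat.sqrt (4 * p / 3) with hXdef
  have h1 : X ^ 2 ≤ 4 * p / 3 := Nat.sqrt_le' _
  have h2 : 4 * p / 3 < (X + 1) ^ 2 := Nat.lt_succ_sqrt' _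
  obtain hX | hX := Nat.lt_or_ge X 83
  · by_cases hc : Nat.gcd p 30030 = 1
    · have h4 := reducedFormCount_lt_of_lt X hX (p - 3 * X ^ 2 / 4) (by
        rw [add_sq] at h2
        omega)
      rw [Nat.add_sub_cancel' (by omega)] at h4
      obtain h5 | h5 := h4 hc
      · have := hp.one_lt
        simp only [List.mem_cons, List.not_mem_nil, or_false] at h5
        simp only [Finset.mem_insert, Finset.mem_singleton]
        omega
      · omega
    · have h4 : p ∣ 30030 := by
        by_contra hn
        exact hc ((Nat.Prime.coprime_iff_not_dvd hp).2 hn)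
      have h5 : p ∈ Nat.primeFactorsList 30030 := by
        rw [Nat.mem_primeFactorsList (by norm_num)]; exact ⟨hp, h4⟩
      have h6 : Nat.primeFactorsList 30030 = [2, 3, 5, 7, 11, 13] := by simp
      rw [h6] at h5
      simp only [List.mem_cons, List.not_mem_nil, or_false] at h5
      simp only [Finset.mem_insert, Finset.mem_singleton]
      omega
  · have := reducedFormCount_lt_of_le hp hX (by omega)
    omega

section

open UpperHalfPlane Matrix Filter Topology Function
open scoped MatrixGroups Manifold

theorem card_le_reducedFormCount {α : Type*} {p : ℕ} (s : Finset α) (f : α → ℤ × ℤ)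
    (hf : Set.InjOn f s)
    (h : ∀ e ∈ s, 0 < (f e).1 ∧ (f e).1 ∣ (f e).2 ^ 2 + p ∧ (f e).1 ^ 2 ≤ (f e).2 ^ 2 + p ∧
      2 * |(f e).2| ≤ (f e).1) :
    s.card ≤ reducedFormCount p (Nat.sqrt (4 * p / 3)) := by
  set X := Nat.sqrt (4 * p / 3) with hX
  let T : Finset (ℤ × ℤ) := (Finset.Ioc 0 X).biUnion fun A ↦
    (formCoeffs p A (A / 2)).image (fun b : ℕ ↦ ((A : ℤ), (b : ℤ))) ∪
      ((formCoeffs p A (A / 2)).erase 0).image (fun b : ℕ ↦ ((A : ℤ), -(b : ℤ)))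
  have hT : T.card ≤ reducedFormCount p X := by
    rw [reducedFormCount_eq]
    refine Finset.card_biUnion_le.trans (Finset.sum_le_sum fun A _ ↦ ?_)
    exact (Finset.card_union_le _ _).trans (add_le_add Finset.card_image_le Finset.card_image_le)
  refine (Finset.card_le_card_of_injOn f (fun e he ↦ ?_) hf).trans hT
  obtain ⟨h1, h2, h3, h4⟩ := h e he
  generalize hfe : f e = x at *
  obtain ⟨A, b⟩ := x
  simp only at h1 h2 h3 h4
  lift A to ℕ using h1.le
  have habs := Int.abs_eq_natAbs b
  have hb : b.natAbs ∈ formCoeffs p A (A / 2) := by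
    simp only [formCoeffs, Finset.mem_filter, Finset.mem_range]
    refine ⟨by omega, ?_, ?_⟩
    · zify; simpa using h2
    · zify; simpa using h3
  simp only [T, Finset.coe_biUnion, Set.mem_iUnion]
  refine ⟨A, ?_, ?_⟩
  · simp only [Finset.coe_Ioc, Set.mem_Ioc]
    refine ⟨by omega, ?_⟩
    rw [hX, Nat.le_sqrt', Nat.le_div_iff_mul_le (by norm_num)]
    zify
    have h5 : (2 * |b|) ^ 2 ≤ (A : ℤ) ^ 2 := pow_le_pow_left₀ (by positivity) h4 2
    rw [mul_pow, sq_abs] at h5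
    linarith
  · obtain hb0 | hb0 := le_or_gt 0 b
    · simp only [Finset.coe_union, Finset.coe_image]
      left
      exact ⟨b.natAbs, hb, by simp [abs_of_nonneg hb0]⟩
    · simp only [Finset.coe_union, Finset.coe_image]
      right
      refine ⟨b.natAbs, Finset.mem_erase.2 ⟨by simpa using hb0.ne, hb⟩, by simp [abs_of_neg hb0]⟩

namespace IsHauptmodul

variable {p : ℕ} {F : ℍ → ℂ}

/-- The value `e` is taken by `F` at a root of a form of discriminant `D` with leading
coefficient divisible by `p`. -/
def IsSpecialValue (p : ℕ) (F : ℍ → ℂ) (D : ℤ) (e : ℂ) : Prop :=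
  ∃ (z : ℍ) (A B C : ℤ), F z = e ∧ IsFormRoot A B C z ∧ (p : ℤ) ∣ A ∧ B ^ 2 - 4 * A * C = D

theorem card_isSpecialValue_le_one (hF : IsHauptmodul p F) (hp : p.Prime) (hp2 : p ≠ 2) {D : ℤ}
    (hD : IsClassNumberOne D) (hpD : ¬ (p : ℤ) ∣ D) (s : Finset ℂ)
    (hs : ∀ e ∈ s, IsSpecialValue p F D e) : s.card ≤ 1 := by
  refine Finset.card_le_one.2 fun a ha b hb ↦ ?_
  obtain ⟨z, A, B, C, rfl, h, hA, hz⟩ := hs a ha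
  obtain ⟨w, A', B', C', rfl, h', hA', hw⟩ := hs b hb
  exact (hF.eq_iff z w).2 (hD.exists_smul_eq hp hp2 hpD h h' hA hA' hz hw)

theorem card_isSpecialValue_le (hF : IsHauptmodul p F) (hp : p.Prime) (hp2 : p ≠ 2)
    (s : Finset ℂ) (hs : ∀ e ∈ s, IsSpecialValue p F (-4 * p) e) :
    s.card ≤ reducedFormCount p (Nat.sqrt (4 * p / 3)) := by
  have hred : ∀ e : ℂ, ∃ x : ℤ × ℤ, e ∈ s → ∃ (z : ℍ) (A B C : ℤ) (g : SL(2, ℤ)) (c : ℤ),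
      F z = e ∧ IsFormRoot A B C z ∧ (p : ℤ) ∣ A ∧ B ^ 2 - 4 * A * C = -4 * p ∧
      IsFormRoot x.1 (2 * x.2) c (g • z) ∧ x.2 ^ 2 + p = x.1 * c ∧
      2 * |x.2| ≤ x.1 ∧ x.1 ≤ c := by
    intro e
    by_cases he : e ∈ s
    · obtain ⟨z, A, B, C, hz, h, hA, hD⟩ := hs e he
      obtain ⟨g, A', B', C', h', hD', h1, h2⟩ := h.exists_reduced
      rw [hD] at hD'
      obtain ⟨b, rfl⟩ : (2 : ℤ) ∣ B' := by
        refine Int.prime_two.dvd_of_dvd_pow (n := 2) ⟨2 * (A' * C' - p), ?_⟩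
        linear_combination hD'
      refine ⟨(A', b), fun _ ↦ ⟨z, A, B, C, g, C', hz, h, hA, hD, h', ?_, ?_, h2⟩⟩
      · have : 4 * (b ^ 2 + (p : ℤ)) = 4 * (A' * C') := by linear_combination hD'
        exact mul_left_cancel₀ (by norm_num) this
      · rwa [abs_mul] at h1
    · exact ⟨0, fun h ↦ absurd h he⟩
  choose f hf using hred
  refine card_le_reducedFormCount s f (fun a ha b hb hab ↦ ?_) fun e he ↦ ?_
  · obtain ⟨z, A, B, C, g, c, rfl, h, hA, hD, hg, h1, -, -⟩ := hf a ha
    obtain ⟨w, A', B', C', g', c', rfl, h', hA', hD', hg', h1', -, -⟩ := hf b hb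
    rw [← hab] at hg' h1'
    obtain rfl : c = c' := mul_left_cancel₀ hg.pos.ne' (h1.symm.trans h1')
    refine (hF.eq_iff z w).2 (h.exists_smul_eq_of_disc_neg_four_mul hp hp2 h' hA hA' hD hD'
      (g'⁻¹ * g) ?_)
    rw [mul_smul, hg.eq_of_form hg', inv_smul_smul]
  · obtain ⟨z, A, B, C, g, c, -, -, -, -, hg, h1, h2, h3⟩ := hf e he
    exact ⟨hg.pos, ⟨c, h1⟩, by rw [h1, sq]; exact mul_le_mul_of_nonneg_left h3 hg.pos.le, h2⟩

/-- The Riemann–Hurwitz inequality for a Hauptmodul. -/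
theorem le_six_mul_reducedFormCount (hF : IsHauptmodul p F) (hp : p.Prime) (hp5 : 5 ≤ p) :
    p ≤ 6 * reducedFormCount p (Nat.sqrt (4 * p / 3)) + 1 := by
  classical
  obtain ⟨P, G, hG, hG0, hdeg, hPG⟩ := hF.exists_polynomial hp
  have hP0 : P ≠ 0 := by rintro rfl; simp at hdeg
  have hroot : ∀ e ∈ P.roots.toFinset,
      (P.rootMultiplicity e = 8 ∧ IsSpecialValue p F (-3) e) ∨
      (P.rootMultiplicity e = 6 ∧ IsSpecialValue p F (-4) e) ∨
      (P.rootMultiplicity e = 6 ∧ IsSpecialValue p F (-4 * p) e) := by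
    intro e he
    obtain ⟨z, rfl⟩ := hF.surjective e
    obtain ⟨k, hk0, hk⟩ := hF.exists_order z
    have hm := hF.rootMultiplicity_mul hP0 hG hG0 hPG z hk
    have hpos : 0 < P.rootMultiplicity (F z) := by
      rw [Polynomial.rootMultiplicity_pos hP0]
      exact Polynomial.isRoot_of_mem_roots (Multiset.mem_toFinset.1 he)
    have hk2 : 2 ≤ k := by
      by_contra! hlt
      obtain rfl : k = 1 := by omega
      omega
    have hζ := Complex.isPrimitiveRoot_exp k hk0
    obtain ⟨γ, hγ, hγz, hγζ⟩ := hF.exists_stabilizer hp z hk hζ.pow_eq_one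
    obtain ⟨A, B, C, h, hA, hD⟩ := Gamma0Star.exists_isFormRoot hp hp5 hγ hγz hζ hk2 hγζ
    obtain ⟨rfl, hD⟩ | ⟨rfl, hD⟩ | ⟨rfl, hD⟩ := hD
    · exact Or.inr (Or.inl ⟨by omega, z, A, B, C, rfl, h, hA, hD⟩)
    · exact Or.inl ⟨by omega, z, A, B, C, rfl, h, hA, hD⟩
    · exact Or.inr (Or.inr ⟨by omega, z, A, B, C, rfl, h, hA, hD⟩)
  set R := P.roots.toFinset with hR
  have hsum : P.natDegree = ∑ e ∈ R, P.rootMultiplicity e := by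
    rw [← IsAlgClosed.card_roots_eq_natDegree, ← Multiset.toFinset_sum_count_eq]
    simp [Polynomial.count_roots, hR]
  have hle : ∑ e ∈ R, P.rootMultiplicity e ≤
      ∑ e ∈ R, ((if IsSpecialValue p F (-3) e then 8 else 0) +
        (if IsSpecialValue p F (-4) e then 6 else 0) +
        (if IsSpecialValue p F (-4 * p) e then 6 else 0)) := by
    refine Finset.sum_le_sum fun e he ↦ ?_
    obtain ⟨h1, h2⟩ | ⟨h1, h2⟩ | ⟨h1, h2⟩ := hroot e he <;> rw [h1, if_pos h2] <;> omega
  simp only [Finset.sum_add_distrib, ← Finset.sum_filter, Finset.sum_const, smul_eq_mul] at hle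
  have hdvd : ∀ m : ℕ, 0 < m → m < 5 → ¬ (p : ℤ) ∣ -(m : ℤ) := by
    intro m hm hm5 h
    rw [Int.dvd_neg, Int.natCast_dvd_natCast] at h
    exact absurd (Nat.le_of_dvd hm h) (by omega)
  have h3 := hF.card_isSpecialValue_le_one hp (by omega) isClassNumberOne_neg_three
    (hdvd 3 (by norm_num) (by norm_num)) {e ∈ R | IsSpecialValue p F (-3) e} (by simp)
  have h4 := hF.card_isSpecialValue_le_one hp (by omega) isClassNumberOne_neg_four
    (hdvd 4 (by norm_num) (by norm_num)) {e ∈ R | IsSpecialValue p F (-4) e} (by simp)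
  have h5 := hF.card_isSpecialValue_le hp (by omega)
    {e ∈ R | IsSpecialValue p F (-4 * p) e} (by simp)
  omega

end IsHauptmodul

theorem IsGenusZeroStar.mem {p : ℕ} (h : IsGenusZeroStar p) (hp : p.Prime) :
    p ∈ ({2, 3, 5, 7, 11, 13, 17, 19, 23, 29, 31, 41, 47, 59, 71} : Finset ℕ) := by
  obtain ⟨F, hF⟩ := h.exists_isHauptmodul
  obtain hp5 | hp5 := Nat.lt_or_ge p 5
  · have := hp.two_le
    have : p ≠ 4 := by rintro rfl; norm_num at hp
    simp only [Finset.mem_insert, Finset.mem_singleton]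
    omega
  · exact mem_of_le_reducedFormCount hp (hF.le_six_mul_reducedFormCount hp hp5)

end

/-- **Genus-zero primes for `Γ₀(p)*`.**
For a prime `p`, the group `Γ₀(p)*` generated by `Γ₀(p)` and the Fricke involution
`W_p` has genus zero if and only if
`p ∈ {2,3,5,7,11,13,17,19,23,29,31,41,47,59,71}`. -/
theorem genus_zero_primes (p : ℕ) (hp : p.Prime) :
    IsGenusZeroStar p ↔
      p ∈ ({2, 3, 5, 7, 11, 13, 17, 19, 23, 29, 31, 41, 47, 59, 71} : Finset ℕ) := by
  exact ⟨fun h ↦ h.mem hp, isGenusZeroStar_of_mem⟩
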